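/- Let K ∈ L^∞(ℝ³) be positive and suppose there exist constants C₀ > 0 and s > 0 such that K(x) ≤ C₀|x|^{−s} for all |x| ≥ 1. Then for every μ ∈ (0, min{s/6, 1}) there exists w : ℝ³ → ℝ with the following properties: w and all its weak partial derivatives up to order 3 belong to L²_{loc}(ℝ³) (i.e., for every multi-index β with |β| ≤ 3 there is g_β ∈ L²_{loc}(ℝ³) with ∫ w ∂^β φ dx = (−1)^{|β|} ∫ g_β φ dx for all φ ∈ C_c^∞(ℝ³)); Δw ∈ L_{1/2}(ℝ³); K e^{3w} ∈ L¹(ℝ³) with ∫_{ℝ³} K e^{3w} dx = 4π²(1−μ) (which equals 2(1−μ)|S³| since |S³| = 2π²); and ∫_{ℝ³} (−Δw)(x)·((−Δ)^{1/2}φ)(x) dx = ∫_{ℝ³} K(x) e^{3w(x)} φ(x) dx for every Schwartz function φ : ℝ³ → ℝ. -/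

import Mathlib

open MeasureTheory Real Filter

noncomputable section

abbrev E3 := EuclideanSpace ℝ (Fin 3)

/-- The Laplacian of `f : ℝ³ → ℝ` as the sum of second partial derivatives. -/
def lap (f : E3 → ℝ) (x : E3) : ℝ :=
  ∑ i, fderiv ℝ (fun y => fderiv ℝ f y (EuclideanSpace.single i 1)) x (EuclideanSpace.single i 1)

/-- The half Laplacian `(-Δ)^{1/2} φ` of a Schwartz function on ℝ³, defined as a
principal value: `(1/π²) lim_{ε→0⁺} ∫_{|x−y|>ε} (φ(x)−φ(y))/|x−y|⁴ dy`. -/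
def halfLap (φ : SchwartzMap E3 ℝ) (x : E3) : ℝ :=
  limUnder (nhdsWithin (0:ℝ) (Set.Ioi 0)) fun ε =>
    (1 / π ^ 2) * ∫ y in {y : E3 | ε < ‖x - y‖}, (φ x - φ y) / ‖x - y‖ ^ 4

/-- `w ∈ L_{1/2}(ℝ³)`. -/
def MemL12 (w : E3 → ℝ) : Prop :=
  LocallyIntegrable w volume ∧ Integrable (fun x => |w x| / (1 + ‖x‖ ^ 4)) volume

/-- `u` is a smooth solution of `(-Δ)^{3/2} u = 2 e^{3u}` in ℝ³ with finite volume. -/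
def IsSolution (u : E3 → ℝ) : Prop :=
  ContDiff ℝ (⊤ : ℕ∞) u ∧ MemL12 (lap u) ∧ Integrable (fun x => exp (3 * u x)) volume ∧
    ∀ φ : SchwartzMap E3 ℝ,
      ∫ x, (-(lap u x)) * halfLap φ x = 2 * ∫ x, exp (3 * u x) * φ x

/-- `u` is a spherical solution. -/
def IsSpherical (u : E3 → ℝ) : Prop :=
  ∃ lam : ℝ, 0 < lam ∧ ∃ x₀ : E3, ∀ x, u x = log (2 * lam / (1 + lam ^ 2 * ‖x - x₀‖ ^ 2))

/-- `α = (1/π²) ∫ e^{3u}`. -/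
def solAlpha (u : E3 → ℝ) : ℝ := (1 / π ^ 2) * ∫ y, exp (3 * u y)

/-- `v(x) = (1/π²) ∫ log(|y|/|x−y|) e^{3u(y)} dy`. -/
def solV (u : E3 → ℝ) (x : E3) : ℝ :=
  (1 / π ^ 2) * ∫ y, log (‖y‖ / ‖x - y‖) * exp (3 * u y)

end

noncomputable section

/-- The partial derivative in the `i`-th coordinate direction. -/
def pd (i : Fin 3) (f : E3 → ℝ) : E3 → ℝ :=
  fun x => fderiv ℝ f x (EuclideanSpace.single i 1)

/-- The iterated partial derivative `∂^β` corresponding to a multi-index `β`. -/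
def pdM (β : Fin 3 → ℕ) (f : E3 → ℝ) : E3 → ℝ :=
  (pd 0)^[β 0] ((pd 1)^[β 1] ((pd 2)^[β 2] f))

end

section MeanField

variable {X : Type*} [MeasurableSpace X]

/-- A nonnegative symmetric kernel with at most logarithmic singularities. -/
structure IsExpKernel (ν : Measure X) (G : X → X → ℝ) : Prop where
  meas : Measurable (Function.uncurry G)
  symm : ∀ x y, G x y = G y x
  nonneg : ∀ x y, 0 ≤ G x y
  exp_int : ∀ γ : ℝ, 0 < γ → γ < 3 →
    ∃ C, ∀ x, Integrable (fun y => exp (γ * G x y)) ν ∧ ∫ y, exp (γ * G x y) ∂ν ≤ C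

/-- A nonnegative symmetric kernel with at most logarithmic singularities, conditionally positive
semidefinite with respect to `ν`. -/
structure IsLogKernel (ν : Measure X) (G : X → X → ℝ) : Prop extends IsExpKernel ν G where
  psd : ∀ σ : X → ℝ, Measurable σ → (∃ M, ∀ x, |σ x| ≤ M) → ∫ x, σ x ∂ν = 0 →
    0 ≤ ∫ x, (∫ y, G x y * σ y ∂ν) * σ x ∂ν

/-- Bounded measurable functions. -/
def BddMeas (f : X → ℝ) : Prop := Measurable f ∧ ∃ M, ∀ x, |f x| ≤ M

lemma BddMeas.integrable {ν : Measure X} [IsFiniteMeasure ν] {f : X → ℝ} (hf : BddMeas f) :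
    Integrable f ν := by
  obtain ⟨hm, M, hM⟩ := hf
  exact Integrable.of_bound hm.aestronglyMeasurable M (Eventually.of_forall hM)

lemma BddMeas.add {f g : X → ℝ} (hf : BddMeas f) (hg : BddMeas g) :
    BddMeas (fun x => f x + g x) := by
  obtain ⟨hm, M, hM⟩ := hf
  obtain ⟨hn, N, hN⟩ := hg
  exact ⟨hm.add hn, M + N, fun x => (abs_add_le _ _).trans (add_le_add (hM x) (hN x))⟩

lemma BddMeas.mul {f g : X → ℝ} (hf : BddMeas f) (hg : BddMeas g) :
    BddMeas (fun x => f x * g x) := by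
  obtain ⟨hm, M, hM⟩ := hf
  obtain ⟨hn, N, hN⟩ := hg
  refine ⟨hm.mul hn, M * N, fun x => ?_⟩
  rw [abs_mul]
  exact mul_le_mul (hM x) (hN x) (abs_nonneg _) ((abs_nonneg _).trans (hM x))

lemma BddMeas.const (c : ℝ) : BddMeas (fun _ : X => c) :=
  ⟨measurable_const, |c|, fun _ => le_rfl⟩

lemma BddMeas.const_mul {f : X → ℝ} (c : ℝ) (hf : BddMeas f) : BddMeas (fun x => c * f x) :=
  (BddMeas.const c).mul hf

lemma BddMeas.sub {f g : X → ℝ} (hf : BddMeas f) (hg : BddMeas g) :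
    BddMeas (fun x => f x - g x) := by
  simpa [sub_eq_add_neg] using hf.add (hg.const_mul (-1))

lemma BddMeas.exp {f : X → ℝ} (hf : BddMeas f) : BddMeas (fun x => Real.exp (f x)) := by
  obtain ⟨hm, M, hM⟩ := hf
  refine ⟨hm.exp, Real.exp M, fun x => ?_⟩
  rw [abs_of_pos (Real.exp_pos _)]
  exact Real.exp_le_exp.2 ((le_abs_self _).trans (hM x))

lemma integral_exp_pos_of_bddMeas {ν : Measure X} [IsFiniteMeasure ν] [NeZero ν] {f : X → ℝ}
    (hf : BddMeas f) : 0 < ∫ x, Real.exp (f x) ∂ν :=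
  integral_exp_pos hf.exp.integrable

/-- Gibbs variational inequality. -/
lemma gibbs_ineq {ν : Measure X} [IsFiniteMeasure ν] [NeZero ν] {ψ χ : X → ℝ}
    (hψ : BddMeas ψ) (hχ : BddMeas χ) :
    log (∫ x, exp (χ x) ∂ν) + ∫ x, (ψ x - χ x) * (exp (χ x) / ∫ x, exp (χ x) ∂ν) ∂ν
      ≤ log (∫ x, exp (ψ x) ∂ν) ∧
    (log (∫ x, exp (χ x) ∂ν) + ∫ x, (ψ x - χ x) * (exp (χ x) / ∫ x, exp (χ x) ∂ν) ∂ν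
      = log (∫ x, exp (ψ x) ∂ν) →
      ∀ᵐ x ∂ν, exp (ψ x) / ∫ x, exp (ψ x) ∂ν = exp (χ x) / ∫ x, exp (χ x) ∂ν) := by
  have hA : 0 < ∫ x, exp (ψ x) ∂ν := integral_exp_pos_of_bddMeas hψ
  have hB : 0 < ∫ x, exp (χ x) ∂ν := integral_exp_pos_of_bddMeas hχ
  set A := ∫ x, exp (ψ x) ∂ν with hAdef
  set B := ∫ x, exp (χ x) ∂ν with hBdef
  have hg : BddMeas (fun x => exp (χ x) / B) := by
    simpa [div_eq_inv_mul] using hχ.exp.const_mul B⁻¹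
  have hG : BddMeas (fun x => exp (ψ x) / A) := by
    simpa [div_eq_inv_mul] using hψ.exp.const_mul A⁻¹
  have h1 : ∫ x, exp (χ x) / B ∂ν = 1 := by
    rw [integral_div, ← hBdef, div_self hB.ne']
  have h2 : ∫ x, exp (ψ x) / A ∂ν = 1 := by
    rw [integral_div, ← hAdef, div_self hA.ne']
  set a : X → ℝ := fun x => ψ x - χ x - log A + log B with ha
  have hexp : ∀ x, (exp (χ x) / B) * exp (a x) = exp (ψ x) / A := by
    intro x
    simp only [ha]
    rw [Real.exp_add, Real.exp_sub, Real.exp_sub, Real.exp_log hA, Real.exp_log hB]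
    field_simp
  have hpt : ∀ x, 0 ≤ exp (ψ x) / A - exp (χ x) / B - (exp (χ x) / B) * a x := by
    intro x
    rw [← hexp]
    have : a x + 1 ≤ exp (a x) := Real.add_one_le_exp _
    have hp : 0 < exp (χ x) / B := by positivity
    nlinarith [mul_le_mul_of_nonneg_left this hp.le]
  have hab : BddMeas a := ((hψ.sub hχ).sub (BddMeas.const _)).add (BddMeas.const _)
  have h_integrable : Integrable (fun x => exp (ψ x) / A - exp (χ x) / B - (exp (χ x) / B) * a x) ν :=
    ((hG.sub hg).sub (hg.mul hab)).integrable
  have hval : ∫ x, (exp (ψ x) / A - exp (χ x) / B - (exp (χ x) / B) * a x) ∂ν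
      = - ∫ x, (exp (χ x) / B) * a x ∂ν := by
    rw [integral_sub (hG.sub hg).integrable (hg.mul hab).integrable,
      integral_sub hG.integrable hg.integrable, h1, h2]
    ring
  have hval2 : ∫ x, (exp (χ x) / B) * a x ∂ν
      = ∫ x, (ψ x - χ x) * (exp (χ x) / B) ∂ν - log A + log B := by
    have : ∀ x, (exp (χ x) / B) * a x
        = (ψ x - χ x) * (exp (χ x) / B) + (log B - log A) * (exp (χ x) / B) := by
      intro x; simp only [ha]; ring
    simp_rw [this]
    rw [integral_add ((hψ.sub hχ).mul hg).integrable (hg.const_mul _).integrable,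
      integral_const_mul, h1]
    ring
  have hnn : 0 ≤ ∫ x, (exp (ψ x) / A - exp (χ x) / B - (exp (χ x) / B) * a x) ∂ν :=
    integral_nonneg fun x => hpt x
  rw [hval, hval2] at hnn
  refine ⟨by linarith, fun heq => ?_⟩
  have hzero : ∫ x, (exp (ψ x) / A - exp (χ x) / B - (exp (χ x) / B) * a x) ∂ν = 0 := by
    rw [hval, hval2]; linarith
  rw [integral_eq_zero_iff_of_nonneg (fun x => hpt x) h_integrable] at hzero
  filter_upwards [hzero] with x hx
  have hp : 0 < exp (χ x) / B := by positivity
  have ha0 : a x = 0 := by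
    by_contra hne
    have := Real.add_one_lt_exp hne
    simp only [Pi.zero_apply] at hx
    rw [← hexp] at hx
    nlinarith [mul_lt_mul_of_pos_left this hp]
  rw [← hexp, ha0]; simp

end MeanField

section Potential

variable {X : Type*} [MeasurableSpace X]


/-- The potential of the density `f` with respect to the kernel `G`. -/
noncomputable def pot (ν : Measure X) (G : X → X → ℝ) (f : X → ℝ) (x : X) : ℝ :=
  ∫ y, G x y * f y ∂ν

/-- The mutual energy of two densities. -/
noncomputable def en (ν : Measure X) (G : X → X → ℝ) (f g : X → ℝ) : ℝ :=
  ∫ x, pot ν G f x * g x ∂ν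

namespace IsExpKernel

variable {ν : Measure X} {G : X → X → ℝ} (h : IsExpKernel ν G)
include h

lemma bound_int : ∃ C, 0 ≤ C ∧ ∀ x, Integrable (G x) ν ∧ ∫ y, G x y ∂ν ≤ C := by
  obtain ⟨C, hC⟩ := h.exp_int 1 one_pos (by norm_num)
  refine ⟨max C 0, le_max_right _ _, fun x => ?_⟩
  have hle : ∀ y, G x y ≤ exp (1 * G x y) := fun y => by
    rw [one_mul]; linarith [Real.add_one_le_exp (G x y)]
  have hi : Integrable (G x) ν := by
    refine (hC x).1.mono' (h.meas.of_uncurry_left).aestronglyMeasurable (Eventually.of_forall ?_)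
    intro y
    rw [Real.norm_of_nonneg (h.nonneg x y)]
    exact hle y
  exact ⟨hi, (integral_mono hi (hC x).1 hle).trans ((hC x).2.trans (le_max_left _ _))⟩

lemma integrable_prod [IsFiniteMeasure ν] {f g : X → ℝ} (hf : BddMeas f) (hg : BddMeas g) :
    Integrable (fun p : X × X => G p.1 p.2 * f p.2 * g p.1) (ν.prod ν) := by
  obtain ⟨C, hC0, hC⟩ := h.bound_int
  have hGi : Integrable (fun p : X × X => G p.1 p.2) (ν.prod ν) := by
    refine (integrable_prod_iff h.meas.aestronglyMeasurable).2
      ⟨Eventually.of_forall fun x => (hC x).1, ?_⟩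
    refine Integrable.of_bound (C := C) ?_ (Eventually.of_forall fun x => ?_)
    · exact (h.meas.norm.stronglyMeasurable.integral_prod_right).aestronglyMeasurable
    · rw [Real.norm_of_nonneg (integral_nonneg fun y => norm_nonneg _)]
      simp only [Function.uncurry, Real.norm_of_nonneg (h.nonneg x _)]
      exact (hC x).2
  obtain ⟨hfm, M, hM⟩ := hf
  obtain ⟨hgm, N, hN⟩ := hg
  exact (hGi.mul_bdd (hfm.comp measurable_snd).aestronglyMeasurable
    (Eventually.of_forall fun p => hM _)).mul_bdd (hgm.comp measurable_fst).aestronglyMeasurable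
    (Eventually.of_forall fun p => hN _)

end IsExpKernel

namespace IsLogKernel

variable {ν : Measure X} [IsFiniteMeasure ν] {G : X → X → ℝ} (h : IsLogKernel ν G)
include h

lemma int_G_mul {f : X → ℝ} (hf : BddMeas f) (x : X) : Integrable (fun y => G x y * f y) ν := by
  obtain ⟨C, -, hC⟩ := h.bound_int
  obtain ⟨hm, M, hM⟩ := hf
  exact (hC x).1.mul_bdd hm.aestronglyMeasurable (Eventually.of_forall hM)

lemma pot_abs_le : ∃ C, 0 ≤ C ∧ ∀ (f : X → ℝ) (M : ℝ), Measurable f → (∀ x, |f x| ≤ M) →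
    ∀ x, |pot ν G f x| ≤ C * M := by
  obtain ⟨C, hC0, hC⟩ := h.bound_int
  refine ⟨C, hC0, fun f M hm hM x => ?_⟩
  have hM0 : 0 ≤ M := (abs_nonneg _).trans (hM x)
  calc |pot ν G f x| ≤ ∫ y, |G x y * f y| ∂ν := abs_integral_le_integral_abs
    _ ≤ ∫ y, G x y * M ∂ν := by
      refine integral_mono (h.int_G_mul ⟨hm, M, hM⟩ x).abs ((hC x).1.mul_const M) fun y => ?_
      simp only [abs_mul, abs_of_nonneg (h.nonneg x y)]
      exact mul_le_mul_of_nonneg_left (hM y) (h.nonneg x y)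
    _ = (∫ y, G x y ∂ν) * M := integral_mul_const _ _
    _ ≤ C * M := mul_le_mul_of_nonneg_right (hC x).2 hM0

lemma pot_meas {f : X → ℝ} (hf : Measurable f) : Measurable (pot ν G f) := by
  have : StronglyMeasurable (Function.uncurry fun x y => G x y * f y) :=
    (h.meas.mul (hf.comp measurable_snd)).stronglyMeasurable
  exact this.integral_prod_right.measurable

lemma pot_bddMeas {f : X → ℝ} (hf : BddMeas f) : BddMeas (pot ν G f) := by
  obtain ⟨C, -, hC⟩ := h.pot_abs_le
  exact ⟨h.pot_meas hf.1, _, hC f _ hf.1 hf.2.choose_spec⟩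

lemma en_comm {f g : X → ℝ} (hf : BddMeas f) (hg : BddMeas g) : en ν G f g = en ν G g f := by
  unfold en pot
  simp_rw [← integral_mul_const]
  rw [integral_integral_swap (h.integrable_prod hf hg)]
  refine integral_congr_ae (Eventually.of_forall fun y => ?_)
  refine integral_congr_ae (Eventually.of_forall fun x => ?_)
  simp only [h.symm x y]; ring

lemma pot_sub {f g : X → ℝ} (hf : BddMeas f) (hg : BddMeas g) (x : X) :
    pot ν G (fun y => f y - g y) x = pot ν G f x - pot ν G g x := by
  unfold pot
  rw [← integral_sub (h.int_G_mul hf x) (h.int_G_mul hg x)]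
  simp_rw [mul_sub]

lemma pot_nonneg {f : X → ℝ} (hf : ∀ x, 0 ≤ f x) (x : X) : 0 ≤ pot ν G f x :=
  integral_nonneg fun y => mul_nonneg (h.nonneg x y) (hf y)

lemma en_nonneg {f g : X → ℝ} (hf : ∀ x, 0 ≤ f x) (hg : ∀ x, 0 ≤ g x) : 0 ≤ en ν G f g :=
  integral_nonneg fun x => mul_nonneg (h.pot_nonneg hf x) (hg x)

lemma en_sub_nonneg {f g : X → ℝ} (hf : BddMeas f) (hg : BddMeas g)
    (hfg : ∫ x, f x ∂ν = ∫ x, g x ∂ν) :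
    0 ≤ en ν G f f - 2 * en ν G f g + en ν G g g := by
  have h0 := h.psd (fun x => f x - g x) (hf.sub hg).1 (hf.sub hg).2
    (by rw [integral_sub hf.integrable hg.integrable, hfg, sub_self])
  have e1 : ∀ x, (∫ y, G x y * (f y - g y) ∂ν) * (f x - g x)
      = pot ν G f x * f x - pot ν G f x * g x - (pot ν G g x * f x - pot ν G g x * g x) := by
    intro x
    have := h.pot_sub hf hg x
    unfold pot at this ⊢
    rw [this]; ring
  simp_rw [e1] at h0
  have hPf := h.pot_bddMeas hf
  have hPg := h.pot_bddMeas hg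
  rw [integral_sub ((hPf.mul hf).sub (hPf.mul hg)).integrable
    ((hPg.mul hf).sub (hPg.mul hg)).integrable,
    integral_sub (hPf.mul hf).integrable (hPf.mul hg).integrable,
    integral_sub (hPg.mul hf).integrable (hPg.mul hg).integrable] at h0
  have hc := h.en_comm hf hg
  unfold en at *
  linarith

end IsLogKernel
end Potential

section Gibbs

variable {X : Type*} [MeasurableSpace X]

/-- Bounded probability densities with respect to `ν`. -/
def IsDens (ν : Measure X) (f : X → ℝ) : Prop :=
  Measurable f ∧ (∃ M, ∀ x, f x ≤ M) ∧ (∀ x, 0 ≤ f x) ∧ ∫ x, f x ∂ν = 1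

lemma IsDens.bddMeas {ν : Measure X} {f : X → ℝ} (hf : IsDens ν f) : BddMeas f := by
  obtain ⟨hm, ⟨M, hM⟩, h0, -⟩ := hf
  exact ⟨hm, M, fun x => by rw [abs_of_nonneg (h0 x)]; exact hM x⟩

/-- The partition function of the potential of `f` at inverse temperature `q`. -/
noncomputable def part (ν : Measure X) (G : X → X → ℝ) (q : ℝ) (f : X → ℝ) : ℝ :=
  ∫ x, exp (q * pot ν G f x) ∂ν

/-- The Gibbs density associated with the potential of `f`. -/
noncomputable def gib (ν : Measure X) (G : X → X → ℝ) (q : ℝ) (f : X → ℝ) (x : X) : ℝ :=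
  exp (q * pot ν G f x) / part ν G q f

/-- The Moser-Trudinger (mean field) functional. -/
noncomputable def mtJ (ν : Measure X) (G : X → X → ℝ) (β : ℝ) (f : X → ℝ) : ℝ :=
  β / 2 * en ν G f f - log (part ν G β f)

namespace IsLogKernel

variable {ν : Measure X} [IsFiniteMeasure ν] {G : X → X → ℝ} (h : IsLogKernel ν G)
include h

lemma part_pos [NeZero ν] (q : ℝ) {f : X → ℝ} (hf : BddMeas f) : 0 < part ν G q f :=
  integral_exp_pos_of_bddMeas ((h.pot_bddMeas hf).const_mul q)

lemma le_part {q : ℝ} (hq : 0 ≤ q) {f : X → ℝ} (hf : IsDens ν f) :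
    ν.real Set.univ ≤ part ν G q f := by
  have : ∫ _, (1:ℝ) ∂ν ≤ part ν G q f := by
    refine integral_mono (integrable_const _)
      ((h.pot_bddMeas hf.bddMeas).const_mul q).exp.integrable fun x => ?_
    exact Real.one_le_exp (mul_nonneg hq (h.pot_nonneg hf.2.2.1 x))
  simpa using this

lemma isDens_gib [NeZero ν] (q : ℝ) {f : X → ℝ} (hf : BddMeas f) : IsDens ν (gib ν G q f) := by
  have hp := h.part_pos q hf
  have hb : BddMeas (gib ν G q f) := by
    have := (((h.pot_bddMeas hf).const_mul q).exp).const_mul (part ν G q f)⁻¹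
    have e : gib ν G q f = fun x => (part ν G q f)⁻¹ * exp (q * pot ν G f x) := by
      funext x; unfold gib; rw [div_eq_inv_mul]
    rw [e]; exact this
  refine ⟨hb.1, ?_, fun x => by unfold gib; positivity, ?_⟩
  · obtain ⟨M, hM⟩ := hb.2
    exact ⟨M, fun x => (le_abs_self _).trans (hM x)⟩
  · unfold gib
    rw [integral_div]
    exact div_self hp.ne'

/-- Jensen's inequality for the exponential of a potential. -/
lemma part_le {γ C : ℝ} (hC : ∀ x, Integrable (fun y => exp (γ * G x y)) ν ∧
    ∫ y, exp (γ * G x y) ∂ν ≤ C) {f : X → ℝ} (hf : IsDens ν f) : part ν G γ f ≤ C := by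
  have hfi : Integrable f ν := hf.bddMeas.integrable
  have hmeas : Measurable (fun p : X × X => exp (γ * G p.1 p.2)) :=
    (h.meas.const_mul γ).exp
  have h_integrable : Integrable (fun p : X × X => exp (γ * G p.1 p.2) * f p.2) (ν.prod ν) := by
    have hE : Integrable (fun p : X × X => exp (γ * G p.1 p.2)) (ν.prod ν) := by
      refine (integrable_prod_iff hmeas.aestronglyMeasurable).2
        ⟨Eventually.of_forall fun x => (hC x).1, ?_⟩
      refine Integrable.of_bound (C := C) ?_ (Eventually.of_forall fun x => ?_)
      · exact (hmeas.norm.stronglyMeasurable.integral_prod_right).aestronglyMeasurable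
      · rw [Real.norm_of_nonneg (integral_nonneg fun y => norm_nonneg _)]
        simp only [Real.norm_of_nonneg (exp_pos _).le]
        exact (hC x).2
    obtain ⟨hfm, M, hM⟩ := hf.bddMeas
    exact hE.mul_bdd (hfm.comp measurable_snd).aestronglyMeasurable
      (Eventually.of_forall fun p => hM _)
  have hpt : ∀ x, exp (γ * pot ν G f x) ≤ ∫ y, exp (γ * G x y) * f y ∂ν := by
    intro x
    set c := γ * pot ν G f x with hc
    have hGf := h.int_G_mul hf.bddMeas x
    have h1 : ∫ y, exp c * ((1 - c) * f y + γ * (G x y * f y)) ∂ν = exp c := by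
      rw [integral_const_mul, integral_add (hfi.const_mul _) (hGf.const_mul _),
        integral_const_mul, integral_const_mul, hf.2.2.2]
      change exp c * ((1 - c) * 1 + c) = exp c
      ring
    rw [← h1]
    refine integral_mono (((hfi.const_mul _).add (hGf.const_mul _)).const_mul _) ?_ fun y => ?_
    · obtain ⟨hfm, M, hM⟩ := hf.bddMeas
      exact (hC x).1.mul_bdd hfm.aestronglyMeasurable (Eventually.of_forall hM)
    · have := Real.add_one_le_exp (γ * G x y - c)
      rw [Real.exp_sub, le_div_iff₀ (exp_pos _)] at this
      have h2 := mul_le_mul_of_nonneg_right this (hf.2.2.1 y)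
      calc _ = (γ * G x y - c + 1) * exp c * f y := by ring
        _ ≤ _ := h2
  calc part ν G γ f ≤ ∫ x, ∫ y, exp (γ * G x y) * f y ∂ν ∂ν :=
        integral_mono ((h.pot_bddMeas hf.bddMeas).const_mul γ).exp.integrable
          h_integrable.integral_prod_left hpt
    _ = ∫ y, ∫ x, exp (γ * G x y) * f y ∂ν ∂ν := integral_integral_swap h_integrable
    _ ≤ ∫ y, C * f y ∂ν := by
      refine integral_mono h_integrable.integral_prod_right (hfi.const_mul _) fun y => ?_
      simp only [integral_mul_const]
      refine mul_le_mul_of_nonneg_right ?_ (hf.2.2.1 y)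
      simp_rw [fun x => h.symm x y]
      exact (hC y).2
    _ = C := by rw [integral_const_mul, hf.2.2.2, mul_one]

lemma coercive [NeZero ν] {γ C : ℝ} (hC : ∀ x, Integrable (fun y => exp (γ * G x y)) ν ∧
    ∫ y, exp (γ * G x y) ∂ν ≤ C) (q : ℝ) {f : X → ℝ} (hf : IsDens ν f) :
    log (part ν G q f) + γ * en ν G (gib ν G q f) (gib ν G q f) - q * en ν G f (gib ν G q f)
      ≤ log C := by
  have hg := h.isDens_gib q hf.bddMeas
  have hPf := h.pot_bddMeas hf.bddMeas
  have hPg := h.pot_bddMeas hg.bddMeas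
  have h1 := (gibbs_ineq (ν := ν) (hPg.const_mul γ) (hPf.const_mul q)).1
  have h2 : log (part ν G γ (gib ν G q f)) ≤ log C :=
    Real.log_le_log (h.part_pos γ hg.bddMeas) (h.part_le hC hg)
  have h3 : ∫ x, (γ * pot ν G (gib ν G q f) x - q * pot ν G f x) * gib ν G q f x ∂ν
      = γ * en ν G (gib ν G q f) (gib ν G q f) - q * en ν G f (gib ν G q f) := by
    unfold en
    rw [← integral_const_mul, ← integral_const_mul, ← integral_sub]
    · refine integral_congr_ae (Eventually.of_forall fun x => ?_)
      simp only; ring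
    · exact ((hPg.mul hg.bddMeas).const_mul γ).integrable
    · exact ((hPf.mul hg.bddMeas).const_mul q).integrable
  change log (part ν G q f) + ∫ x, (γ * pot ν G (gib ν G q f) x - q * pot ν G f x)
    * gib ν G q f x ∂ν ≤ log (part ν G γ (gib ν G q f)) at h1
  rw [h3] at h1
  linarith

lemma descent [NeZero ν] (β : ℝ) (hβ : 0 ≤ β) {f : X → ℝ} (hf : IsDens ν f) :
    mtJ ν G β (gib ν G β f) ≤ mtJ ν G β f ∧
    (mtJ ν G β f ≤ mtJ ν G β (gib ν G β f) →
      ∀ᵐ x ∂ν, gib ν G β (gib ν G β f) x = gib ν G β f x) := by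
  have hg := h.isDens_gib β hf.bddMeas
  have hPf := h.pot_bddMeas hf.bddMeas
  have hPg := h.pot_bddMeas hg.bddMeas
  obtain ⟨h1, h1'⟩ := gibbs_ineq (ν := ν) (hPg.const_mul β) (hPf.const_mul β)
  have h3 : ∫ x, (β * pot ν G (gib ν G β f) x - β * pot ν G f x) * gib ν G β f x ∂ν
      = β * en ν G (gib ν G β f) (gib ν G β f) - β * en ν G f (gib ν G β f) := by
    unfold en
    rw [← integral_const_mul, ← integral_const_mul, ← integral_sub]
    · refine integral_congr_ae (Eventually.of_forall fun x => ?_)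
      simp only; ring
    · exact ((hPg.mul hg.bddMeas).const_mul β).integrable
    · exact ((hPf.mul hg.bddMeas).const_mul β).integrable
  change log (part ν G β f) + ∫ x, (β * pot ν G (gib ν G β f) x - β * pot ν G f x)
    * gib ν G β f x ∂ν ≤ log (part ν G β (gib ν G β f)) at h1
  change log (part ν G β f) + ∫ x, (β * pot ν G (gib ν G β f) x - β * pot ν G f x)
    * gib ν G β f x ∂ν = log (part ν G β (gib ν G β f)) →
    ∀ᵐ x ∂ν, gib ν G β (gib ν G β f) x = gib ν G β f x at h1'
  rw [h3] at h1 h1'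
  have h4 := mul_nonneg hβ (h.en_sub_nonneg hf.bddMeas hg.bddMeas
    (hf.2.2.2.trans hg.2.2.2.symm))
  unfold mtJ
  exact ⟨by linarith, fun hle => h1' (by linarith)⟩

lemma energy_le [NeZero ν] {γ C : ℝ} (hC : ∀ x, Integrable (fun y => exp (γ * G x y)) ν ∧
    ∫ y, exp (γ * G x y) ∂ν ≤ C) {β : ℝ} (hβ : 0 ≤ β) {f : X → ℝ} (hf : IsDens ν f) :
    (γ - β / 2) * en ν G (gib ν G β f) (gib ν G β f) ≤ mtJ ν G β f + log C := by
  have hg := h.isDens_gib β hf.bddMeas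
  have h1 := h.coercive hC β hf
  have h4 := mul_nonneg hβ (h.en_sub_nonneg hf.bddMeas hg.bddMeas
    (hf.2.2.2.trans hg.2.2.2.symm))
  unfold mtJ
  linarith

lemma part_two_le [NeZero ν] {γ C : ℝ} (hγ : 0 ≤ γ)
    (hC : ∀ x, Integrable (fun y => exp (γ * G x y)) ν ∧
    ∫ y, exp (γ * G x y) ∂ν ≤ C) {f : X → ℝ} (hf : IsDens ν f) :
    log (part ν G (2 * γ) f) ≤ log C + γ * en ν G f f := by
  have hg := h.isDens_gib (2 * γ) hf.bddMeas
  have h1 := h.coercive hC (2 * γ) hf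
  have h4 := mul_nonneg hγ (h.en_sub_nonneg hf.bddMeas hg.bddMeas
    (hf.2.2.2.trans hg.2.2.2.symm))
  linarith

lemma pot_gib_le [NeZero ν] {β γ : ℝ} (hβ : 0 < β) (hβγ : β < 2 * γ) :
    ∃ D, 0 ≤ D ∧ ∀ f, IsDens ν f → ∀ x, pot ν G (gib ν G β f) x ≤ D * (1 + part ν G (2 * γ) f) := by
  obtain ⟨C, hC⟩ := h.exp_int 1 one_pos (by norm_num)
  have hγ : 0 < 2 * γ := hβ.trans hβγ
  have hν : 0 < ν.real Set.univ := by
    simp [measureReal_def, ENNReal.toReal_pos_iff, measure_lt_top, NeZero.ne ν]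
  set θ := β / (2 * γ) with hθ
  have hθ0 : 0 < θ := by positivity
  have hθ1 : θ < 1 := by rw [hθ, div_lt_one hγ]; exact hβγ
  refine ⟨(ν.real Set.univ)⁻¹ * (1 - θ)⁻¹ * max C 1, ?_, fun f hf x => ?_⟩
  · have : 0 < 1 - θ := by linarith
    positivity
  have hPf := h.pot_bddMeas hf.bddMeas
  have hp := h.part_pos β hf.bddMeas
  have hle := h.le_part hβ.le hf
  have h1θ : 0 < 1 - θ := by linarith
  have hpt : ∀ y, G x y * gib ν G β f y ≤
      (ν.real Set.univ)⁻¹ * (1 - θ)⁻¹ * (exp (1 * G x y) + exp (2 * γ * pot ν G f y)) := by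
    intro y
    have hV := h.pot_nonneg hf.2.2.1 y
    have h1 : gib ν G β f y ≤ (ν.real Set.univ)⁻¹ * exp (β * pot ν G f y) := by
      unfold gib
      rw [div_eq_inv_mul]
      gcongr
    have h2 : G x y ≤ (1 - θ)⁻¹ * exp ((1 - θ) * G x y) := by
      rw [inv_mul_eq_div, le_div_iff₀ h1θ]
      linarith [Real.add_one_le_exp ((1 - θ) * G x y)]
    have h3 : exp ((1 - θ) * G x y) * exp (β * pot ν G f y)
        ≤ exp (1 * G x y) + exp (2 * γ * pot ν G f y) := by
      have hc := convexOn_exp.2 (Set.mem_univ (1 * G x y)) (Set.mem_univ (2 * γ * pot ν G f y))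
        h1θ.le hθ0.le (by ring)
      rw [← Real.exp_add]
      have e : (1 - θ) * G x y + β * pot ν G f y
          = (1 - θ) • (1 * G x y) + θ • (2 * γ * pot ν G f y) := by
        have : β = θ * (2 * γ) := (div_mul_cancel₀ β hγ.ne').symm
        rw [this]; simp only [smul_eq_mul]; ring
      rw [e]
      refine hc.trans ?_
      simp only [smul_eq_mul]
      have ha := exp_pos (1 * G x y)
      have hb := exp_pos (2 * γ * pot ν G f y)
      nlinarith
    calc G x y * gib ν G β f y
        ≤ ((1 - θ)⁻¹ * exp ((1 - θ) * G x y)) * ((ν.real Set.univ)⁻¹ * exp (β * pot ν G f y)) := by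
          refine mul_le_mul h2 h1 ?_ (by positivity)
          unfold gib; positivity
      _ = (ν.real Set.univ)⁻¹ * (1 - θ)⁻¹ *
          (exp ((1 - θ) * G x y) * exp (β * pot ν G f y)) := by ring
      _ ≤ _ := by gcongr
  have hi2 : Integrable (fun y => exp (2 * γ * pot ν G f y)) ν := (hPf.const_mul _).exp.integrable
  calc pot ν G (gib ν G β f) x
      ≤ ∫ y, (ν.real Set.univ)⁻¹ * (1 - θ)⁻¹ *
          (exp (1 * G x y) + exp (2 * γ * pot ν G f y)) ∂ν :=
        integral_mono (h.int_G_mul (h.isDens_gib β hf.bddMeas).bddMeas x)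
          (((hC x).1.add hi2).const_mul _) hpt
    _ = (ν.real Set.univ)⁻¹ * (1 - θ)⁻¹ * (∫ y, exp (1 * G x y) ∂ν + part ν G (2 * γ) f) := by
        rw [integral_const_mul, integral_add (hC x).1 hi2]; rfl
    _ ≤ (ν.real Set.univ)⁻¹ * (1 - θ)⁻¹ * (max C 1 + max C 1 * part ν G (2 * γ) f) := by
        have hpp := h.part_pos (2 * γ) hf.bddMeas
        have : 1 * part ν G (2 * γ) f ≤ max C 1 * part ν G (2 * γ) f := by
          gcongr; exact le_max_right _ _
        gcongr
        · exact (hC x).2.trans (le_max_left _ _)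
        · linarith
    _ = _ := by ring

/-- Densities of bounded mean field energy become uniformly bounded after three Gibbs steps. -/
lemma gib_iterate_bounded [NeZero ν] {β : ℝ} (hβ : 0 < β) (hβ6 : β < 6) (J₀ : ℝ) :
    ∃ M, ∀ f, IsDens ν f → mtJ ν G β f ≤ J₀ →
      ∀ x, gib ν G β (gib ν G β (gib ν G β f)) x ≤ M := by
  set γ := (β / 2 + 3) / 2 with hγ
  obtain ⟨C, hC⟩ := h.exp_int γ (by rw [hγ]; linarith) (by rw [hγ]; linarith)
  obtain ⟨D, hD0, hD⟩ := h.pot_gib_le (β := β) (γ := γ) hβ (by rw [hγ]; linarith)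
  have hν : 0 < ν.real Set.univ := by
    simp [measureReal_def, ENNReal.toReal_pos_iff, measure_lt_top, NeZero.ne ν]
  have hd : 0 < γ - β / 2 := by rw [hγ]; linarith
  have hγ0 : 0 < γ := by rw [hγ]; linarith
  set E := (J₀ + log C) / (γ - β / 2)
  set Q := exp (log C + γ * E)
  refine ⟨(ν.real Set.univ)⁻¹ * exp (β * (D * (1 + Q))), fun f hf hJ x => ?_⟩
  have hf1 := h.isDens_gib β hf.bddMeas
  have hf2 := h.isDens_gib β hf1.bddMeas
  have hE : en ν G (gib ν G β f) (gib ν G β f) ≤ E := by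
    rw [le_div_iff₀' hd]
    linarith [h.energy_le hC hβ.le hf]
  have hQ : part ν G (2 * γ) (gib ν G β f) ≤ Q := by
    rw [← Real.exp_log (h.part_pos (2 * γ) hf1.bddMeas)]
    refine Real.exp_le_exp.2 ((h.part_two_le hγ0.le hC hf1).trans ?_)
    gcongr
  have hle := h.le_part hβ.le hf2
  have hp := h.part_pos β hf2.bddMeas
  have hV := hD _ hf1 x
  have hV' : pot ν G (gib ν G β (gib ν G β f)) x ≤ D * (1 + Q) := hV.trans (by gcongr)
  change exp (β * pot ν G (gib ν G β (gib ν G β f)) x) /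
    part ν G β (gib ν G β (gib ν G β f)) ≤ _
  rw [div_eq_inv_mul]
  gcongr

end IsLogKernel
end Gibbs

section WeakCompactness

variable {X : Type*} [MeasurableSpace X]

/-- A uniformly bounded sequence of functions on a finite separable measure space has a
subsequence along which all integrals against square integrable functions converge. -/
lemma exists_subseq_tendsto_integral_mul {ν : Measure X} [IsFiniteMeasure ν] [IsSeparable ν]
    {g : ℕ → X → ℝ} {M : ℝ} (hg : ∀ n, Measurable (g n)) (hM : ∀ n x, |g n x| ≤ M) :
    ∃ k : ℕ → ℕ, StrictMono k ∧ ∀ F : X → ℝ, MemLp F 2 ν →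
      ∃ l, Tendsto (fun n => ∫ y, F y * g (k n) y ∂ν) atTop (nhds l) := by
  have hmem : ∀ n, MemLp (g n) 2 ν := fun n =>
    MemLp.of_bound (hg n).aestronglyMeasurable M (Eventually.of_forall (hM n))
  set R : ℝ := (measureUnivNNReal ν : ℝ) ^ (2 : ENNReal).toReal⁻¹ * max M 0
  have : Fact ((2 : ENNReal) ≠ ⊤) := ⟨by simp⟩
  set T : ℕ → WeakDual ℝ (Lp ℝ 2 ν) := fun n =>
    StrongDual.toWeakDual (InnerProductSpace.toDual ℝ (Lp ℝ 2 ν) (hmem n).toLp)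
  have hT : ∀ n, T n ∈ WeakDual.toStrongDual ⁻¹' Metric.closedBall (0 : StrongDual ℝ (Lp ℝ 2 ν)) R := by
    intro n
    simp only [Set.mem_preimage, mem_closedBall_zero_iff, T]
    change ‖InnerProductSpace.toDual ℝ (Lp ℝ 2 ν) (hmem n).toLp‖ ≤ R
    rw [LinearIsometryEquiv.norm_map]
    refine Lp.norm_le_of_ae_bound (le_max_right M 0) ?_
    filter_upwards [(hmem n).coeFn_toLp] with x hx
    rw [hx]; exact (hM n x).trans (le_max_left _ _)
  obtain ⟨a, -, k, hk, hlim⟩ := WeakDual.isSeqCompact_closedBall ℝ (Lp ℝ 2 ν) 0 R hT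
  refine ⟨k, hk, fun F hF => ⟨a hF.toLp, ?_⟩⟩
  have h1 := ((WeakDual.eval_continuous hF.toLp).tendsto a).comp hlim
  refine h1.congr fun n => ?_
  change inner ℝ (hmem (k n)).toLp hF.toLp = _
  rw [L2.inner_def]
  refine integral_congr_ae ?_
  filter_upwards [(hmem (k n)).coeFn_toLp, hF.coeFn_toLp] with x h1 h2
  rw [h1, h2]
  simp

end WeakCompactness

section FixedPoint

variable {X : Type*} [MeasurableSpace X]

namespace IsLogKernel

variable {ν : Measure X} [IsFiniteMeasure ν] {G : X → X → ℝ} (h : IsLogKernel ν G)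
include h

lemma memLp_two (x : X) : MemLp (G x) 2 ν := by
  obtain ⟨C, hC⟩ := h.exp_int 1 one_pos (by norm_num)
  have hm : Measurable (G x) := h.meas.of_uncurry_left
  rw [memLp_two_iff_integrable_sq hm.aestronglyMeasurable]
  refine ((hC x).1.const_mul 2).mono' (hm.pow_const 2).aestronglyMeasurable
    (Eventually.of_forall fun y => ?_)
  rw [Real.norm_of_nonneg (sq_nonneg _)]
  have := Real.quadratic_le_exp_of_nonneg (mul_nonneg zero_le_one (h.nonneg x y))
  have := h.nonneg x y
  rw [one_mul] at *
  nlinarith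

/-- Dominated convergence for Gibbs densities along pointwise convergent potentials. -/
lemma tendsto_gib [NeZero ν] {q : ℝ} {g : ℕ → X → ℝ} {B : ℝ} {U : X → ℝ}
    (hg : ∀ n, BddMeas (g n)) (hB : ∀ n x, |pot ν G (g n) x| ≤ B)
    (hU : ∀ x, Tendsto (fun n => pot ν G (g n) x) atTop (nhds (U x))) :
    BddMeas U ∧ ∀ x, Tendsto (fun n => gib ν G q (g n) x) atTop
      (nhds (exp (q * U x) / ∫ y, exp (q * U y) ∂ν)) := by
  have hUm : Measurable U := measurable_of_tendsto_metrizable (fun n => h.pot_meas (hg n).1)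
    (tendsto_pi_nhds.2 hU)
  have hUB : ∀ x, |U x| ≤ B := fun x =>
    le_of_tendsto ((hU x).abs) (Eventually.of_forall fun n => hB n x)
  have hUb : BddMeas U := ⟨hUm, B, hUB⟩
  have he : ∀ x, Tendsto (fun n => exp (q * pot ν G (g n) x)) atTop (nhds (exp (q * U x))) :=
    fun x => (Real.continuous_exp.tendsto _).comp ((hU x).const_mul q)
  refine ⟨hUb, fun x => (he x).div ?_ (integral_exp_pos_of_bddMeas (hUb.const_mul q)).ne'⟩
  refine tendsto_integral_of_dominated_convergence (fun _ => exp (|q| * B))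
    (fun n => ((h.pot_bddMeas (hg n)).const_mul q).exp.1.aestronglyMeasurable)
    (integrable_const _) (fun n => Eventually.of_forall fun x => ?_)
    (Eventually.of_forall he)
  rw [Real.norm_of_nonneg (exp_pos _).le]
  refine Real.exp_le_exp.2 ((le_abs_self _).trans ?_)
  rw [abs_mul]
  exact mul_le_mul_of_nonneg_left (hB n x) (abs_nonneg q)

/-- Bounded pointwise convergence of densities gives convergence of potentials. -/
lemma tendsto_pot {g : ℕ → X → ℝ} {B : ℝ} {u : X → ℝ}
    (hg : ∀ n, Measurable (g n)) (hB : ∀ n x, |g n x| ≤ B)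
    (hu : ∀ x, Tendsto (fun n => g n x) atTop (nhds (u x))) (x : X) :
    Tendsto (fun n => pot ν G (g n) x) atTop (nhds (pot ν G u x)) := by
  obtain ⟨C, -, hC⟩ := h.bound_int
  refine tendsto_integral_of_dominated_convergence (fun y => G x y * B)
    (fun n => ((hC x).1.aestronglyMeasurable.mul (hg n).aestronglyMeasurable))
    ((hC x).1.mul_const B) (fun n => Eventually.of_forall fun y => ?_)
    (Eventually.of_forall fun y => (hu y).const_mul _)
  rw [norm_mul, Real.norm_of_nonneg (h.nonneg x y)]
  exact mul_le_mul_of_nonneg_left (hB n y) (h.nonneg x y)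

lemma tendsto_mtJ [NeZero ν] {β : ℝ} {g : ℕ → X → ℝ} {B : ℝ} {u : X → ℝ}
    (hg : ∀ n, Measurable (g n)) (hB : ∀ n x, |g n x| ≤ B)
    (hu : ∀ x, Tendsto (fun n => g n x) atTop (nhds (u x))) (hub : BddMeas u) :
    Tendsto (fun n => mtJ ν G β (g n)) atTop (nhds (mtJ ν G β u)) := by
  obtain ⟨C, hC0, hC⟩ := h.pot_abs_le
  have hgb : ∀ n, BddMeas (g n) := fun n => ⟨hg n, B, hB n⟩
  have hp := h.tendsto_pot hg hB hu
  have hP : ∀ n x, |pot ν G (g n) x| ≤ C * B := fun n => hC _ _ (hg n) (hB n)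
  have h1 : Tendsto (fun n => en ν G (g n) (g n)) atTop (nhds (en ν G u u)) := by
    refine tendsto_integral_of_dominated_convergence (fun _ => C * B * B)
      (fun n => ((h.pot_bddMeas (hgb n)).mul (hgb n)).1.aestronglyMeasurable)
      (integrable_const _) (fun n => Eventually.of_forall fun x => ?_)
      (Eventually.of_forall fun x => (hp x).mul (hu x))
    rw [norm_mul]
    exact mul_le_mul (hP n x) (hB n x) (norm_nonneg _) ((abs_nonneg _).trans (hP n x))
  have h2 : Tendsto (fun n => part ν G β (g n)) atTop (nhds (part ν G β u)) := by
    refine tendsto_integral_of_dominated_convergence (fun _ => exp (|β| * (C * B)))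
      (fun n => ((h.pot_bddMeas (hgb n)).const_mul β).exp.1.aestronglyMeasurable)
      (integrable_const _) (fun n => Eventually.of_forall fun x => ?_)
      (Eventually.of_forall fun x => (Real.continuous_exp.tendsto _).comp ((hp x).const_mul β))
    rw [Real.norm_of_nonneg (exp_pos _).le]
    refine Real.exp_le_exp.2 ((le_abs_self _).trans ?_)
    rw [abs_mul]
    exact mul_le_mul_of_nonneg_left (hP n x) (abs_nonneg β)
  exact (h1.const_mul _).sub (h2.log (h.part_pos β hub).ne')

/-- Existence of a bounded solution of the mean field equation. -/
theorem exists_gib_eq_self [NeZero ν] [IsSeparable ν] {β : ℝ} (hβ : 0 < β) (hβ6 : β < 6) :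
    ∃ f, IsDens ν f ∧ ∀ x, f x = gib ν G β f x := by
  have hν : 0 < ν.real Set.univ := by
    simp [measureReal_def, ENNReal.toReal_pos_iff, measure_lt_top, NeZero.ne ν]
  obtain ⟨C₁, hC₁⟩ := h.exp_int (β / 2) (by linarith) (by linarith)
  have hlow : ∀ f, IsDens ν f → - log C₁ ≤ mtJ ν G β f := by
    intro f hf
    have := h.energy_le hC₁ hβ.le hf
    simp only [sub_self, zero_mul] at this
    linarith
  set S : Set ℝ := mtJ ν G β '' {f | IsDens ν f} with hS
  have hSb : BddBelow S := ⟨- log C₁, by rintro _ ⟨f, hf, rfl⟩; exact hlow f hf⟩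
  have hSn : S.Nonempty := ⟨_, gib ν G β (fun _ => 0), h.isDens_gib β (BddMeas.const 0), rfl⟩
  obtain ⟨v, -, hv, hvS⟩ := exists_seq_tendsto_sInf hSn hSb
  choose f hf hfv using hvS
  have hinf : ∀ u, IsDens ν u → sInf S ≤ mtJ ν G β u := fun u hu => csInf_le hSb ⟨u, hu, rfl⟩
  obtain ⟨J₀, hJ₀⟩ := hv.bddAbove_range
  obtain ⟨M, hM⟩ := h.gib_iterate_bounded hβ hβ6 J₀
  set g : ℕ → X → ℝ := fun n => gib ν G β (gib ν G β (gib ν G β (f n))) with hg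
  have hf1 := fun n => h.isDens_gib β (hf n).bddMeas
  have hf2 := fun n => h.isDens_gib β (hf1 n).bddMeas
  have hf3 : ∀ n, IsDens ν (g n) := fun n => h.isDens_gib β (hf2 n).bddMeas
  have hgM : ∀ n x, |g n x| ≤ M := fun n x => by
    rw [abs_of_nonneg ((hf3 n).2.2.1 x)]
    exact hM _ (hf n) (by rw [hfv]; exact hJ₀ ⟨n, rfl⟩) x
  obtain ⟨k, hk, hlim⟩ := exists_subseq_tendsto_integral_mul (ν := ν) (fun n => (hf3 n).1) hgM
  choose U hU using fun x => hlim (G x) (h.memLp_two x)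
  obtain ⟨C, hC0, hC⟩ := h.pot_abs_le
  have hP : ∀ n x, |pot ν G (g (k n)) x| ≤ C * M := fun n => hC _ _ (hf3 _).1 (hgM _)
  obtain ⟨hUb, hconv⟩ := h.tendsto_gib (q := β) (fun n => (hf3 (k n)).bddMeas) hP hU
  set u : X → ℝ := fun x => exp (β * U x) / ∫ y, exp (β * U y) ∂ν with hu
  have hZ := integral_exp_pos_of_bddMeas (ν := ν) (hUb.const_mul β)
  have hub : BddMeas u := by
    have := ((hUb.const_mul β).exp).const_mul (∫ y, exp (β * U y) ∂ν)⁻¹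
    simpa only [hu, div_eq_inv_mul] using this
  have hud : IsDens ν u := by
    refine ⟨hub.1, ?_, fun x => by positivity, ?_⟩
    · obtain ⟨N, hN⟩ := hub.2
      exact ⟨N, fun x => (le_abs_self _).trans (hN x)⟩
    · rw [hu, integral_div]; exact div_self hZ.ne'
  have hfd := fun n => h.isDens_gib β (hf3 (k n)).bddMeas
  have hbd : ∀ n x, |gib ν G β (g (k n)) x| ≤ (ν.real Set.univ)⁻¹ * exp (β * (C * M)) := by
    intro n x
    rw [abs_of_nonneg ((hfd n).2.2.1 x)]
    unfold gib
    have := h.le_part hβ.le (hf3 (k n))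
    have h1 := (le_abs_self _).trans (hP n x)
    have h2 := h.part_pos β (hf3 (k n)).bddMeas
    rw [div_eq_inv_mul]
    gcongr
  have hJlim := h.tendsto_mtJ (β := β) (fun n => (hfd n).1) hbd hconv hub
  have hJle : ∀ n, mtJ ν G β (gib ν G β (g (k n))) ≤ v (k n) := by
    intro n
    rw [← hfv]
    exact (h.descent β hβ.le (hf3 _)).1.trans <| (h.descent β hβ.le (hf2 _)).1.trans <|
      (h.descent β hβ.le (hf1 _)).1.trans (h.descent β hβ.le (hf _)).1
  have hJu : mtJ ν G β u ≤ sInf S :=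
    le_of_tendsto_of_tendsto' hJlim (hv.comp hk.tendsto_atTop) hJle
  have hTu := h.isDens_gib β hud.bddMeas
  have hae := (h.descent β hβ.le hud).2 (hJu.trans (hinf _ hTu))
  refine ⟨gib ν G β (gib ν G β u), h.isDens_gib β hTu.bddMeas, fun x => ?_⟩
  have hpot : ∀ x, pot ν G (gib ν G β (gib ν G β u)) x = pot ν G (gib ν G β u) x := by
    intro x
    refine integral_congr_ae ?_
    filter_upwards [hae] with y hy
    rw [hy]
  change exp (β * pot ν G (gib ν G β u) x) / ∫ x, exp (β * pot ν G (gib ν G β u) x) ∂ν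
    = exp (β * pot ν G (gib ν G β (gib ν G β u)) x) /
      ∫ x, exp (β * pot ν G (gib ν G β (gib ν G β u)) x) ∂ν
  simp only [hpot]

end IsLogKernel
end FixedPoint

section PositiveKernels

/-- Gaussians are integrable. -/
lemma integrable_gauss {t : ℝ} (ht : 0 < t) : Integrable (fun v : E3 => exp (-t * ‖v‖ ^ 2)) := by
  refine Not.imp_symm integral_undef ?_
  rw [GaussianFourier.integral_rexp_neg_mul_sq_norm ht]
  positivity

variable {X : Type*} [MeasurableSpace X]

/-- The quadratic form of a kernel against a density. -/
noncomputable def quadForm (ν : Measure X) (B : X × X → ℝ) (σ : X → ℝ) : ℝ :=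
  ∫ p, B p * (σ p.2 * σ p.1) ∂(ν.prod ν)

lemma BddMeas.tensor {σ : X → ℝ} (hσ : BddMeas σ) :
    BddMeas (fun p : X × X => σ p.2 * σ p.1) := by
  obtain ⟨hm, M, hM⟩ := hσ
  refine ⟨(hm.comp measurable_snd).mul (hm.comp measurable_fst), M * M, fun p => ?_⟩
  rw [abs_mul]
  exact mul_le_mul (hM _) (hM _) (abs_nonneg _) ((abs_nonneg _).trans (hM p.2))

/-- Mixtures of positive semidefinite kernels are positive semidefinite. -/
lemma quadForm_mix_nonneg {ν : Measure X} [IsFiniteMeasure ν] {T : Type*} [MeasurableSpace T]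
    {m : Measure T} [SFinite m] {B : T → X × X → ℝ} (hB : Measurable (Function.uncurry B))
    {b : T → ℝ} (hb : Integrable b m) (hBb : ∀ᵐ t ∂m, ∀ p, |B t p| ≤ b t) {σ : X → ℝ}
    (hσ : BddMeas σ) (h0 : ∀ᵐ t ∂m, 0 ≤ quadForm ν (B t) σ) :
    0 ≤ quadForm ν (fun p => ∫ t, B t p ∂m) σ := by
  unfold quadForm
  obtain ⟨hSm, M, hM⟩ := hσ.tensor
  simp_rw [← integral_mul_const]
  rw [integral_integral_swap]
  · exact integral_nonneg_of_ae h0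
  · have h1 : Integrable (fun q : (X × X) × T => M * b q.2) ((ν.prod ν).prod m) :=
      ((hb.comp_snd (ν.prod ν)).const_mul M)
    refine h1.mono' ?_ ?_
    · exact ((hB.comp measurable_swap).mul (hSm.comp measurable_fst)).aestronglyMeasurable
    · have h2 : ∀ᵐ q : (X × X) × T ∂((ν.prod ν).prod m), ∀ p, |B q.2 p| ≤ b q.2 :=
        Measure.quasiMeasurePreserving_snd.ae hBb
      filter_upwards [h2] with q hq
      simp only [Function.uncurry, norm_mul, Real.norm_eq_abs]
      rw [mul_comm M]
      exact mul_le_mul (hq _) (by rw [← abs_mul]; exact hM q.1) (by positivity)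
        ((abs_nonneg _).trans (hq q.1))

lemma quadForm_gauss_nonneg {ν : Measure E3} [IsFiniteMeasure ν] {t : ℝ} (ht : 0 < t)
    {σ : E3 → ℝ} (hσ : BddMeas σ) :
    0 ≤ quadForm ν (fun p => exp (-t * ‖p.1 - p.2‖ ^ 2)) σ := by
  have h4 : 0 < 4 * t := by linarith
  set c := ∫ v : E3, exp (-(4 * t) * ‖v‖ ^ 2) with hc
  have hc0 : 0 < c := by
    rw [hc, GaussianFourier.integral_rexp_neg_mul_sq_norm h4]; positivity
  have hA : ∀ x y z : E3, exp (-(2 * t) * ‖x - z‖ ^ 2) * exp (-(2 * t) * ‖y - z‖ ^ 2)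
      = exp (-t * ‖x - y‖ ^ 2) * exp (-(4 * t) * ‖z - (1 / 2 : ℝ) • (x + y)‖ ^ 2) := by
    intro x y z
    rw [← Real.exp_add, ← Real.exp_add]
    congr 1
    have h1 := parallelogram_law_with_norm ℝ (x - z) (y - z)
    have e1 : x - z - (y - z) = x - y := by abel
    have e2 : x - z + (y - z) = (-2 : ℝ) • (z - (1 / 2 : ℝ) • (x + y)) := by module
    rw [e1, e2, norm_smul] at h1
    norm_num at h1
    norm_num
    linear_combination t * h1
  have hgi : ∀ x y : E3, Integrable (fun z : E3 =>
      exp (-(2 * t) * ‖x - z‖ ^ 2) * exp (-(2 * t) * ‖y - z‖ ^ 2)) := by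
    intro x y
    simp_rw [hA]
    exact ((integrable_gauss h4).comp_sub_right _).const_mul _
  have hval : ∀ x y : E3, ∫ z : E3, exp (-(2 * t) * ‖x - z‖ ^ 2) * exp (-(2 * t) * ‖y - z‖ ^ 2)
      = c * exp (-t * ‖x - y‖ ^ 2) := by
    intro x y
    simp_rw [hA]
    rw [integral_const_mul, integral_sub_right_eq_self
      (fun z : E3 => exp (-(4 * t) * ‖z‖ ^ 2)), mul_comm]
  obtain ⟨hm, M, hM⟩ := hσ.tensor
  have hAm : Measurable (fun q : (E3 × E3) × E3 =>
      exp (-(2 * t) * ‖q.1.1 - q.2‖ ^ 2) * exp (-(2 * t) * ‖q.1.2 - q.2‖ ^ 2)) := by fun_prop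
  have hAi : Integrable (fun q : (E3 × E3) × E3 =>
      exp (-(2 * t) * ‖q.1.1 - q.2‖ ^ 2) * exp (-(2 * t) * ‖q.1.2 - q.2‖ ^ 2))
      ((ν.prod ν).prod volume) := by
    refine (integrable_prod_iff hAm.aestronglyMeasurable).2
      ⟨Eventually.of_forall fun p => hgi p.1 p.2, ?_⟩
    have : ∀ p : E3 × E3, ∫ z : E3, ‖exp (-(2 * t) * ‖p.1 - z‖ ^ 2) *
        exp (-(2 * t) * ‖p.2 - z‖ ^ 2)‖ = c * exp (-t * ‖p.1 - p.2‖ ^ 2) := by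
      intro p
      rw [← hval]
      refine integral_congr_ae (Eventually.of_forall fun z => ?_)
      exact Real.norm_of_nonneg (by positivity)
    simp_rw [this]
    refine Integrable.of_bound (C := c) (by fun_prop) (Eventually.of_forall fun p => ?_)
    rw [Real.norm_of_nonneg (by positivity)]
    refine mul_le_of_le_one_right hc0.le (Real.exp_le_one_iff.2 ?_)
    nlinarith [sq_nonneg ‖p.1 - p.2‖]
  have key : c * quadForm ν (fun p => exp (-t * ‖p.1 - p.2‖ ^ 2)) σ
      = ∫ z : E3, (∫ x, σ x * exp (-(2 * t) * ‖x - z‖ ^ 2) ∂ν) ^ 2 := by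
    unfold quadForm
    rw [← integral_const_mul]
    simp_rw [← mul_assoc, ← hval, ← integral_mul_const]
    rw [integral_integral_swap]
    · refine integral_congr_ae (Eventually.of_forall fun z => ?_)
      simp only
      rw [sq, ← integral_prod_mul]
      refine integral_congr_ae (Eventually.of_forall fun p => ?_)
      simp only; ring
    · have := hAi.mul_bdd (f := fun q : (E3 × E3) × E3 =>
        exp (-(2 * t) * ‖q.1.1 - q.2‖ ^ 2) * exp (-(2 * t) * ‖q.1.2 - q.2‖ ^ 2))
        (hm.comp measurable_fst).aestronglyMeasurable
        (Eventually.of_forall fun q => hM q.1)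
      refine this.congr (Eventually.of_forall fun q => ?_)
      simp only [Function.uncurry, Function.comp]; ring
  have : 0 ≤ c * quadForm ν (fun p => exp (-t * ‖p.1 - p.2‖ ^ 2)) σ := by
    rw [key]; exact integral_nonneg fun z => sq_nonneg _
  exact nonneg_of_mul_nonneg_right this hc0

lemma quadForm_inv_nonneg {ν : Measure E3} [IsFiniteMeasure ν] {s : ℝ} (hs : 0 < s)
    {σ : E3 → ℝ} (hσ : BddMeas σ) :
    0 ≤ quadForm ν (fun p => (‖p.1 - p.2‖ ^ 2 + s)⁻¹) σ := by
  have h1 : ∀ p : E3 × E3, (‖p.1 - p.2‖ ^ 2 + s)⁻¹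
      = ∫ t in Set.Ioi (0:ℝ), exp (-t * ‖p.1 - p.2‖ ^ 2) * exp (-s * t) := by
    intro p
    have hp : 0 < ‖p.1 - p.2‖ ^ 2 + s := by positivity
    have := integral_exp_mul_Ioi (a := -(‖p.1 - p.2‖ ^ 2 + s)) (by linarith) 0
    simp only [mul_zero, Real.exp_zero] at this
    rw [inv_eq_one_div, ← neg_div_neg_eq, ← this]
    refine integral_congr_ae (Eventually.of_forall fun t => ?_)
    simp only
    rw [← Real.exp_add]; congr 1; ring
  simp_rw [h1]
  refine quadForm_mix_nonneg (b := fun t => exp (-s * t)) (by unfold Function.uncurry; fun_prop)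
    (exp_neg_integrableOn_Ioi 0 hs) ?_ hσ ?_
  · filter_upwards [ae_restrict_mem measurableSet_Ioi] with t ht p
    rw [abs_of_nonneg (by positivity)]
    refine mul_le_of_le_one_left (exp_pos _).le (Real.exp_le_one_iff.2 ?_)
    have : 0 < t := ht
    nlinarith [sq_nonneg ‖p.1 - p.2‖]
  · filter_upwards [ae_restrict_mem measurableSet_Ioi] with t ht
    have := mul_nonneg (quadForm_gauss_nonneg (ν := ν) ht hσ) (exp_pos (-s * t)).le
    unfold quadForm at this ⊢
    rw [← integral_mul_const] at this
    refine this.trans_eq (integral_congr_ae (Eventually.of_forall fun p => ?_))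
    simp only; ring

lemma quadForm_log_nonneg {ν : Measure E3} [IsFiniteMeasure ν] {a b : ℝ} (ha : 0 < a) (hab : a ≤ b)
    {σ : E3 → ℝ} (hσ : BddMeas σ) :
    0 ≤ quadForm ν (fun p => log ((‖p.1 - p.2‖ ^ 2 + b) / (‖p.1 - p.2‖ ^ 2 + a))) σ := by
  have h1 : ∀ p : E3 × E3, log ((‖p.1 - p.2‖ ^ 2 + b) / (‖p.1 - p.2‖ ^ 2 + a))
      = ∫ s in Set.Ioc a b, (‖p.1 - p.2‖ ^ 2 + s)⁻¹ := by
    intro p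
    have hr : 0 ≤ ‖p.1 - p.2‖ ^ 2 := by positivity
    rw [← intervalIntegral.integral_of_le hab]
    have := intervalIntegral.integral_comp_add_left (a := a) (b := b) (fun u : ℝ => u⁻¹)
      (‖p.1 - p.2‖ ^ 2)
    rw [this, integral_inv_of_pos (by linarith) (by linarith)]
  simp_rw [h1]
  refine quadForm_mix_nonneg (b := fun _ => a⁻¹) (by unfold Function.uncurry; fun_prop)
    (by simp) ?_ hσ ?_
  · filter_upwards [ae_restrict_mem measurableSet_Ioc] with s hs p
    have := hs.1
    have : 0 < s := ha.trans hs.1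
    rw [abs_of_nonneg (by positivity)]
    gcongr
    nlinarith [sq_nonneg ‖p.1 - p.2‖]
  · filter_upwards [ae_restrict_mem measurableSet_Ioc] with s hs
    exact quadForm_inv_nonneg (ha.trans hs.1) hσ

end PositiveKernels

section LogKernel

/-- The logarithmic kernel on `ℝ³`, normalized to be nonnegative. -/
noncomputable def logKer (x y : E3) : ℝ :=
  log (1 + ‖x‖ ^ 2) / 2 + log (1 + ‖y‖ ^ 2) / 2 - log ‖x - y‖

/-- The measure with density `k`. -/
noncomputable def densMeas (k : E3 → ℝ) : Measure E3 :=
  volume.withDensity fun x => ENNReal.ofReal (k x)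

lemma integrable_densMeas_iff {k : E3 → ℝ} (hk : Measurable k) (hk0 : ∀ x, 0 ≤ k x) {f : E3 → ℝ} :
    Integrable f (densMeas k) ↔ Integrable (fun x => f x * k x) := by
  unfold densMeas
  rw [integrable_withDensity_iff (by fun_prop) (Eventually.of_forall fun _ => ENNReal.ofReal_lt_top)]
  simp_rw [fun x => ENNReal.toReal_ofReal (hk0 x)]

lemma integral_densMeas {k : E3 → ℝ} (hk : Measurable k) (hk0 : ∀ x, 0 ≤ k x) (f : E3 → ℝ) :
    ∫ x, f x ∂(densMeas k) = ∫ x, f x * k x := by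
  unfold densMeas
  rw [integral_withDensity_eq_integral_toReal_smul (by fun_prop)
    (Eventually.of_forall fun _ => ENNReal.ofReal_lt_top)]
  refine integral_congr_ae (Eventually.of_forall fun x => ?_)
  simp only [ENNReal.toReal_ofReal (hk0 x), smul_eq_mul, mul_comm]

lemma densMeas_ac (k : E3 → ℝ) : densMeas k ≪ volume := withDensity_absolutelyContinuous _ _

instance (k : E3 → ℝ) : NullSingletonClass (densMeas k) := ⟨fun x => densMeas_ac k (by simp)⟩

lemma integrable_japanese {p : ℝ} (hp : 3 < p) :
    Integrable (fun x : E3 => (1 + ‖x‖ ^ 2) ^ (-p / 2)) :=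
  integrable_rpow_neg_one_add_norm_sq (by simpa using hp)

lemma measurable_logKer : Measurable (Function.uncurry logKer) := by
  unfold logKer Function.uncurry
  fun_prop

lemma logKer_symm (x y : E3) : logKer x y = logKer y x := by
  unfold logKer
  rw [norm_sub_rev]; ring

lemma norm_sub_sq_le (x y : E3) : ‖x - y‖ ^ 2 ≤ (1 + ‖x‖ ^ 2) * (1 + ‖y‖ ^ 2) := by
  have h1 := norm_sub_le x y
  have h2 : ‖x - y‖ ^ 2 ≤ (‖x‖ + ‖y‖) ^ 2 := by gcongr
  nlinarith [sq_nonneg (‖x‖ * ‖y‖ - 1)]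

lemma log_one_add_sq_nonneg (x : E3) : 0 ≤ log (1 + ‖x‖ ^ 2) :=
  Real.log_nonneg (by nlinarith [sq_nonneg ‖x‖])

lemma logKer_nonneg (x y : E3) : 0 ≤ logKer x y := by
  unfold logKer
  rcases eq_or_ne x y with rfl | hxy
  · simp; positivity [log_one_add_sq_nonneg x]
  · have hr : 0 < ‖x - y‖ := norm_pos_iff.2 (sub_ne_zero.2 hxy)
    have h1 := Real.log_le_log (by positivity) (norm_sub_sq_le x y)
    rw [Real.log_mul (by positivity) (by positivity), Real.log_pow] at h1
    push_cast at h1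
    linarith

lemma exp_logKer {x y : E3} (hxy : x ≠ y) :
    exp (logKer x y) = √(1 + ‖x‖ ^ 2) * √(1 + ‖y‖ ^ 2) / ‖x - y‖ := by
  have hr : 0 < ‖x - y‖ := norm_pos_iff.2 (sub_ne_zero.2 hxy)
  unfold logKer
  rw [Real.exp_sub, Real.exp_add, Real.exp_log hr, ← Real.log_sqrt (by positivity),
    ← Real.log_sqrt (by positivity), Real.exp_log (by positivity), Real.exp_log (by positivity)]

lemma exp_logKer_le {x y : E3} (hxy : x ≠ y) :
    exp (logKer x y) ≤ (1 + ‖y‖ ^ 2) / ‖x - y‖ + √(1 + ‖y‖ ^ 2) := by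
  have hr : 0 < ‖x - y‖ := norm_pos_iff.2 (sub_ne_zero.2 hxy)
  rw [exp_logKer hxy]
  have hs := Real.sq_sqrt (show (0:ℝ) ≤ 1 + ‖y‖ ^ 2 by positivity)
  have h1 : ‖y‖ ≤ √(1 + ‖y‖ ^ 2) := Real.le_sqrt_of_sq_le (by linarith)
  have hx : √(1 + ‖x‖ ^ 2) ≤ √(1 + ‖y‖ ^ 2) + ‖x - y‖ := by
    refine Real.sqrt_le_iff.2 ⟨by positivity, ?_⟩
    have h2 : ‖x‖ ≤ ‖y‖ + ‖x - y‖ := by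
      have := norm_add_le y (x - y)
      rwa [add_sub_cancel] at this
    have h3 : ‖x‖ ^ 2 ≤ (‖y‖ + ‖x - y‖) ^ 2 := by gcongr
    nlinarith
  calc √(1 + ‖x‖ ^ 2) * √(1 + ‖y‖ ^ 2) / ‖x - y‖
      ≤ (√(1 + ‖y‖ ^ 2) + ‖x - y‖) * √(1 + ‖y‖ ^ 2) / ‖x - y‖ := by gcongr
    _ = _ := by
      rw [add_mul, ← sq, hs, add_div, mul_div_cancel_left₀ _ hr.ne']

/-- An integrable majorant of the singular kernels. -/
noncomputable def kerMaj (γ : ℝ) (z : E3) : ℝ :=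
  (Metric.ball 0 1).indicator (fun z : E3 => ‖z‖ ^ (-γ)) z +
    2 ^ ((6 - γ) / 2) * (1 + ‖z‖ ^ 2) ^ (-(6 - γ) / 2)

lemma integrable_kerMaj {γ : ℝ} (h3 : γ < 3) : Integrable (kerMaj γ) := by
  refine Integrable.add ?_ ((integrable_japanese (by linarith)).const_mul _)
  rw [integrable_indicator_iff measurableSet_ball]
  refine integrableOn_ball_of_norm_le_rpow (C := 1) (α := γ) (by simp) (by simpa using h3)
    (Eventually.of_forall fun x => ?_) (measurable_norm.pow_const _).aestronglyMeasurable
  rw [one_mul, Real.norm_of_nonneg (by positivity)]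

lemma rpow_mul_le_kerMaj {γ a : ℝ} (h0 : 0 < γ) (h3 : γ < 3) (ha : 1 ≤ a) {z : E3} (hz : z ≠ 0) :
    a ^ (γ - 3) * ‖z‖ ^ (-γ) ≤ kerMaj γ z + a ^ (-(6 - γ) / 2) := by
  have hr : 0 < ‖z‖ := norm_pos_iff.2 hz
  have ha0 : 0 < a := by linarith
  unfold kerMaj
  by_cases hb : ‖z‖ < 1
  · rw [Set.indicator_of_mem (by simpa using hb)]
    have h1 : a ^ (γ - 3) ≤ 1 := Real.rpow_le_one_of_one_le_of_nonpos ha (by linarith)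
    have h2 : a ^ (γ - 3) * ‖z‖ ^ (-γ) ≤ 1 * ‖z‖ ^ (-γ) := by gcongr
    have h4 : 0 ≤ (2:ℝ) ^ ((6 - γ) / 2) * (1 + ‖z‖ ^ 2) ^ (-(6 - γ) / 2) := by positivity
    have h5 : 0 ≤ a ^ (-(6 - γ) / 2) := by positivity
    linarith
  · rw [Set.indicator_of_notMem (by simpa using hb), zero_add]
    push Not at hb
    have hz2 : (‖z‖ ^ 2) ^ (-(6 - γ) / 2) ≤ 2 ^ ((6 - γ) / 2) * (1 + ‖z‖ ^ 2) ^ (-(6 - γ) / 2) := by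
      have h1 : (1 + ‖z‖ ^ 2) / 2 ≤ ‖z‖ ^ 2 := by nlinarith
      have h2 := Real.rpow_le_rpow_of_nonpos (by positivity) h1 (z := -(6 - γ) / 2) (by linarith)
      refine h2.trans_eq ?_
      rw [Real.div_rpow (by positivity) (by norm_num), div_eq_mul_inv, ← Real.rpow_neg (by norm_num)]
      rw [mul_comm]; congr 2; ring
    have hle : a ^ (γ - 3) * ‖z‖ ^ (-γ) ≤ (‖z‖ ^ 2) ^ (-(6 - γ) / 2) + a ^ (-(6 - γ) / 2) := by
      have e1 : ‖z‖ ^ (-γ) = (‖z‖ ^ 2) ^ (-γ / 2) := by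
        rw [← Real.rpow_natCast ‖z‖ 2, ← Real.rpow_mul hr.le]; congr 1; push_cast; ring
      rw [e1]
      set b := ‖z‖ ^ 2 with hbdef
      have hb0 : 0 < b := by positivity
      have p1 : 0 < b ^ (-(6 - γ) / 2) := by positivity
      have p2 : 0 < a ^ (-(6 - γ) / 2) := by positivity
      rcases le_total a b with hab | hab
      · have : a ^ (γ - 3) * b ^ (-γ / 2) ≤ a ^ (γ - 3) * a ^ (-γ / 2) := by
          gcongr ?_ * ?_
          exact Real.rpow_le_rpow_of_nonpos ha0 hab (by linarith)
        rw [← Real.rpow_add ha0] at this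
        have e : γ - 3 + -γ / 2 = -(6 - γ) / 2 := by ring
        rw [e] at this
        linarith
      · have : a ^ (γ - 3) * b ^ (-γ / 2) ≤ b ^ (γ - 3) * b ^ (-γ / 2) := by
          gcongr ?_ * ?_
          exact Real.rpow_le_rpow_of_nonpos hb0 hab (by linarith)
        rw [← Real.rpow_add hb0] at this
        have e : γ - 3 + -γ / 2 = -(6 - γ) / 2 := by ring
        rw [e] at this
        linarith
    linarith

lemma exp_mul_logKer_le {γ : ℝ} (h0 : 0 < γ) (h3 : γ < 3) {x y : E3} (hxy : x ≠ y) :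
    exp (γ * logKer x y) * ((1 + ‖y‖ ^ 2) ^ 3)⁻¹ ≤
      2 ^ γ * (kerMaj γ (x - y) + 2 * (1 + ‖y‖ ^ 2) ^ (-(6 - γ) / 2)) := by
  have hr : 0 < ‖x - y‖ := norm_pos_iff.2 (sub_ne_zero.2 hxy)
  set a := 1 + ‖y‖ ^ 2 with ha
  have ha1 : 1 ≤ a := by rw [ha]; nlinarith [sq_nonneg ‖y‖]
  have ha0 : 0 < a := by linarith
  have h1 : exp (γ * logKer x y) ≤ (a / ‖x - y‖ + √a) ^ γ := by
    rw [mul_comm, Real.exp_mul]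
    exact Real.rpow_le_rpow (exp_pos _).le (exp_logKer_le hxy) h0.le
  have h2 : (a / ‖x - y‖ + √a) ^ γ ≤ 2 ^ γ * ((a / ‖x - y‖) ^ γ + √a ^ γ) := by
    have hA : 0 < a / ‖x - y‖ := by positivity
    have hB : 0 < √a := by positivity
    rcases le_total (a / ‖x - y‖) √a with hab | hab
    · calc (a / ‖x - y‖ + √a) ^ γ ≤ (2 * √a) ^ γ := by gcongr; linarith
        _ = 2 ^ γ * √a ^ γ := Real.mul_rpow (by norm_num) hB.le
        _ ≤ _ := by gcongr; linarith [Real.rpow_nonneg hA.le γ]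
    · calc (a / ‖x - y‖ + √a) ^ γ ≤ (2 * (a / ‖x - y‖)) ^ γ := by gcongr; linarith
        _ = 2 ^ γ * (a / ‖x - y‖) ^ γ := Real.mul_rpow (by norm_num) hA.le
        _ ≤ _ := by gcongr; linarith [Real.rpow_nonneg hB.le γ]
  have e3 : (a ^ 3)⁻¹ = a ^ (-3 : ℝ) := by
    rw [Real.rpow_neg ha0.le]; norm_cast
  have e1 : (a / ‖x - y‖) ^ γ * (a ^ 3)⁻¹ = a ^ (γ - 3) * ‖x - y‖ ^ (-γ) := by
    rw [e3, Real.div_rpow ha0.le hr.le, Real.rpow_neg hr.le, sub_eq_add_neg γ 3, Real.rpow_add ha0]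
    ring
  have e2 : √a ^ γ * (a ^ 3)⁻¹ = a ^ (-(6 - γ) / 2) := by
    rw [e3, Real.sqrt_eq_rpow, ← Real.rpow_mul ha0.le, ← Real.rpow_add ha0]; congr 1; ring
  calc exp (γ * logKer x y) * (a ^ 3)⁻¹
      ≤ (2 ^ γ * ((a / ‖x - y‖) ^ γ + √a ^ γ)) * (a ^ 3)⁻¹ := by gcongr; exact h1.trans h2
    _ = 2 ^ γ * (a ^ (γ - 3) * ‖x - y‖ ^ (-γ) + a ^ (-(6 - γ) / 2)) := by
      rw [mul_assoc, add_mul, e1, e2]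
    _ ≤ _ := by
      have := rpow_mul_le_kerMaj h0 h3 ha1 (sub_ne_zero.2 hxy)
      exact mul_le_mul_of_nonneg_left (by linarith) (by positivity)


variable {k : E3 → ℝ} {C : ℝ}

lemma integrable_inv_one_add_sq_sq : Integrable (fun x : E3 => ((1 + ‖x‖ ^ 2) ^ 2)⁻¹) := by
  have := integrable_japanese (p := 4) (by norm_num)
  refine this.congr (Eventually.of_forall fun x => ?_)
  simp only
  rw [show (-4 / 2 : ℝ) = -(2 : ℕ) by norm_num, Real.rpow_neg (by positivity), Real.rpow_natCast]

lemma integrable_of_decay (hk : Measurable k) (hk0 : ∀ x, 0 ≤ k x)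
    (hkC : ∀ x, k x ≤ C * ((1 + ‖x‖ ^ 2) ^ 3)⁻¹) :
    Integrable (fun x => (1 + ‖x‖ ^ 2) * k x) := by
  refine (integrable_inv_one_add_sq_sq.const_mul C).mono' (by fun_prop)
    (Eventually.of_forall fun x => ?_)
  have : 0 < 1 + ‖x‖ ^ 2 := by positivity
  rw [Real.norm_of_nonneg (mul_nonneg this.le (hk0 x))]
  calc (1 + ‖x‖ ^ 2) * k x ≤ (1 + ‖x‖ ^ 2) * (C * ((1 + ‖x‖ ^ 2) ^ 3)⁻¹) :=
        mul_le_mul_of_nonneg_left (hkC x) this.le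
    _ = C * ((1 + ‖x‖ ^ 2) ^ 2)⁻¹ := by field_simp

lemma isFiniteMeasure_densMeas (hk : Measurable k) (hk0 : ∀ x, 0 ≤ k x)
    (hkC : ∀ x, k x ≤ C * ((1 + ‖x‖ ^ 2) ^ 3)⁻¹) : IsFiniteMeasure (densMeas k) := by
  refine isFiniteMeasure_withDensity_ofReal (Integrable.hasFiniteIntegral ?_)
  refine (integrable_of_decay hk hk0 hkC).mono' (by fun_prop) (Eventually.of_forall fun x => ?_)
  rw [Real.norm_of_nonneg (hk0 x)]
  nlinarith [hk0 x, mul_nonneg (sq_nonneg ‖x‖) (hk0 x)]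

lemma logKer_exp_int (hk : Measurable k) (hk0 : ∀ x, 0 ≤ k x) (hC : 0 ≤ C)
    (hkC : ∀ x, k x ≤ C * ((1 + ‖x‖ ^ 2) ^ 3)⁻¹) {γ : ℝ} (h0 : 0 < γ) (h3 : γ < 3) :
    ∃ D, ∀ x, Integrable (fun y => exp (γ * logKer x y)) (densMeas k) ∧
      ∫ y, exp (γ * logKer x y) ∂(densMeas k) ≤ D := by
  have hm : ∀ x, Measurable (logKer x) := fun x => measurable_logKer.of_uncurry_left
  have hF : ∀ x : E3, Integrable (fun y : E3 => C * (2 ^ γ * (kerMaj γ (x - y) +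
      2 * (1 + ‖y‖ ^ 2) ^ (-(6 - γ) / 2)))) := fun x =>
    ((((integrable_kerMaj h3).comp_sub_left x).add
      ((integrable_japanese (by linarith)).const_mul 2)).const_mul _).const_mul _
  have hle : ∀ x : E3, ∀ᵐ y : E3, exp (γ * logKer x y) * k y ≤ C * (2 ^ γ * (kerMaj γ (x - y) +
      2 * (1 + ‖y‖ ^ 2) ^ (-(6 - γ) / 2))) := by
    intro x
    filter_upwards [Measure.ae_ne volume x] with y hy
    calc exp (γ * logKer x y) * k y
        ≤ exp (γ * logKer x y) * (C * ((1 + ‖y‖ ^ 2) ^ 3)⁻¹) := by gcongr; exact hkC y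
      _ = C * (exp (γ * logKer x y) * ((1 + ‖y‖ ^ 2) ^ 3)⁻¹) := by ring
      _ ≤ _ := mul_le_mul_of_nonneg_left (exp_mul_logKer_le h0 h3 hy.symm) hC
  have hi : ∀ x : E3, Integrable (fun y => exp (γ * logKer x y) * k y) := by
    intro x
    refine (hF x).mono' ((((hm x).const_mul γ).exp.mul hk).aestronglyMeasurable) ?_
    filter_upwards [hle x] with y hy
    rwa [Real.norm_of_nonneg (mul_nonneg (exp_pos _).le (hk0 y))]
  refine ⟨C * (2 ^ γ * ((∫ z, kerMaj γ z) + 2 * ∫ y : E3, (1 + ‖y‖ ^ 2) ^ (-(6 - γ) / 2))),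
    fun x => ⟨(integrable_densMeas_iff hk hk0).2 (hi x), ?_⟩⟩
  rw [integral_densMeas hk hk0]
  refine (integral_mono_ae (hi x) (hF x) (hle x)).trans_eq ?_
  rw [integral_const_mul, integral_const_mul, integral_add ((integrable_kerMaj h3).comp_sub_left x)
    ((integrable_japanese (by linarith)).const_mul 2), integral_const_mul,
    integral_sub_left_eq_self (kerMaj γ)]

end LogKernel

section LogKernelPositivity

variable {k : E3 → ℝ} {C : ℝ}

lemma isExpKernel_logKer (hk : Measurable k) (hk0 : ∀ x, 0 ≤ k x) (hC : 0 ≤ C)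
    (hkC : ∀ x, k x ≤ C * ((1 + ‖x‖ ^ 2) ^ 3)⁻¹) : IsExpKernel (densMeas k) logKer where
  meas := measurable_logKer
  symm := logKer_symm
  nonneg := logKer_nonneg
  exp_int _ h0 h3 := logKer_exp_int hk hk0 hC hkC h0 h3

lemma ae_prod_ne (ν : Measure E3) [SFinite ν] [NullSingletonClass ν] :
    ∀ᵐ p : E3 × E3 ∂(ν.prod ν), p.1 ≠ p.2 := by
  have h : MeasurableSet {p : E3 × E3 | p.1 = p.2} := 
    measurableSet_eq_fun measurable_fst measurable_snd
  change (ν.prod ν) {p : E3 × E3 | ¬ p.1 ≠ p.2} = 0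
  simp only [ne_eq, not_not]
  rw [Measure.measure_prod_null h]
  refine Eventually.of_forall fun x => ?_
  have : Prod.mk x ⁻¹' {p : E3 × E3 | p.1 = p.2} = {x} := by
    ext y; simp [eq_comm]
  simp only [this, measure_singleton, Pi.zero_apply]

/-- Regularized logarithmic kernels. -/
noncomputable def logKerReg (n : ℕ) (p : E3 × E3) : ℝ :=
  log (1 + ‖p.1‖ ^ 2) / 2 + log (1 + ‖p.2‖ ^ 2) / 2
    + log ((‖p.1 - p.2‖ ^ 2 + (n + 1)) / (‖p.1 - p.2‖ ^ 2 + (n + 1 : ℝ)⁻¹)) / 2 - log (n + 1) / 2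

lemma logKerReg_eq (n : ℕ) (p : E3 × E3) : logKerReg n p =
    log (1 + ‖p.1‖ ^ 2) / 2 + log (1 + ‖p.2‖ ^ 2) / 2
    + log (1 + ‖p.1 - p.2‖ ^ 2 * (n + 1 : ℝ)⁻¹) / 2
    - log (‖p.1 - p.2‖ ^ 2 + (n + 1 : ℝ)⁻¹) / 2 := by
  unfold logKerReg
  have h1 : 0 < ‖p.1 - p.2‖ ^ 2 + (n + 1 : ℝ) := by positivity
  have h2 : 0 < ‖p.1 - p.2‖ ^ 2 + (n + 1 : ℝ)⁻¹ := by positivity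
  have h3 : (0:ℝ) < n + 1 := by positivity
  have e : 1 + ‖p.1 - p.2‖ ^ 2 * (n + 1 : ℝ)⁻¹ = (‖p.1 - p.2‖ ^ 2 + (n + 1 : ℝ)) / (n + 1) := by
    field_simp; ring
  rw [e, Real.log_div h1.ne' h2.ne', Real.log_div h1.ne' h3.ne']
  ring

lemma tendsto_logKerReg {p : E3 × E3} (hp : p.1 ≠ p.2) :
    Tendsto (fun n => logKerReg n p) atTop (nhds (logKer p.1 p.2)) := by
  have hr : 0 < ‖p.1 - p.2‖ := norm_pos_iff.2 (sub_ne_zero.2 hp)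
  have h0 : Tendsto (fun n : ℕ => (n + 1 : ℝ)⁻¹) atTop (nhds 0) := by
    simpa [one_div] using tendsto_one_div_add_atTop_nhds_zero_nat (𝕜 := ℝ)
  have h1 : Tendsto (fun n : ℕ => log (1 + ‖p.1 - p.2‖ ^ 2 * (n + 1 : ℝ)⁻¹)) atTop
      (nhds (log (1 + ‖p.1 - p.2‖ ^ 2 * 0))) :=
    ((h0.const_mul _).const_add 1).log (by simp)
  have h2 : Tendsto (fun n : ℕ => log (‖p.1 - p.2‖ ^ 2 + (n + 1 : ℝ)⁻¹)) atTop
      (nhds (log (‖p.1 - p.2‖ ^ 2 + 0))) :=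
    (h0.const_add _).log (by positivity)
  simp_rw [logKerReg_eq]
  have := ((h1.div_const 2).const_add
    (log (1 + ‖p.1‖ ^ 2) / 2 + log (1 + ‖p.2‖ ^ 2) / 2)).sub (h2.div_const 2)
  convert this using 2
  unfold logKer
  simp [Real.log_pow]

lemma abs_logKerReg_le (n : ℕ) {p : E3 × E3} (hp : p.1 ≠ p.2) :
    |logKerReg n p| ≤
      logKer p.1 p.2 + (log (1 + ‖p.1‖ ^ 2) / 2 + log (1 + ‖p.2‖ ^ 2) / 2 + 1) := by
  have hr : 0 < ‖p.1 - p.2‖ := norm_pos_iff.2 (sub_ne_zero.2 hp)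
  have hw1 := log_one_add_sq_nonneg p.1
  have hw2 := log_one_add_sq_nonneg p.2
  have hn1 : (n + 1 : ℝ)⁻¹ ≤ 1 := inv_le_one_of_one_le₀ (by linarith [Nat.cast_nonneg (α := ℝ) n])
  have hn0 : (0 : ℝ) < (n + 1 : ℝ)⁻¹ := by positivity
  have hG := logKer_nonneg p.1 p.2
  have hq : log (1 + ‖p.1 - p.2‖ ^ 2) ≤ log 2 + log (1 + ‖p.1‖ ^ 2) + log (1 + ‖p.2‖ ^ 2) := by
    rw [← Real.log_mul (by positivity) (by positivity), ← Real.log_mul (by positivity) (by positivity)]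
    refine Real.log_le_log (by positivity) ?_
    have := norm_sub_sq_le p.1 p.2
    nlinarith [sq_nonneg (‖p.1‖ * ‖p.2‖), sq_nonneg ‖p.1‖, sq_nonneg ‖p.2‖]
  have hl2 : log 2 ≤ 1 := by have := Real.log_two_lt_d9; linarith
  have ha : 0 ≤ log (1 + ‖p.1 - p.2‖ ^ 2 * (n + 1 : ℝ)⁻¹) :=
    Real.log_nonneg (by have : 0 ≤ ‖p.1 - p.2‖ ^ 2 * (n + 1 : ℝ)⁻¹ := by positivity
                        linarith)
  have hb : log (1 + ‖p.1 - p.2‖ ^ 2 * (n + 1 : ℝ)⁻¹) ≤ log (1 + ‖p.1 - p.2‖ ^ 2) :=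
    Real.log_le_log (by positivity) (by
      have := mul_le_of_le_one_right (sq_nonneg ‖p.1 - p.2‖) hn1
      linarith)
  have hc : 2 * log ‖p.1 - p.2‖ ≤ log (‖p.1 - p.2‖ ^ 2 + (n + 1 : ℝ)⁻¹) := by
    have := Real.log_le_log (by positivity : 0 < ‖p.1 - p.2‖ ^ 2)
      (by linarith : ‖p.1 - p.2‖ ^ 2 ≤ ‖p.1 - p.2‖ ^ 2 + (n + 1 : ℝ)⁻¹)
    rwa [Real.log_pow] at this
  have hd : log (‖p.1 - p.2‖ ^ 2 + (n + 1 : ℝ)⁻¹) ≤ log (1 + ‖p.1 - p.2‖ ^ 2) :=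
    Real.log_le_log (by positivity) (by linarith)
  rw [logKerReg_eq, abs_le]
  constructor
  · linarith
  · unfold logKer
    linarith

lemma integrable_log_densMeas (hk : Measurable k) (hk0 : ∀ x, 0 ≤ k x)
    (hkC : ∀ x, k x ≤ C * ((1 + ‖x‖ ^ 2) ^ 3)⁻¹) :
    Integrable (fun x => log (1 + ‖x‖ ^ 2) / 2) (densMeas k) := by
  have : Integrable (fun x : E3 => 1 + ‖x‖ ^ 2) (densMeas k) :=
    (integrable_densMeas_iff hk hk0).2 (integrable_of_decay hk hk0 hkC)
  refine this.mono' (Measurable.aestronglyMeasurable (by fun_prop))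
    (Eventually.of_forall fun x => ?_)
  have h1 := log_one_add_sq_nonneg x
  rw [Real.norm_of_nonneg (by linarith)]
  linarith [Real.log_le_self (show 0 ≤ 1 + ‖x‖ ^ 2 by positivity)]

lemma logKer_psd (hk : Measurable k) (hk0 : ∀ x, 0 ≤ k x) (hC : 0 ≤ C)
    (hkC : ∀ x, k x ≤ C * ((1 + ‖x‖ ^ 2) ^ 3)⁻¹) {σ : E3 → ℝ} (hσ : BddMeas σ)
    (h0 : ∫ x, σ x ∂(densMeas k) = 0) :
    0 ≤ ∫ x, (∫ y, logKer x y * σ y ∂(densMeas k)) * σ x ∂(densMeas k) := by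
  have := isFiniteMeasure_densMeas hk hk0 hkC
  set ν := densMeas k with hν
  have hE : IsExpKernel ν logKer := isExpKernel_logKer hk hk0 hC hkC
  have hGi : Integrable (fun p : E3 × E3 => logKer p.1 p.2) (ν.prod ν) := by
    simpa using hE.integrable_prod (BddMeas.const 1) (BddMeas.const 1)
  have hl := integrable_log_densMeas hk hk0 hkC
  have hw : Integrable (fun p : E3 × E3 => log (1 + ‖p.1‖ ^ 2) / 2 + log (1 + ‖p.2‖ ^ 2) / 2)
      (ν.prod ν) := (hl.comp_fst ν).add (hl.comp_snd ν)
  obtain ⟨hSm, M, hM⟩ := hσ.tensor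
  have hM0 : 0 ≤ M := (abs_nonneg _).trans (hM 0)
  have hreg : ∀ n, 0 ≤ ∫ p, logKerReg n p * (σ p.2 * σ p.1) ∂(ν.prod ν) := by
    intro n
    have hq := quadForm_log_nonneg (ν := ν) (a := (n + 1 : ℝ)⁻¹) (b := n + 1) (by positivity)
      ((inv_le_one_of_one_le₀ (by linarith [Nat.cast_nonneg (α := ℝ) n])).trans
        (by linarith [Nat.cast_nonneg (α := ℝ) n])) hσ
    unfold quadForm at hq
    have hS : ∫ p : E3 × E3, σ p.2 * σ p.1 ∂(ν.prod ν) = 0 := by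
      simp_rw [mul_comm]
      rw [integral_prod_mul, h0, zero_mul]
    have e1 : ∫ p : E3 × E3, log (1 + ‖p.1‖ ^ 2) / 2 * (σ p.2 * σ p.1) ∂(ν.prod ν) = 0 := by
      have := integral_prod_mul (μ := ν) (ν := ν) (fun x : E3 => log (1 + ‖x‖ ^ 2) / 2 * σ x) σ
      rw [h0, mul_zero] at this
      rw [← this]
      exact integral_congr_ae (Eventually.of_forall fun p => by simp only; ring)
    have e2 : ∫ p : E3 × E3, log (1 + ‖p.2‖ ^ 2) / 2 * (σ p.2 * σ p.1) ∂(ν.prod ν) = 0 := by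
      have := integral_prod_mul (μ := ν) (ν := ν) σ (fun x : E3 => log (1 + ‖x‖ ^ 2) / 2 * σ x)
      rw [h0, zero_mul] at this
      rw [← this]
      exact integral_congr_ae (Eventually.of_forall fun p => by simp only; ring)
    have hSi : Integrable (fun p : E3 × E3 => σ p.2 * σ p.1) (ν.prod ν) :=
      BddMeas.integrable ⟨hSm, M, hM⟩
    have i1 := (hl.comp_fst ν).mul_bdd hSm.aestronglyMeasurable (Eventually.of_forall hM)
    have i2 := (hl.comp_snd ν).mul_bdd hSm.aestronglyMeasurable (Eventually.of_forall hM)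
    by_cases i3 : Integrable (fun p : E3 × E3 => log ((‖p.1 - p.2‖ ^ 2 + (n + 1)) /
      (‖p.1 - p.2‖ ^ 2 + (n + 1 : ℝ)⁻¹)) * (σ p.2 * σ p.1)) (ν.prod ν)
    · have : ∫ p, logKerReg n p * (σ p.2 * σ p.1) ∂(ν.prod ν)
          = 1 / 2 * ∫ p : E3 × E3, log ((‖p.1 - p.2‖ ^ 2 + (n + 1)) /
          (‖p.1 - p.2‖ ^ 2 + (n + 1 : ℝ)⁻¹)) * (σ p.2 * σ p.1) ∂(ν.prod ν) := by
        have e3 : ∀ p : E3 × E3, logKerReg n p * (σ p.2 * σ p.1) =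
            log (1 + ‖p.1‖ ^ 2) / 2 * (σ p.2 * σ p.1) + log (1 + ‖p.2‖ ^ 2) / 2 * (σ p.2 * σ p.1)
            + 1 / 2 * (log ((‖p.1 - p.2‖ ^ 2 + (n + 1)) /
              (‖p.1 - p.2‖ ^ 2 + (n + 1 : ℝ)⁻¹)) * (σ p.2 * σ p.1))
            - log (n + 1) / 2 * (σ p.2 * σ p.1) := by
          intro p; unfold logKerReg; ring
        simp_rw [e3]
        rw [integral_sub, integral_add, integral_add, integral_const_mul, integral_const_mul, e1,
          e2, hS]
        · ring
        · exact i1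
        · exact i2
        · exact i1.add i2
        · exact i3.const_mul _
        · exact (i1.add i2).add (i3.const_mul _)
        · exact hSi.const_mul _
      rw [this]
      exact mul_nonneg (by norm_num) hq
    · have : ¬ Integrable (fun p => logKerReg n p * (σ p.2 * σ p.1)) (ν.prod ν) := by
        intro hi
        apply i3
        have := (((hi.sub i1).sub i2).add (hSi.const_mul (log (n + 1) / 2))).const_mul 2
        refine this.congr (Eventually.of_forall fun p => ?_)
        simp only [Pi.sub_apply, Pi.add_apply]
        unfold logKerReg; ring
      rw [integral_undef this]
  have hlim : Tendsto (fun n => ∫ p, logKerReg n p * (σ p.2 * σ p.1) ∂(ν.prod ν)) atTop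
      (nhds (∫ p : E3 × E3, logKer p.1 p.2 * (σ p.2 * σ p.1) ∂(ν.prod ν))) := by
    refine tendsto_integral_of_dominated_convergence (fun p => (logKer p.1 p.2 +
      (log (1 + ‖p.1‖ ^ 2) / 2 + log (1 + ‖p.2‖ ^ 2) / 2 + 1)) * M) (fun n => ?_)
      ((hGi.add (hw.add (integrable_const 1))).mul_const M) (fun n => ?_) ?_
    · refine Measurable.aestronglyMeasurable (Measurable.mul ?_ hSm)
      unfold logKerReg; fun_prop
    · filter_upwards [ae_prod_ne ν] with p hp
      rw [norm_mul]
      have := abs_logKerReg_le n hp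
      exact mul_le_mul this (hM p) (norm_nonneg _) ((abs_nonneg _).trans this)
    · filter_upwards [ae_prod_ne ν] with p hp
      exact (tendsto_logKerReg hp).mul_const _
  have hfin := ge_of_tendsto' hlim hreg
  have hpi := hE.integrable_prod hσ hσ
  simp_rw [← mul_assoc] at hfin
  rw [integral_prod _ hpi] at hfin
  simpa only [integral_mul_const] using hfin

theorem isLogKernel_logKer (hk : Measurable k) (hk0 : ∀ x, 0 ≤ k x) (hC : 0 ≤ C)
    (hkC : ∀ x, k x ≤ C * ((1 + ‖x‖ ^ 2) ^ 3)⁻¹) : IsLogKernel (densMeas k) logKer where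
  toIsExpKernel := isExpKernel_logKer hk hk0 hC hkC
  psd _ hm hb h0 := logKer_psd hk hk0 hC hkC ⟨hm, hb⟩ h0

end LogKernelPositivity

section Density

lemma weight_bound {K : E3 → ℝ} (hKpos : ∀ x, 0 < K x) {C : ℝ} (hC : ∀ x, K x ≤ C)
    {s C₀ : ℝ} (hC₀ : 0 < C₀) (hKdecay : ∀ x : E3, 1 ≤ ‖x‖ → K x ≤ C₀ * ‖x‖ ^ (-s))
    {μ : ℝ} (h0 : 0 < μ) (hμ : 6 * μ ≤ s) (x : E3) :
    K x * (1 + ‖x‖ ^ 2) ^ (-(6 * (1 - μ)) / 2) ≤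
      max C C₀ * 2 ^ (3 * μ) * ((1 + ‖x‖ ^ 2) ^ 3)⁻¹ := by
  have hb : 0 < 1 + ‖x‖ ^ 2 := by positivity
  have hmax : 0 < max C C₀ := lt_max_of_lt_right hC₀
  have key : K x ≤ max C C₀ * (((1 + ‖x‖ ^ 2) / 2) ^ (-(3 * μ))) := by
    rcases le_or_gt 1 ‖x‖ with hx | hx
    · have hx0 : 0 < ‖x‖ := by linarith
      calc K x ≤ C₀ * ‖x‖ ^ (-s) := hKdecay x hx
        _ ≤ C₀ * ‖x‖ ^ (-(6 * μ)) := by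
          gcongr
        _ = C₀ * (‖x‖ ^ 2) ^ (-(3 * μ)) := by
          rw [← Real.rpow_natCast ‖x‖ 2, ← Real.rpow_mul hx0.le]; congr 2; push_cast; ring
        _ ≤ _ := by
          gcongr ?_ * ?_
          · exact le_max_right _ _
          · exact Real.rpow_le_rpow_of_nonpos (by positivity) (by nlinarith) (by linarith)
    · calc K x ≤ max C C₀ * 1 := by rw [mul_one]; exact (hC x).trans (le_max_left _ _)
        _ ≤ _ := by
          gcongr
          exact Real.one_le_rpow_of_pos_of_le_one_of_nonpos (by positivity)
            (by nlinarith [norm_nonneg x]) (by linarith)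
  calc K x * (1 + ‖x‖ ^ 2) ^ (-(6 * (1 - μ)) / 2)
      ≤ (max C C₀ * (((1 + ‖x‖ ^ 2) / 2) ^ (-(3 * μ)))) * (1 + ‖x‖ ^ 2) ^ (-(6 * (1 - μ)) / 2) := by
        gcongr
    _ = _ := by
      rw [Real.div_rpow hb.le (by norm_num), div_eq_mul_inv, ← Real.rpow_neg (by norm_num), neg_neg]
      have : ((1 + ‖x‖ ^ 2) ^ 3)⁻¹ =
          (1 + ‖x‖ ^ 2) ^ (-(3 * μ)) * (1 + ‖x‖ ^ 2) ^ (-(6 * (1 - μ)) / 2) := by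
        rw [← Real.rpow_add hb, ← Real.rpow_natCast, ← Real.rpow_neg hb.le]
        congr 1; push_cast; ring
      rw [this]; ring

/-- Existence of a normal solution, in terms of its curvature density. -/
theorem exists_density (K : E3 → ℝ) (hKmeas : Measurable K)
    (hKpos : ∀ x, 0 < K x) (hKbdd : ∃ C : ℝ, ∀ x, K x ≤ C)
    (s C₀ : ℝ) (hC₀ : 0 < C₀)
    (hKdecay : ∀ x : E3, 1 ≤ ‖x‖ → K x ≤ C₀ * ‖x‖ ^ (-s))
    (μ : ℝ) (hμ : μ ∈ Set.Ioo 0 (min (s / 6) 1)) :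
    ∃ ρ : E3 → ℝ, ∃ c D : ℝ, Measurable ρ ∧ (∀ x, 0 ≤ ρ x) ∧
      (∀ x, ρ x ≤ D * ((1 + ‖x‖ ^ 2) ^ 3)⁻¹) ∧ ∫ x, ρ x = 4 * π ^ 2 * (1 - μ) ∧
      ∀ x, K x * exp (3 * (c + 1 / (2 * π ^ 2) * ∫ y, -log ‖x - y‖ * ρ y)) = ρ x := by
  obtain ⟨C, hC⟩ := hKbdd
  obtain ⟨hμ0, hμ1⟩ := hμ
  have hμ6 : 6 * μ ≤ s := by have := hμ1.trans_le (min_le_left _ _); linarith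
  have hμ1' : μ < 1 := hμ1.trans_le (min_le_right _ _)
  set β : ℝ := 6 * (1 - μ) with hβ
  have hβ0 : 0 < β := by rw [hβ]; linarith
  have hβ6 : β < 6 := by rw [hβ]; linarith
  set k : E3 → ℝ := fun x => K x * (1 + ‖x‖ ^ 2) ^ (-β / 2) with hk
  set C' : ℝ := max C C₀ * 2 ^ (3 * μ) with hC'
  have hC'0 : 0 < C' := mul_pos (lt_max_of_lt_right hC₀) (by positivity)
  have hkm : Measurable k := hKmeas.mul (Measurable.pow_const (by fun_prop) _)
  have hkpos : ∀ x, 0 < k x := fun x => mul_pos (hKpos x) (by positivity)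
  have hk0 : ∀ x, 0 ≤ k x := fun x => (hkpos x).le
  have hkC : ∀ x, k x ≤ C' * ((1 + ‖x‖ ^ 2) ^ 3)⁻¹ :=
    weight_bound hKpos hC hC₀ hKdecay hμ0 hμ6
  have := isFiniteMeasure_densMeas hkm hk0 hkC
  have hL := isLogKernel_logKer hkm hk0 hC'0.le hkC
  set ν := densMeas k with hν
  have hne : NeZero ν := ⟨by
    intro h
    have h1 : (∫⁻ x, ENNReal.ofReal (k x)) = 0 := by
      have : ν Set.univ = 0 := by rw [h]; rfl
      rwa [hν, densMeas, withDensity_apply _ MeasurableSet.univ, Measure.restrict_univ] at this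
    rw [lintegral_eq_zero_iff (by fun_prop)] at h1
    have h2 : ∀ᵐ x : E3, False := by
      filter_upwards [h1] with x hx
      simp only [Pi.zero_apply, ENNReal.ofReal_eq_zero] at hx
      linarith [hkpos x]
    rw [eventually_false_iff_eq_bot, ae_eq_bot] at h2
    exact NeZero.ne _ h2⟩
  obtain ⟨f, hf, hfeq⟩ := hL.exists_gib_eq_self hβ0 hβ6
  set Z := part ν logKer β f with hZ
  have hZ0 : 0 < Z := hL.part_pos β hf.bddMeas
  set Λ : ℝ := 4 * π ^ 2 * (1 - μ) with hΛ
  have hΛ0 : 0 < Λ := mul_pos (by positivity) (by linarith)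
  have hl := integrable_log_densMeas hkm hk0 hkC
  obtain ⟨hfm, M, hM⟩ := hf.bddMeas
  have hlf : Integrable (fun y => log (1 + ‖y‖ ^ 2) / 2 * f y) ν :=
    hl.mul_bdd hfm.aestronglyMeasurable (Eventually.of_forall hM)
  have hfi : Integrable f ν := hf.bddMeas.integrable
  set a := ∫ y, log (1 + ‖y‖ ^ 2) / 2 * f y ∂ν with ha
  have hpot : ∀ x, pot ν logKer f x = log (1 + ‖x‖ ^ 2) / 2 + a + ∫ y, -log ‖x - y‖ * f y ∂ν := by
    intro x
    have hG := hL.int_G_mul hf.bddMeas x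
    have e : ∀ y, -log ‖x - y‖ * f y = logKer x y * f y - log (1 + ‖x‖ ^ 2) / 2 * f y
        - log (1 + ‖y‖ ^ 2) / 2 * f y := by intro y; unfold logKer; ring
    simp_rw [e]
    have h1 : Integrable (fun y => logKer x y * f y - log (1 + ‖x‖ ^ 2) / 2 * f y) ν :=
      hG.sub (hfi.const_mul _)
    rw [integral_sub h1 hlf, integral_sub hG (hfi.const_mul _),
      integral_const_mul, hf.2.2.2]
    unfold pot
    ring
  refine ⟨fun x => Λ * (f x * k x), (log (Λ / Z) + β * a) / 3, Λ * (M * C'), ?_, ?_, ?_, ?_, ?_⟩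
  · exact (hfm.mul hkm).const_mul Λ
  · exact fun x => mul_nonneg hΛ0.le (mul_nonneg (hf.2.2.1 x) (hk0 x))
  · intro x
    have h1 : f x ≤ M := (le_abs_self _).trans (hM x)
    have h2 : 0 ≤ M := (abs_nonneg _).trans (hM x)
    calc Λ * (f x * k x) ≤ Λ * (M * (C' * ((1 + ‖x‖ ^ 2) ^ 3)⁻¹)) := by
          have := hk0 x
          have := hkC x
          gcongr
      _ = _ := by ring
  · rw [integral_const_mul, ← integral_densMeas hkm hk0, hf.2.2.2, mul_one]
  · intro x
    have e1 : ∫ y, -log ‖x - y‖ * (Λ * (f y * k y)) = Λ * ∫ y, -log ‖x - y‖ * f y ∂ν := by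
      rw [hν, integral_densMeas hkm hk0, ← integral_const_mul]
      exact integral_congr_ae (Eventually.of_forall fun y => by simp only; ring)
    have hx := hfeq x
    unfold gib at hx
    rw [hpot x, ← hZ] at hx
    simp only
    rw [e1, hx]
    set I := ∫ y, -log ‖x - y‖ * f y ∂ν
    have e2 : 3 * ((log (Λ / Z) + β * a) / 3 + 1 / (2 * π ^ 2) * (Λ * I))
        = log (Λ / Z) + (β * a + β * I) := by
      rw [hΛ, hβ]; field_simp; ring
    have hb : 0 < 1 + ‖x‖ ^ 2 := by positivity
    have e3 : exp (β * (log (1 + ‖x‖ ^ 2) / 2 + a + I))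
        = (1 + ‖x‖ ^ 2) ^ (β / 2) * exp (β * a + β * I) := by
      rw [Real.rpow_def_of_pos hb, ← Real.exp_add]; congr 1; ring
    have e4 : (1 + ‖x‖ ^ 2) ^ (β / 2) * (1 + ‖x‖ ^ 2) ^ (-β / 2) = 1 := by
      rw [← Real.rpow_add hb, show β / 2 + -β / 2 = 0 by ring, Real.rpow_zero]
    rw [e2, Real.exp_add, Real.exp_log (by positivity), e3, hk]
    simp only
    rw [show Λ * ((1 + ‖x‖ ^ 2) ^ (β / 2) * exp (β * a + β * I) / Z *
      (K x * (1 + ‖x‖ ^ 2) ^ (-β / 2))) = ((1 + ‖x‖ ^ 2) ^ (β / 2) * (1 + ‖x‖ ^ 2) ^ (-β / 2)) *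
      (K x * (Λ / Z * exp (β * a + β * I))) by ring, e4, one_mul]

end Density

section Potentials

/-- Measurable densities on `ℝ³` with rapid decay. -/
structure DecayDens (ρ : E3 → ℝ) (D : ℝ) : Prop where
  meas : Measurable ρ
  nonneg : ∀ x, 0 ≤ ρ x
  le : ∀ x, ρ x ≤ D * ((1 + ‖x‖ ^ 2) ^ 3)⁻¹

namespace DecayDens

variable {ρ : E3 → ℝ} {D : ℝ} (h : DecayDens ρ D)
include h

lemma integrable_moment : Integrable (fun x => (1 + ‖x‖ ^ 2) * ρ x) :=
  integrable_of_decay h.meas h.nonneg h.le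

lemma integrable : Integrable ρ := by
  refine h.integrable_moment.mono' h.meas.aestronglyMeasurable (Eventually.of_forall fun x => ?_)
  rw [Real.norm_of_nonneg (h.nonneg x)]
  nlinarith [h.nonneg x, mul_nonneg (sq_nonneg ‖x‖) (h.nonneg x)]

lemma const_nonneg : 0 ≤ D := by
  have := (h.nonneg 0).trans (h.le 0)
  simpa using this

lemma le_const (x : E3) : ρ x ≤ D := by
  refine (h.le x).trans (mul_le_of_le_one_right h.const_nonneg (inv_le_one_of_one_le₀ ?_))
  exact one_le_pow₀ (by nlinarith [sq_nonneg ‖x‖])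

lemma integrable_linear (a b : ℝ) (x : E3) : Integrable (fun y => (a + b * ‖x - y‖) * ρ y) := by
  refine (h.integrable_moment.const_mul (|a| + |b| * (‖x‖ + 1))).mono'
    (((by fun_prop : Measurable fun y : E3 => a + b * ‖x - y‖).mul h.meas).aestronglyMeasurable)
    (Eventually.of_forall fun y => ?_)
  rw [norm_mul, Real.norm_of_nonneg (h.nonneg y), ← mul_assoc]
  refine mul_le_mul_of_nonneg_right ?_ (h.nonneg y)
  have h1 : ‖a + b * ‖x - y‖‖ ≤ |a| + |b| * (‖x‖ + ‖y‖) := by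
    refine (norm_add_le _ _).trans ?_
    rw [norm_mul, norm_norm, Real.norm_eq_abs, Real.norm_eq_abs]
    gcongr
    exact norm_sub_le x y
  refine h1.trans ?_
  have h2 : ‖y‖ ≤ 1 + ‖y‖ ^ 2 := by nlinarith [sq_nonneg (‖y‖ - 1), norm_nonneg y]
  have h3 : 0 ≤ ‖y‖ ^ 2 := by positivity
  have h4 : |a| ≤ |a| * (1 + ‖y‖ ^ 2) := le_mul_of_one_le_right (abs_nonneg _) (by linarith)
  have h5 : |b| * (‖x‖ + ‖y‖) ≤ |b| * ((‖x‖ + 1) * (1 + ‖y‖ ^ 2)) := by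
    gcongr
    nlinarith [norm_nonneg x, mul_nonneg (norm_nonneg x) h3]
  linarith

lemma exists_riesz_bound {γ : ℝ} (h0 : 0 < γ) (h3 : γ < 3) : ∃ M, 0 ≤ M ∧ ∀ x,
    Integrable (fun y => ‖x - y‖ ^ (-γ) * ρ y) ∧ ∫ y, ‖x - y‖ ^ (-γ) * ρ y ≤ M := by
  have hz : ∀ z : E3, ‖z‖ ^ (-γ) ≤ kerMaj γ z + 1 := by
    intro z
    unfold kerMaj
    have h4 : 0 ≤ (2:ℝ) ^ ((6 - γ) / 2) * (1 + ‖z‖ ^ 2) ^ (-(6 - γ) / 2) := by positivity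
    by_cases hb : ‖z‖ < 1
    · rw [Set.indicator_of_mem (by simpa using hb)]; linarith
    · rw [Set.indicator_of_notMem (by simpa using hb)]
      have : ‖z‖ ^ (-γ) ≤ 1 := Real.rpow_le_one_of_one_le_of_nonpos (not_lt.1 hb) (by linarith)
      linarith
  have hi : ∀ x : E3, Integrable fun y => D * kerMaj γ (x - y) + ρ y := fun x =>
    (((integrable_kerMaj h3).comp_sub_left x).const_mul D).add h.integrable
  have hle : ∀ x y : E3, ‖x - y‖ ^ (-γ) * ρ y ≤ D * kerMaj γ (x - y) + ρ y := by
    intro x y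
    have h1 : 0 ≤ kerMaj γ (x - y) := by
      unfold kerMaj
      have : 0 ≤ (Metric.ball 0 1).indicator (fun z : E3 => ‖z‖ ^ (-γ)) (x - y) :=
        Set.indicator_nonneg (fun _ _ => by positivity) _
      positivity
    calc _ ≤ (kerMaj γ (x - y) + 1) * ρ y := mul_le_mul_of_nonneg_right (hz _) (h.nonneg y)
      _ = kerMaj γ (x - y) * ρ y + ρ y := by ring
      _ ≤ _ := by
        rw [mul_comm D]
        gcongr
        exact h.le_const y
  have h_integrable : ∀ x, Integrable (fun y => ‖x - y‖ ^ (-γ) * ρ y) := fun x =>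
    (hi x).mono' ((Measurable.mul (Measurable.pow_const (by fun_prop) _)
      h.meas).aestronglyMeasurable) (Eventually.of_forall fun y => by
        rw [Real.norm_of_nonneg (mul_nonneg (by positivity) (h.nonneg y))]; exact hle x y)
  refine ⟨D * (∫ z, kerMaj γ z) + ∫ y, ρ y, ?_, fun x => ⟨h_integrable x, ?_⟩⟩
  · refine le_trans (integral_nonneg fun y => mul_nonneg ?_ (h.nonneg y))
      ((integral_mono (h_integrable 0) (hi 0) (hle 0)).trans_eq ?_)
    · positivity
    · rw [integral_add (((integrable_kerMaj h3).comp_sub_left 0).const_mul D) h.integrable,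
        integral_const_mul, integral_sub_left_eq_self (kerMaj γ)]
  · refine (integral_mono (h_integrable x) (hi x) (hle x)).trans_eq ?_
    rw [integral_add (((integrable_kerMaj h3).comp_sub_left x).const_mul D) h.integrable,
        integral_const_mul, integral_sub_left_eq_self (kerMaj γ)]

/-- Differentiation of a potential whose kernel is a limit of smooth kernels. -/
theorem hasFDerivAt_potential {Φ : E3 → ℝ} {Φ' : E3 → E3 →L[ℝ] ℝ} {P : ℕ → E3 → ℝ}
    {P' : ℕ → E3 → E3 →L[ℝ] ℝ} (hP : ∀ n z, HasFDerivAt (P n) (P' n z) z)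
    (hc : ∀ n, Continuous (P' n)) (hb : ∀ n, ∃ B, ∀ z, ‖P' n z‖ ≤ B)
    (hm : Measurable Φ) (hm' : Measurable Φ') {a a' : ℕ → ℝ} (ha : Tendsto a atTop (nhds 0))
    (ha' : Tendsto a' atTop (nhds 0)) {γ γ' : ℝ} (hγ0 : 0 < γ) (hγ3 : γ < 3) (hγ'0 : 0 < γ')
    (hγ'3 : γ' < 3) (hΦ : ∀ n z, z ≠ 0 → ‖P n z - Φ z‖ ≤ a n * ‖z‖ ^ (-γ))
    (hΦ' : ∀ n z, z ≠ 0 → ‖P' n z - Φ' z‖ ≤ a' n * ‖z‖ ^ (-γ')) (x : E3) :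
    Integrable (fun y => Φ (x - y) * ρ y) ∧ Integrable (fun y => ρ y • Φ' (x - y)) ∧
    HasFDerivAt (fun x => ∫ y, Φ (x - y) * ρ y) (∫ y, ρ y • Φ' (x - y)) x := by
  obtain ⟨M, hM0, hM⟩ := h.exists_riesz_bound hγ0 hγ3
  obtain ⟨M', hM'0, hM'⟩ := h.exists_riesz_bound hγ'0 hγ'3
  have hPc : ∀ n, Continuous (P n) := fun n =>
    continuous_iff_continuousAt.2 fun z => (hP n z).continuousAt
  have hPint : ∀ n x, Integrable (fun y => P n (x - y) * ρ y) := by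
    intro n x
    obtain ⟨B, hB⟩ := hb n
    refine (h.integrable_linear |P n 0| B x).mono' ((((hPc n).measurable.comp
      (by fun_prop)).mul h.meas).aestronglyMeasurable) (Eventually.of_forall fun y => ?_)
    rw [norm_mul, Real.norm_of_nonneg (h.nonneg y)]
    refine mul_le_mul_of_nonneg_right ?_ (h.nonneg y)
    have := convex_univ.norm_image_sub_le_of_norm_hasFDerivWithin_le
      (fun z _ => (hP n z).hasFDerivWithinAt) (fun z _ => hB z) (Set.mem_univ 0)
      (Set.mem_univ (x - y))
    rw [sub_zero] at this
    calc ‖P n (x - y)‖ = ‖P n 0 + (P n (x - y) - P n 0)‖ := by rw [add_sub_cancel]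
      _ ≤ _ := (norm_add_le _ _).trans (by rw [Real.norm_eq_abs]; linarith)
  have hP'int : ∀ n x, Integrable (fun y => ρ y • P' n (x - y)) := by
    intro n x
    obtain ⟨B, hB⟩ := hb n
    refine (h.integrable.mul_const B).mono' (h.meas.aestronglyMeasurable.smul
      ((hc n).comp (by fun_prop)).aestronglyMeasurable) (Eventually.of_forall fun y => ?_)
    rw [norm_smul, Real.norm_of_nonneg (h.nonneg y)]
    exact mul_le_mul_of_nonneg_left (hB _) (h.nonneg y)
  have hd : ∀ n x, HasFDerivAt (fun x => ∫ y, P n (x - y) * ρ y)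
      (∫ y, ρ y • P' n (x - y)) x := by
    intro n x
    obtain ⟨B, hB⟩ := hb n
    refine hasFDerivAt_integral_of_dominated_of_fderiv_le (bound := fun y => ρ y * B)
      (F' := fun x y => ρ y • P' n (x - y))
      univ_mem (Eventually.of_forall fun x => (hPint n x).aestronglyMeasurable) (hPint n x)
      (hP'int n x).aestronglyMeasurable (Eventually.of_forall fun y z _ => ?_)
      (h.integrable.mul_const B) (Eventually.of_forall fun y z _ => ?_)
    · rw [norm_smul, Real.norm_of_nonneg (h.nonneg y)]
      exact mul_le_mul_of_nonneg_left (hB _) (h.nonneg y)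
    · exact ((hP n (z - y)).comp z ((hasFDerivAt_id z).sub_const y)).mul_const (ρ y)
  have hbd : ∀ n x, ∀ᵐ y : E3, ‖P n (x - y) * ρ y - Φ (x - y) * ρ y‖
      ≤ a n * (‖x - y‖ ^ (-γ) * ρ y) := by
    intro n x
    filter_upwards [Measure.ae_ne volume x] with y hy
    rw [← sub_mul, norm_mul, Real.norm_of_nonneg (h.nonneg y), ← mul_assoc]
    exact mul_le_mul_of_nonneg_right (hΦ n _ (sub_ne_zero.2 hy.symm)) (h.nonneg y)
  have hbd' : ∀ n x, ∀ᵐ y : E3, ‖ρ y • P' n (x - y) - ρ y • Φ' (x - y)‖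
      ≤ a' n * (‖x - y‖ ^ (-γ') * ρ y) := by
    intro n x
    filter_upwards [Measure.ae_ne volume x] with y hy
    have e : ρ y • P' n (x - y) - ρ y • Φ' (x - y) = ρ y • (P' n (x - y) - Φ' (x - y)) :=
      (smul_sub (ρ y) (P' n (x - y)) (Φ' (x - y))).symm
    rw [e, norm_smul, Real.norm_of_nonneg (h.nonneg y), mul_comm (ρ y), ← mul_assoc]
    exact mul_le_mul_of_nonneg_right (hΦ' n _ (sub_ne_zero.2 hy.symm)) (h.nonneg y)
  have hΦint : ∀ x, Integrable (fun y => Φ (x - y) * ρ y) := by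
    intro x
    have : Integrable (fun y => P 0 (x - y) * ρ y - Φ (x - y) * ρ y) :=
      ((hM x).1.const_mul (a 0)).mono' ((hPint 0 x).aestronglyMeasurable.sub
        ((hm.comp (by fun_prop)).mul h.meas).aestronglyMeasurable) (hbd 0 x)
    exact ((hPint 0 x).sub this).congr (Eventually.of_forall fun y => sub_sub_cancel _ _)
  have hΦ'int : ∀ x, Integrable (fun y => ρ y • Φ' (x - y)) := by
    intro x
    have hms : AEStronglyMeasurable (fun y => Φ' (x - y)) volume :=
      (hm'.comp (by fun_prop : Measurable fun y : E3 => x - y)).aestronglyMeasurable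
    have : Integrable (fun y => ρ y • P' 0 (x - y) - ρ y • Φ' (x - y)) :=
      ((hM' x).1.const_mul (a' 0)).mono' ((hP'int 0 x).aestronglyMeasurable.sub
        (h.meas.aestronglyMeasurable.smul hms)) (hbd' 0 x)
    exact ((hP'int 0 x).sub this).congr (Eventually.of_forall fun y => sub_sub_cancel _ _)
  refine ⟨hΦint x, hΦ'int x, hasFDerivAt_of_tendstoUniformly (l := atTop)
    (f := fun n x => ∫ y, P n (x - y) * ρ y) (f' := fun n x => ∫ y, ρ y • P' n (x - y))
    (g' := fun x => ∫ y, ρ y • Φ' (x - y)) ?_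
    hd (fun x => ?_) x⟩
  · rw [Metric.tendstoUniformly_iff]
    intro ε hε
    have : Tendsto (fun n => |a' n| * M') atTop (nhds (|0| * M')) := ha'.abs.mul_const M'
    rw [abs_zero, zero_mul] at this
    filter_upwards [this.eventually (gt_mem_nhds hε)] with n hn x
    rw [dist_comm, dist_eq_norm, ← integral_sub (hP'int n x) (hΦ'int x)]
    refine (norm_integral_le_of_norm_le ((hM' x).1.const_mul (a' n)) (hbd' n x)).trans_lt ?_
    rw [integral_const_mul]
    refine lt_of_le_of_lt ?_ hn
    refine (mul_le_mul_of_nonneg_right (le_abs_self _) ?_).trans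
      (mul_le_mul_of_nonneg_left (hM' x).2 (abs_nonneg _))
    exact integral_nonneg fun y => mul_nonneg (by positivity) (h.nonneg y)
  · rw [tendsto_iff_norm_sub_tendsto_zero]
    refine squeeze_zero (fun n => norm_nonneg _) (fun n => ?_)
      (by simpa using ha.mul_const (∫ y, ‖x - y‖ ^ (-γ) * ρ y))
    rw [← integral_sub (hPint n x) (hΦint x), ← integral_const_mul]
    exact norm_integral_le_of_norm_le ((hM x).1.const_mul (a n)) (hbd n x)

end DecayDens

end Potentials

section LogPotential

private lemma tendsto_eps : Tendsto (fun n : ℕ => (1 / ((n : ℝ) + 1))) atTop (nhds 0) :=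
  tendsto_one_div_add_atTop_nhds_zero_nat

namespace DecayDens

variable {ρ : E3 → ℝ} {D : ℝ} (h : DecayDens ρ D)
include h

lemma hasFDerivAt_log_potential (x : E3) :
    Integrable (fun y => log ‖x - y‖ * ρ y) ∧
    Integrable (fun y => ρ y • ((‖x - y‖ ^ 2)⁻¹ • innerSL ℝ (x - y))) ∧
    HasFDerivAt (fun x => ∫ y, log ‖x - y‖ * ρ y)
      (∫ y, ρ y • ((‖x - y‖ ^ 2)⁻¹ • innerSL ℝ (x - y))) x := by
  refine h.hasFDerivAt_potential (Φ := fun z => log ‖z‖)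
    (Φ' := fun z => (‖z‖ ^ 2)⁻¹ • innerSL ℝ z)
    (P := fun n z => log (‖z‖ ^ 2 + (1 / ((n : ℝ) + 1)) ^ 2) / 2)
    (P' := fun n z => (‖z‖ ^ 2 + (1 / ((n : ℝ) + 1)) ^ 2)⁻¹ • innerSL ℝ z)
    (a := fun n => 1 / ((n : ℝ) + 1)) (a' := fun n => 1 / ((n : ℝ) + 1)) (γ := 1) (γ' := 2)
    (fun n z => ?_) (fun n => ?_) (fun n => ?_) (by fun_prop) ?_
    tendsto_eps tendsto_eps one_pos (by norm_num) two_pos (by norm_num)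
    (fun n z hz => ?_) (fun n z hz => ?_) x
  · have hpos : 0 < ‖z‖ ^ 2 + (1 / ((n : ℝ) + 1)) ^ 2 := by positivity
    have := (((hasStrictFDerivAt_norm_sq z).hasFDerivAt.add_const
      ((1 / ((n : ℝ) + 1)) ^ 2)).log hpos.ne').mul_const (1 / 2 : ℝ)
    refine (this.congr_fderiv ?_).congr_of_eventuallyEq (Eventually.of_forall fun w => ?_)
    · ext w
      simp
      ring
    · exact div_eq_mul_one_div _ _
  · have hpos : ∀ z : E3, ‖z‖ ^ 2 + (1 / ((n : ℝ) + 1)) ^ 2 ≠ 0 := fun z => by positivity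
    exact Continuous.smul (Continuous.inv₀ (by fun_prop) hpos) (innerSL ℝ).continuous
  · refine ⟨(n + 1 : ℝ), fun z => ?_⟩
    rw [norm_smul, innerSL_apply_norm, norm_inv, Real.norm_of_nonneg (by positivity)]
    have : (0:ℝ) < n + 1 := by positivity
    rw [inv_mul_le_iff₀ (by positivity), div_pow, one_pow]
    have e : (‖z‖ ^ 2 + 1 / ((n : ℝ) + 1) ^ 2) * (n + 1)
        = ‖z‖ ^ 2 * (n + 1) + 1 / (n + 1) := by field_simp
    rw [e]
    have h2 : (‖z‖ * (n + 1)) ^ 2 / (n + 1) + 1 / (n + 1) ≥ 2 * (‖z‖ * (n + 1)) / (n + 1) := by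
      rw [← add_div, ge_iff_le]
      gcongr
      nlinarith [sq_nonneg (‖z‖ * (n + 1) - 1)]
    have e2 : (‖z‖ * (n + 1)) ^ 2 / ((n : ℝ) + 1) = ‖z‖ ^ 2 * (n + 1) := by field_simp
    have e3 : 2 * (‖z‖ * (n + 1)) / ((n : ℝ) + 1) = 2 * ‖z‖ := by field_simp
    rw [e2, e3] at h2
    linarith [norm_nonneg z]
  · have : Measurable fun z : E3 => (‖z‖ ^ 2)⁻¹ := by fun_prop
    exact this.smul (innerSL ℝ).continuous.measurable
  · have hr : 0 < ‖z‖ := norm_pos_iff.2 hz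
    set ε : ℝ := 1 / ((n : ℝ) + 1) with hε
    have hε0 : 0 < ε := by positivity
    have e : log (‖z‖ ^ 2 + ε ^ 2) / 2 - log ‖z‖ = log (1 + (ε / ‖z‖) ^ 2) / 2 := by
      have : ‖z‖ ^ 2 + ε ^ 2 = ‖z‖ ^ 2 * (1 + (ε / ‖z‖) ^ 2) := by field_simp
      rw [this, Real.log_mul (by positivity) (by positivity), Real.log_pow]; push_cast; ring
    have h1 : log (1 + (ε / ‖z‖) ^ 2) ≤ 2 * (ε / ‖z‖) := by
      have ht : 0 < ε / ‖z‖ := by positivity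
      calc log (1 + (ε / ‖z‖) ^ 2) ≤ log ((1 + ε / ‖z‖) ^ 2) :=
            Real.log_le_log (by positivity) (by nlinarith)
        _ = 2 * log (1 + ε / ‖z‖) := by rw [Real.log_pow]; push_cast; ring
        _ ≤ _ := by
          have := Real.log_le_sub_one_of_pos (show 0 < 1 + ε / ‖z‖ by positivity)
          linarith
    have h2 : 0 ≤ log (1 + (ε / ‖z‖) ^ 2) := Real.log_nonneg (by nlinarith [sq_nonneg (ε / ‖z‖)])
    change ‖log (‖z‖ ^ 2 + ε ^ 2) / 2 - log ‖z‖‖ ≤ ε * ‖z‖ ^ (-1 : ℝ)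
    rw [e, Real.norm_of_nonneg (by positivity), Real.rpow_neg_one]
    rw [← div_eq_mul_inv]
    linarith
  · have hr : 0 < ‖z‖ := norm_pos_iff.2 hz
    set ε : ℝ := 1 / ((n : ℝ) + 1) with hε
    have hε0 : 0 < ε := by positivity
    have e0 : (‖z‖ ^ 2 + ε ^ 2)⁻¹ • innerSL ℝ z - (‖z‖ ^ 2)⁻¹ • innerSL ℝ z
        = ((‖z‖ ^ 2 + ε ^ 2)⁻¹ - (‖z‖ ^ 2)⁻¹) • innerSL ℝ z := (sub_smul _ _ _).symm
    have e1 : (‖z‖ ^ 2 + ε ^ 2)⁻¹ - (‖z‖ ^ 2)⁻¹ = -(ε ^ 2 / (‖z‖ ^ 2 * (‖z‖ ^ 2 + ε ^ 2))) := by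
      field_simp; ring
    change ‖(‖z‖ ^ 2 + ε ^ 2)⁻¹ • innerSL ℝ z - (‖z‖ ^ 2)⁻¹ • innerSL ℝ z‖ ≤ ε * ‖z‖ ^ (-2 : ℝ)
    rw [e0, e1, norm_smul, innerSL_apply_norm, norm_neg, Real.norm_of_nonneg (by positivity),
      show (-2 : ℝ) = -((2 : ℕ) : ℝ) by norm_num, Real.rpow_neg hr.le, Real.rpow_natCast]
    have e2 : ε ^ 2 / (‖z‖ ^ 2 * (‖z‖ ^ 2 + ε ^ 2)) * ‖z‖
        = (ε * ‖z‖ / (‖z‖ ^ 2 + ε ^ 2)) * (ε * (‖z‖ ^ 2)⁻¹) := by field_simp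
    rw [e2]
    refine mul_le_of_le_one_left (by positivity) ?_
    rw [div_le_one (by positivity)]
    nlinarith [sq_nonneg (ε - ‖z‖), mul_pos hε0 hr]

omit h in
private lemma ratio_le {ε r : ℝ} (hε : 0 < ε) (hr : 0 < r) :
    ε ^ 2 / (r ^ 2 + ε ^ 2) ≤ ε ^ (1 / 2 : ℝ) * r ^ (-(1 / 2) : ℝ) := by
  have e : ε ^ (1 / 2 : ℝ) * r ^ (-(1 / 2) : ℝ) = (ε / r) ^ (1 / 2 : ℝ) := by
    rw [Real.div_rpow hε.le hr.le, Real.rpow_neg hr.le, ← div_eq_mul_inv]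
  rw [e]
  rcases le_total r ε with hle | hle
  · calc ε ^ 2 / (r ^ 2 + ε ^ 2) ≤ 1 := by rw [div_le_one (by positivity)]; nlinarith
      _ ≤ _ := Real.one_le_rpow ((one_le_div hr).2 hle) (by norm_num)
  · calc ε ^ 2 / (r ^ 2 + ε ^ 2) ≤ ε ^ 2 / r ^ 2 := by gcongr; nlinarith
      _ = (ε / r) ^ (2 : ℝ) := by rw [← div_pow, ← Real.rpow_natCast]; norm_cast
      _ ≤ _ := Real.rpow_le_rpow_of_exponent_ge (by positivity) ((div_le_one hr).2 hle)
          (by norm_num)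

/-- The derivative of the kernel `z ↦ ⟪z, v⟫ / |z|²`. -/
noncomputable def _root_.rieszGrad (v z : E3) : E3 →L[ℝ] ℝ :=
  (‖z‖ ^ 2)⁻¹ • innerSL ℝ v - (2 * inner ℝ v z * ((‖z‖ ^ 2)⁻¹) ^ 2) • innerSL ℝ z

lemma hasFDerivAt_riesz_potential (v x : E3) :
    Integrable (fun y => (inner ℝ v (x - y) * (‖x - y‖ ^ 2)⁻¹) * ρ y) ∧
    Integrable (fun y => ρ y • rieszGrad v (x - y)) ∧
    HasFDerivAt (fun x => ∫ y, (inner ℝ v (x - y) * (‖x - y‖ ^ 2)⁻¹) * ρ y)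
      (∫ y, ρ y • rieszGrad v (x - y)) x := by
  have hin : ∀ z : E3, |inner ℝ v z| ≤ ‖v‖ * ‖z‖ := fun z => abs_real_inner_le_norm v z
  refine h.hasFDerivAt_potential (Φ := fun z => inner ℝ v z * (‖z‖ ^ 2)⁻¹)
    (Φ' := rieszGrad v)
    (P := fun n z => inner ℝ v z * (‖z‖ ^ 2 + (1 / ((n : ℝ) + 1)) ^ 2)⁻¹)
    (P' := fun n z => (‖z‖ ^ 2 + (1 / ((n : ℝ) + 1)) ^ 2)⁻¹ • innerSL ℝ v -
      (2 * inner ℝ v z * ((‖z‖ ^ 2 + (1 / ((n : ℝ) + 1)) ^ 2)⁻¹) ^ 2) • innerSL ℝ z)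
    (a := fun n => ‖v‖ * (1 / ((n : ℝ) + 1)))
    (a' := fun n => 5 * ‖v‖ * (1 / ((n : ℝ) + 1)) ^ (1 / 2 : ℝ)) (γ := 2) (γ' := 5 / 2)
    (fun n z => ?_) (fun n => ?_) (fun n => ?_) (by fun_prop) ?_
    (by simpa using tendsto_eps.const_mul ‖v‖) ?_ two_pos (by norm_num) (by norm_num) (by norm_num)
    (fun n z hz => ?_) (fun n z hz => ?_) x
  · have hpos : 0 < ‖z‖ ^ 2 + (1 / ((n : ℝ) + 1)) ^ 2 := by positivity
    have h1 := ((hasStrictFDerivAt_norm_sq z).hasFDerivAt.add_const ((1 / ((n : ℝ) + 1)) ^ 2))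
    have h2 := (hasDerivAt_inv hpos.ne').comp_hasFDerivAt z h1
    have h3 := (innerSL ℝ v).hasFDerivAt (x := z)
    refine (h3.mul h2).congr_fderiv ?_
    ext w
    simp
    ring
  · have hpos : ∀ z : E3, ‖z‖ ^ 2 + (1 / ((n : ℝ) + 1)) ^ 2 ≠ 0 := fun z => by positivity
    have hi : Continuous fun z : E3 => (‖z‖ ^ 2 + (1 / ((n : ℝ) + 1)) ^ 2)⁻¹ :=
      Continuous.inv₀ (by fun_prop) hpos
    have hi' : Continuous fun z : E3 => 2 * inner ℝ v z *
        ((‖z‖ ^ 2 + (1 / ((n : ℝ) + 1)) ^ 2)⁻¹) ^ 2 :=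
      (continuous_const.mul (by fun_prop)).mul (hi.pow 2)
    exact (hi.smul continuous_const).sub (hi'.smul (innerSL ℝ).continuous)
  · set ε : ℝ := 1 / ((n : ℝ) + 1) with hε
    have hε0 : 0 < ε := by positivity
    refine ⟨(ε ^ 2)⁻¹ * ‖v‖ + 2 * ‖v‖ * (ε ^ 2)⁻¹, fun z => ?_⟩
    refine (norm_sub_le _ _).trans ?_
    rw [norm_smul, norm_smul, innerSL_apply_norm, innerSL_apply_norm,
      Real.norm_of_nonneg (by positivity : 0 ≤ (‖z‖ ^ 2 + ε ^ 2)⁻¹), Real.norm_eq_abs, abs_mul,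
      abs_mul, abs_two, abs_of_nonneg (by positivity : 0 ≤ ((‖z‖ ^ 2 + ε ^ 2)⁻¹) ^ 2)]
    have h1 : (‖z‖ ^ 2 + ε ^ 2)⁻¹ ≤ (ε ^ 2)⁻¹ := by gcongr; nlinarith [sq_nonneg ‖z‖]
    have h2 : 2 * |inner ℝ v z| * ((‖z‖ ^ 2 + ε ^ 2)⁻¹) ^ 2 * ‖z‖ ≤ 2 * ‖v‖ * (ε ^ 2)⁻¹ :=
      calc _ ≤ 2 * (‖v‖ * ‖z‖) * ((‖z‖ ^ 2 + ε ^ 2)⁻¹) ^ 2 * ‖z‖ := by gcongr; exact hin z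
        _ = 2 * ‖v‖ * ((‖z‖ ^ 2 / (‖z‖ ^ 2 + ε ^ 2)) * (‖z‖ ^ 2 + ε ^ 2)⁻¹) := by
          field_simp
        _ ≤ 2 * ‖v‖ * (1 * (ε ^ 2)⁻¹) := by
          gcongr
          rw [div_le_one (by positivity)]; nlinarith
        _ = _ := by ring
    gcongr
  · have : Measurable fun z : E3 => (‖z‖ ^ 2)⁻¹ := by fun_prop
    have hi' : Measurable fun z : E3 => 2 * inner ℝ v z * ((‖z‖ ^ 2)⁻¹) ^ 2 :=
      (Measurable.const_mul (by fun_prop) 2).mul (this.pow_const 2)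
    exact (this.smul measurable_const).sub (hi'.smul (innerSL ℝ).continuous.measurable)
  · have := (tendsto_eps.rpow_const (p := 1 / 2) (Or.inr (by norm_num))).const_mul (5 * ‖v‖)
    simpa using this
  · have hr : 0 < ‖z‖ := norm_pos_iff.2 hz
    set ε : ℝ := 1 / ((n : ℝ) + 1) with hε
    have hε0 : 0 < ε := by positivity
    have e1 : (‖z‖ ^ 2 + ε ^ 2)⁻¹ - (‖z‖ ^ 2)⁻¹ = -(ε ^ 2 / (‖z‖ ^ 2 * (‖z‖ ^ 2 + ε ^ 2))) := by
      field_simp; ring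
    change ‖inner ℝ v z * (‖z‖ ^ 2 + ε ^ 2)⁻¹ - inner ℝ v z * (‖z‖ ^ 2)⁻¹‖
      ≤ ‖v‖ * ε * ‖z‖ ^ (-2 : ℝ)
    rw [← mul_sub, e1, mul_neg, norm_neg, norm_mul,
      Real.norm_of_nonneg (by positivity : 0 ≤ ε ^ 2 / (‖z‖ ^ 2 * (‖z‖ ^ 2 + ε ^ 2))),
      show (-2 : ℝ) = -((2 : ℕ) : ℝ) by norm_num, Real.rpow_neg hr.le, Real.rpow_natCast]
    calc _ ≤ ‖v‖ * ‖z‖ * (ε ^ 2 / (‖z‖ ^ 2 * (‖z‖ ^ 2 + ε ^ 2))) := by gcongr; exact hin z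
      _ = (ε * ‖z‖ / (‖z‖ ^ 2 + ε ^ 2)) * (‖v‖ * ε * (‖z‖ ^ 2)⁻¹) := by field_simp
      _ ≤ _ := by
        refine mul_le_of_le_one_left (by positivity) ?_
        rw [div_le_one (by positivity)]
        nlinarith [sq_nonneg (ε - ‖z‖), mul_pos hε0 hr]
  · have hr : 0 < ‖z‖ := norm_pos_iff.2 hz
    set ε : ℝ := 1 / ((n : ℝ) + 1) with hε
    have hε0 : 0 < ε := by positivity
    set r := ‖z‖ with hrdef
    set A := (r ^ 2 + ε ^ 2)⁻¹ with hA
    have hA0 : 0 < A := by positivity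
    have e0 : A • innerSL ℝ v - (2 * inner ℝ v z * A ^ 2) • innerSL ℝ z - rieszGrad v z
        = (-((r ^ 2)⁻¹ - A)) • innerSL ℝ v
          + (2 * inner ℝ v z * (((r ^ 2)⁻¹) ^ 2 - A ^ 2)) • innerSL ℝ z := by
      ext w
      simp [rieszGrad, ← hrdef]
      ring
    have hd : (r ^ 2)⁻¹ - A = (ε ^ 2 / (r ^ 2 + ε ^ 2)) * (r ^ 2)⁻¹ := by
      rw [hA]; field_simp; ring
    have hd0 : 0 ≤ (r ^ 2)⁻¹ - A := by rw [hd]; positivity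
    have hAle : A ≤ (r ^ 2)⁻¹ := by linarith
    have hs : ((r ^ 2)⁻¹) ^ 2 - A ^ 2 ≤ 2 * (r ^ 2)⁻¹ * ((r ^ 2)⁻¹ - A) := by nlinarith
    have hs0 : 0 ≤ ((r ^ 2)⁻¹) ^ 2 - A ^ 2 := by nlinarith
    rw [e0]
    refine (norm_add_le _ _).trans ?_
    rw [norm_smul, norm_smul, innerSL_apply_norm, innerSL_apply_norm, norm_neg,
      Real.norm_of_nonneg hd0, Real.norm_eq_abs, abs_mul, abs_mul, abs_two, abs_of_nonneg hs0,
      ← hrdef]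
    calc ((r ^ 2)⁻¹ - A) * ‖v‖ + 2 * |inner ℝ v z| * (((r ^ 2)⁻¹) ^ 2 - A ^ 2) * r
        ≤ ((r ^ 2)⁻¹ - A) * ‖v‖ + 2 * (‖v‖ * r) * (2 * (r ^ 2)⁻¹ * ((r ^ 2)⁻¹ - A)) * r := by
          gcongr
          exact hin z
      _ = 5 * ‖v‖ * ((r ^ 2)⁻¹ - A) := by field_simp; ring
      _ ≤ 5 * ‖v‖ * ((ε ^ (1 / 2 : ℝ) * r ^ (-(1 / 2) : ℝ)) * (r ^ 2)⁻¹) := by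
          rw [hd]
          gcongr
          exact ratio_le hε0 hr
      _ = _ := by
          rw [show (-(5 / 2) : ℝ) = -(1 / 2) + -((2 : ℕ) : ℝ) by norm_num, Real.rpow_add hr,
            Real.rpow_neg hr.le ((2 : ℕ) : ℝ), Real.rpow_natCast]
          ring

end DecayDens

end LogPotential

section NormalSolution

/-- The normalized logarithmic potential of `ρ`. -/
noncomputable def logPot (c : ℝ) (ρ : E3 → ℝ) (x : E3) : ℝ :=
  c + 1 / (2 * π ^ 2) * ∫ y, -log ‖x - y‖ * ρ y

lemma norm_rieszGrad_le (v z : E3) : ‖rieszGrad v z‖ ≤ 3 * ‖v‖ * ‖z‖ ^ (-2 : ℝ) := by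
  have h2 : ‖z‖ ^ (-2 : ℝ) = (‖z‖ ^ 2)⁻¹ := by
    rw [show (-2 : ℝ) = -((2 : ℕ) : ℝ) by norm_num, Real.rpow_neg (norm_nonneg z), Real.rpow_natCast]
  rw [h2]
  rcases eq_or_ne z 0 with rfl | hz
  · simp [rieszGrad]
  have hr : 0 < ‖z‖ := norm_pos_iff.2 hz
  unfold rieszGrad
  refine (norm_sub_le _ _).trans ?_
  rw [norm_smul, norm_smul, innerSL_apply_norm, innerSL_apply_norm,
      Real.norm_of_nonneg (by positivity : 0 ≤ (‖z‖ ^ 2)⁻¹), Real.norm_eq_abs, abs_mul,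
      abs_mul, abs_two, abs_of_nonneg (by positivity : 0 ≤ ((‖z‖ ^ 2)⁻¹) ^ 2)]
  calc _ ≤ (‖z‖ ^ 2)⁻¹ * ‖v‖ + 2 * (‖v‖ * ‖z‖) * ((‖z‖ ^ 2)⁻¹) ^ 2 * ‖z‖ := by
        gcongr; exact abs_real_inner_le_norm v z
    _ = _ := by field_simp; ring

lemma measurable_rieszGrad (v : E3) : Measurable (rieszGrad v) := by
  have : Measurable fun z : E3 => (‖z‖ ^ 2)⁻¹ := by fun_prop
  have hi' : Measurable fun z : E3 => 2 * inner ℝ v z * ((‖z‖ ^ 2)⁻¹) ^ 2 :=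
    (Measurable.const_mul (by fun_prop) 2).mul (this.pow_const 2)
  exact (this.smul measurable_const).sub (hi'.smul (innerSL ℝ).continuous.measurable)

namespace DecayDens

variable {ρ : E3 → ℝ} {D : ℝ} (h : DecayDens ρ D) (c : ℝ)
include h

lemma hasFDerivAt_logPot (x : E3) : HasFDerivAt (logPot c ρ)
    (-(1 / (2 * π ^ 2)) • ∫ y, ρ y • ((‖x - y‖ ^ 2)⁻¹ • innerSL ℝ (x - y))) x := by
  have h1 := ((h.hasFDerivAt_log_potential x).2.2.const_mul (-(1 / (2 * π ^ 2)))).const_add c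
  refine h1.congr_of_eventuallyEq (Eventually.of_forall fun z => ?_)
  simp only [logPot, neg_mul, integral_neg, mul_neg]

lemma differentiable_logPot : Differentiable ℝ (logPot c ρ) :=
  fun x => (h.hasFDerivAt_logPot c x).differentiableAt

lemma fderiv_logPot_apply (x v : E3) : fderiv ℝ (logPot c ρ) x v =
    -(1 / (2 * π ^ 2)) * ∫ y, (inner ℝ v (x - y) * (‖x - y‖ ^ 2)⁻¹) * ρ y := by
  rw [(h.hasFDerivAt_logPot c x).fderiv, _root_.smul_apply,
    ContinuousLinearMap.integral_apply (h.hasFDerivAt_log_potential x).2.1, smul_eq_mul]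
  congr 1
  refine integral_congr_ae (Eventually.of_forall fun y => ?_)
  simp only [_root_.smul_apply, innerSL_apply_apply, smul_eq_mul,
    real_inner_comm (x - y) v]
  ring

lemma hasFDerivAt_fderiv_logPot (v x : E3) :
    HasFDerivAt (fun x => fderiv ℝ (logPot c ρ) x v)
      (-(1 / (2 * π ^ 2)) • ∫ y, ρ y • rieszGrad v (x - y)) x := by
  simp_rw [h.fderiv_logPot_apply c]
  exact (h.hasFDerivAt_riesz_potential v x).2.2.const_mul _

lemma exists_fderiv_logPot_le (v : E3) : ∃ B, ∀ x, |fderiv ℝ (logPot c ρ) x v| ≤ B := by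
  obtain ⟨M, hM0, hM⟩ := h.exists_riesz_bound one_pos (by norm_num)
  refine ⟨1 / (2 * π ^ 2) * (‖v‖ * M), fun x => ?_⟩
  rw [h.fderiv_logPot_apply c, abs_mul, abs_neg, abs_of_nonneg (by positivity)]
  gcongr
  rw [← Real.norm_eq_abs]
  refine (norm_integral_le_of_norm_le ((hM x).1.const_mul ‖v‖)
    (Eventually.of_forall fun y => ?_)).trans ?_
  · rw [norm_mul, Real.norm_of_nonneg (h.nonneg y), ← mul_assoc]
    refine mul_le_mul_of_nonneg_right ?_ (h.nonneg y)
    rw [norm_mul, norm_inv, norm_pow, norm_norm, Real.rpow_neg_one]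
    rcases eq_or_ne (x - y) 0 with h0 | h0
    · simp [h0]
    · have hr : 0 < ‖x - y‖ := norm_pos_iff.2 h0
      calc _ ≤ (‖v‖ * ‖x - y‖) * (‖x - y‖ ^ 2)⁻¹ := by
            gcongr; exact abs_real_inner_le_norm _ _
        _ = _ := by field_simp
  · rw [integral_const_mul]
    gcongr
    exact (hM x).2

lemma exists_fderiv_fderiv_logPot_le (v u : E3) :
    ∃ B, ∀ x, |fderiv ℝ (fun x => fderiv ℝ (logPot c ρ) x v) x u| ≤ B := by
  obtain ⟨M, hM0, hM⟩ := h.exists_riesz_bound two_pos (by norm_num)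
  refine ⟨1 / (2 * π ^ 2) * (3 * ‖v‖ * M) * ‖u‖, fun x => ?_⟩
  rw [(h.hasFDerivAt_fderiv_logPot c v x).fderiv]
  refine (ContinuousLinearMap.le_opNorm (-(1 / (2 * π ^ 2)) • ∫ y, ρ y • rieszGrad v (x - y))
    u).trans ?_
  gcongr
  rw [norm_smul, norm_neg, Real.norm_of_nonneg (by positivity)]
  gcongr
  refine (norm_integral_le_of_norm_le ((hM x).1.const_mul (3 * ‖v‖))
    (Eventually.of_forall fun y => ?_)).trans ?_
  · rw [norm_smul, Real.norm_of_nonneg (h.nonneg y), ← mul_assoc, mul_comm]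
    exact mul_le_mul_of_nonneg_right (norm_rieszGrad_le v _) (h.nonneg y)
  · rw [integral_const_mul]
    gcongr
    exact (hM x).2

lemma lap_logPot (x : E3) : lap (logPot c ρ) x =
    -(1 / (2 * π ^ 2)) * ∫ y, (‖x - y‖ ^ 2)⁻¹ * ρ y := by
  unfold lap
  have e : ∀ i : Fin 3, fderiv ℝ (fun y => fderiv ℝ (logPot c ρ) y (EuclideanSpace.single i 1)) x
      (EuclideanSpace.single i 1) = -(1 / (2 * π ^ 2)) * ∫ y, ρ y *
        rieszGrad (EuclideanSpace.single i 1) (x - y) (EuclideanSpace.single i 1) := by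
    intro i
    rw [(h.hasFDerivAt_fderiv_logPot c _ x).fderiv, _root_.smul_apply,
      ContinuousLinearMap.integral_apply (h.hasFDerivAt_riesz_potential _ x).2.1, smul_eq_mul]
    rfl
  have hi : ∀ i : Fin 3, Integrable (fun y => ρ y *
        rieszGrad (EuclideanSpace.single i 1) (x - y) (EuclideanSpace.single i 1)) := fun i =>
    (ContinuousLinearMap.apply ℝ ℝ (EuclideanSpace.single i 1)).integrable_comp
      (h.hasFDerivAt_riesz_potential (EuclideanSpace.single i 1) x).2.1
  simp_rw [e]
  rw [← Finset.mul_sum, ← integral_finsetSum _ fun i _ => hi i]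
  congr 1
  refine integral_congr_ae (Eventually.of_forall fun y => ?_)
  simp only
  rw [← Finset.mul_sum, mul_comm]
  congr 1
  rcases eq_or_ne (x - y) 0 with h0 | h0
  · simp [h0, rieszGrad]
  have hr : 0 < ‖x - y‖ := norm_pos_iff.2 h0
  have hs : ‖x - y‖ ^ 2 = ∑ i, (x - y) i ^ 2 := by
    rw [EuclideanSpace.norm_eq, Real.sq_sqrt (Finset.sum_nonneg fun i _ => by positivity)]
    simp
  set z := x - y
  have e2 : ∀ i : Fin 3, rieszGrad (EuclideanSpace.single i 1) z (EuclideanSpace.single i 1)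
      = (‖z‖ ^ 2)⁻¹ - 2 * ((‖z‖ ^ 2)⁻¹) ^ 2 * (z i) ^ 2 := by
    intro i
    simp [rieszGrad, EuclideanSpace.inner_single_left, EuclideanSpace.inner_single_right]
    ring
  simp_rw [e2]
  rw [Finset.sum_sub_distrib, ← Finset.mul_sum, ← hs]
  simp
  field_simp
  ring

omit h in
lemma measurable_lap_logPot : Measurable (lap (logPot c ρ)) := by
  unfold lap
  exact Finset.measurable_sum _ fun i _ => measurable_fderiv_apply_const ℝ _ _

lemma exists_lap_logPot_le : ∃ B, ∀ x, |lap (logPot c ρ) x| ≤ B := by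
  choose B hB using fun i : Fin 3 => h.exists_fderiv_fderiv_logPot_le c
    (EuclideanSpace.single i 1) (EuclideanSpace.single i 1)
  exact ⟨∑ i, B i, fun x => (Finset.abs_sum_le_sum_abs _ _).trans
    (Finset.sum_le_sum fun i _ => hB i x)⟩

omit h in
lemma _root_.locallyIntegrable_of_bounded {f : E3 → ℝ} (hm : Measurable f) {B : ℝ}
    (hB : ∀ x, |f x| ≤ B) : LocallyIntegrable f :=
  (locallyIntegrable_const B).mono hm.aestronglyMeasurable (Eventually.of_forall fun x => by
    rw [Real.norm_eq_abs]
    exact (hB x).trans (le_abs_self B))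

lemma memL12_lap_logPot : MemL12 (lap (logPot c ρ)) := by
  obtain ⟨B, hB⟩ := h.exists_lap_logPot_le c
  have hm := measurable_lap_logPot (ρ := ρ) c
  refine ⟨locallyIntegrable_of_bounded hm hB, ?_⟩
  refine (integrable_inv_one_add_sq_sq.const_mul (2 * B)).mono'
    ((hm.norm.div (by fun_prop)).aestronglyMeasurable) (Eventually.of_forall fun x => ?_)
  have hB0 : 0 ≤ B := (abs_nonneg _).trans (hB x)
  rw [norm_div, norm_abs_eq_norm, Real.norm_of_nonneg (by positivity : 0 ≤ 1 + ‖x‖ ^ 4),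
    Real.norm_eq_abs, div_le_iff₀ (by positivity)]
  refine (hB x).trans ?_
  rw [mul_assoc, mul_assoc, mul_left_comm]
  refine le_mul_of_one_le_right hB0 ?_
  rw [← mul_assoc, mul_comm, ← mul_assoc, le_mul_inv_iff₀ (by positivity)]
  nlinarith [sq_nonneg (‖x‖ ^ 2 - 1)]

end DecayDens

lemma integral_mul_pd {u φ : E3 → ℝ} (i : Fin 3) (hu : Differentiable ℝ u)
    (hb : ∃ B, ∀ x, |pd i u x| ≤ B) (hφ : ContDiff ℝ (⊤ : ℕ∞) φ) (hs : HasCompactSupport φ) :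
    ∫ x, u x * pd i φ x = -∫ x, pd i u x * φ x := by
  obtain ⟨B, hB⟩ := hb
  have hd : Continuous (pd i φ) :=
    (hφ.continuous_fderiv (by simp)).clm_apply continuous_const
  have hds : HasCompactSupport (pd i φ) := hs.fderiv_apply ℝ _
  refine integral_mul_fderiv_eq_neg_fderiv_mul_of_integrable ?_ ?_ ?_ (fun x _ => hu x)
    (fun x _ => hφ.differentiable (by simp) x)
  · refine (hφ.continuous.integrable_of_hasCompactSupport hs).bdd_mul (c := B)
      (measurable_fderiv_apply_const ℝ _ _).aestronglyMeasurable (Eventually.of_forall hB)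
  · exact (hu.continuous.mul hd).integrable_of_hasCompactSupport hds.mul_left
  · exact (hu.continuous.mul hφ.continuous).integrable_of_hasCompactSupport hs.mul_left

lemma contDiff_pd {φ : E3 → ℝ} (i : Fin 3) (hφ : ContDiff ℝ (⊤ : ℕ∞) φ) :
    ContDiff ℝ (⊤ : ℕ∞) (pd i φ) :=
  (hφ.fderiv_right (m := (⊤ : ℕ∞)) (by simp)).clm_apply contDiff_const

lemma exists_list_pdM (β : Fin 3 → ℕ) :
    ∃ l : List (Fin 3), l.length = ∑ i, β i ∧ ∀ φ, pdM β φ = l.foldr pd φ := by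
  have hr : ∀ (i : Fin 3) (n : ℕ) (φ : E3 → ℝ), (pd i)^[n] φ = (List.replicate n i).foldr pd φ := by
    intro i n φ
    induction n with
    | zero => rfl
    | succ n ih => rw [Function.iterate_succ_apply', ih]; rfl
  refine ⟨List.replicate (β 0) 0 ++ List.replicate (β 1) 1 ++ List.replicate (β 2) 2, ?_,
    fun φ => ?_⟩
  · simp [Fin.sum_univ_three, add_assoc]
  · simp only [pdM, hr, List.foldr_append]

end NormalSolution

section RieszKernels

lemma volume_real_ball_zero_one : (volume : Measure E3).real (Metric.ball 0 1) = 4 * π / 3 := by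
  rw [Measure.real, EuclideanSpace.volume_ball]
  have h1 : Gamma ((Fintype.card (Fin 3) : ℝ) / 2 + 1) = 3 / 4 * √π := by
    have : ((Fintype.card (Fin 3) : ℝ) / 2 + 1) = (1 / 2 + 1) + 1 := by norm_num
    rw [this, Gamma_add_one (by norm_num), Gamma_add_one (by norm_num), Gamma_one_half_eq]
    ring
  have h2 : √π ≠ 0 := by positivity
  have h3 : √π ^ 2 = π := sq_sqrt pi_pos.le
  rw [h1, Fintype.card_fin, ENNReal.ofReal_one, one_pow, one_mul,
    ENNReal.toReal_ofReal (by positivity)]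
  field_simp
  rw [h3]

lemma integral_radial_of_hasDerivAt {g G G' : ℝ → ℝ} {l : ℝ}
    (hd : ∀ r, HasDerivAt G (G' r) r) (hpos : ∀ r, 0 ≤ G' r) (heq : ∀ r, 0 < r → G' r = r ^ 2 * g r)
    (hl : Tendsto G atTop (nhds l)) :
    Integrable (fun x : E3 => g ‖x‖) ∧ ∫ x : E3, g ‖x‖ = 4 * π * (l - G 0) := by
  have hdim : Module.finrank ℝ E3 = 3 := by simp
  have hc : ∀ r ∈ Set.Ioi (0 : ℝ), G' r = r ^ (Module.finrank ℝ E3 - 1) • g r := by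
    intro r hr
    rw [hdim, heq r hr, smul_eq_mul]
  constructor
  · rw [integrable_fun_norm_addHaar (volume : Measure E3) (f := g)]
    exact (integrableOn_Ioi_deriv_of_nonneg' (fun r _ => hd r) (fun r _ => hpos r) hl).congr_fun hc
      measurableSet_Ioi
  · rw [integral_fun_norm_addHaar (volume : Measure E3) g, volume_real_ball_zero_one,
      ← setIntegral_congr_fun measurableSet_Ioi hc,
      integral_Ioi_of_hasDerivAt_of_nonneg' (fun r _ => hd r) (fun r _ => hpos r) hl, hdim]
    simp only [nsmul_eq_mul, smul_eq_mul]
    push_cast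
    ring

lemma hasDerivAt_arctan_div {ε : ℝ} (hε : 0 < ε) (r : ℝ) :
    HasDerivAt (fun r => arctan (r / ε) / ε) (ε ^ 2 + r ^ 2)⁻¹ r := by
  have h := (((hasDerivAt_id r).div_const ε).arctan).div_const ε
  refine h.congr_deriv ?_
  have : ε ^ 2 + r ^ 2 ≠ 0 := by positivity
  simp only [id]
  field_simp

lemma tendsto_arctan_div {ε : ℝ} (hε : 0 < ε) :
    Tendsto (fun r => arctan (r / ε) / ε) atTop (nhds (π / 2 / ε)) :=
  ((tendsto_nhds_of_tendsto_nhdsWithin tendsto_arctan_atTop).comp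
    (tendsto_id.atTop_div_const hε)).div_const ε

lemma integral_regularized_kernel {ε : ℝ} (hε : 0 < ε) :
    Integrable (fun z : E3 => ((ε ^ 2 + ‖z‖ ^ 2) ^ 2)⁻¹) ∧
      ∫ z : E3, ((ε ^ 2 + ‖z‖ ^ 2) ^ 2)⁻¹ = π ^ 2 / ε := by
  have hp : ∀ r : ℝ, 0 < ε ^ 2 + r ^ 2 := fun r => by positivity
  have hd : ∀ r : ℝ, HasDerivAt (fun r => 1 / 2 * (arctan (r / ε) / ε - r / (ε ^ 2 + r ^ 2)))
      (r ^ 2 * ((ε ^ 2 + r ^ 2) ^ 2)⁻¹) r := by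
    intro r
    have h := ((hasDerivAt_arctan_div hε r).sub ((hasDerivAt_id r).div
      (((hasDerivAt_pow 2 r).const_add (ε ^ 2))) (hp r).ne')).const_mul (1 / 2)
    refine h.congr_deriv ?_
    have := (hp r).ne'
    simp only [id]
    field_simp
    ring
  have hl : Tendsto (fun r => 1 / 2 * (arctan (r / ε) / ε - r / (ε ^ 2 + r ^ 2))) atTop
      (nhds (1 / 2 * (π / 2 / ε - 0))) := by
    refine ((tendsto_arctan_div hε).sub ?_).const_mul _
    refine squeeze_zero' (g := fun r : ℝ => r⁻¹) ?_ ?_ tendsto_inv_atTop_zero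
    · filter_upwards [eventually_gt_atTop 0] with r hr
      positivity
    · filter_upwards [eventually_gt_atTop 0] with r hr
      rw [div_le_iff₀ (hp r)]
      have : 0 < ε ^ 2 := by positivity
      have h2 : r⁻¹ * (ε ^ 2 + r ^ 2) = r⁻¹ * ε ^ 2 + r := by field_simp
      rw [h2]
      have : 0 ≤ r⁻¹ * ε ^ 2 := by positivity
      linarith
  obtain ⟨h1, h2⟩ := integral_radial_of_hasDerivAt (g := fun r => ((ε ^ 2 + r ^ 2) ^ 2)⁻¹) hd
    (fun r => by positivity) (fun r _ => rfl) hl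
  refine ⟨h1, h2.trans ?_⟩
  simp
  field_simp
  norm_num

lemma integral_riesz_kernel {ε : ℝ} (hε : 0 < ε) :
    Integrable (fun z : E3 => (‖z‖ ^ 2 * (ε ^ 2 + ‖z‖ ^ 2))⁻¹) ∧
      ∫ z : E3, (‖z‖ ^ 2 * (ε ^ 2 + ‖z‖ ^ 2))⁻¹ = 2 * π ^ 2 / ε := by
  obtain ⟨h1, h2⟩ := integral_radial_of_hasDerivAt (g := fun r => (r ^ 2 * (ε ^ 2 + r ^ 2))⁻¹)
    (hasDerivAt_arctan_div hε)
    (fun r => by positivity) (fun r hr => by field_simp) (tendsto_arctan_div hε)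
  refine ⟨h1, h2.trans ?_⟩
  simp
  field_simp
  norm_num

end RieszKernels

section Inversion

open EuclideanGeometry

lemma abs_det_smul_reflection (c : ℝ) (v : E3) :
    |((c • ((Submodule.span ℝ {v})ᗮ.reflection : E3 →L[ℝ] E3) : E3 →L[ℝ] E3)).det| = |c| ^ 3 := by
  have h1 : ((c • ((Submodule.span ℝ {v})ᗮ.reflection : E3 →L[ℝ] E3) : E3 →L[ℝ] E3)).det
      = LinearMap.det (c • (Submodule.span ℝ {v})ᗮ.reflection.toLinearMap) := rfl
  rw [h1, LinearMap.det_smul, Submodule.det_reflection, abs_mul, abs_pow, abs_pow]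
  simp

lemma integral_comp_inversion (g : E3 → ℝ) :
    (Integrable g ↔ Integrable fun y => ‖y‖⁻¹ ^ 6 * g ((‖y‖ ^ 2)⁻¹ • y)) ∧
      ∫ z, g z = ∫ y, ‖y‖⁻¹ ^ 6 * g ((‖y‖ ^ 2)⁻¹ • y) := by
  have hinv : ∀ y : E3, inversion (0 : E3) 1 y = (‖y‖ ^ 2)⁻¹ • y := by
    intro y
    simp [inversion_def]
  have hd : ∀ y ∈ ({0}ᶜ : Set E3), HasFDerivWithinAt (inversion (0 : E3) 1)
      ((1 / dist y 0) ^ 2 • ((Submodule.span ℝ {y - 0})ᗮ.reflection : E3 →L[ℝ] E3)) {0}ᶜ y :=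
    fun y hy => (hasFDerivAt_inversion hy).hasFDerivWithinAt
  have hinj : Set.InjOn (inversion (0 : E3) 1) {0}ᶜ :=
    (inversion_injective (0 : E3) one_ne_zero).injOn
  have him : inversion (0 : E3) 1 '' {0}ᶜ = {0}ᶜ := by
    rw [Set.image_compl_eq (inversion_bijective (0 : E3) one_ne_zero), Set.image_singleton,
      inversion_self]
  have hs : MeasurableSet ({0}ᶜ : Set E3) := (measurableSet_singleton _).compl
  have he : ∀ y : E3, |((1 / dist y 0) ^ 2 • ((Submodule.span ℝ {y - 0})ᗮ.reflection :
      E3 →L[ℝ] E3) : E3 →L[ℝ] E3).det| • g (inversion (0 : E3) 1 y)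
        = ‖y‖⁻¹ ^ 6 * g ((‖y‖ ^ 2)⁻¹ • y) := by
    intro y
    rw [abs_det_smul_reflection, hinv, smul_eq_mul, abs_of_nonneg (by positivity), dist_zero_right]
    ring
  have hi := integrableOn_image_iff_integrableOn_abs_det_fderiv_smul volume hs hd hinj g
  have hv := integral_image_eq_integral_abs_det_fderiv_smul volume hs hd hinj g
  have hr : (volume : Measure E3).restrict {0}ᶜ = volume := restrict_compl_singleton 0
  simp only [he, him, IntegrableOn, hr] at hi hv
  exact ⟨hi, hv⟩

lemma integral_riesz_mul_regularized {ε : ℝ} (hε : 0 < ε) (a : E3) :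
    Integrable (fun z : E3 => (‖z‖ ^ 2)⁻¹ * ((ε ^ 2 + ‖z + a‖ ^ 2) ^ 2)⁻¹) ∧
      ∫ z : E3, (‖z‖ ^ 2)⁻¹ * ((ε ^ 2 + ‖z + a‖ ^ 2) ^ 2)⁻¹
        = π ^ 2 / (ε * (ε ^ 2 + ‖a‖ ^ 2)) := by
  obtain ⟨hi, hv⟩ := integral_comp_inversion
    (fun z : E3 => (‖z‖ ^ 2)⁻¹ * ((ε ^ 2 + ‖z + a‖ ^ 2) ^ 2)⁻¹)
  set A := ε ^ 2 + ‖a‖ ^ 2 with hA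
  have hA0 : 0 < A := by positivity
  have he : ∀ᵐ y : E3, ‖y‖⁻¹ ^ 6 * ((‖(‖y‖ ^ 2)⁻¹ • y‖ ^ 2)⁻¹ *
      ((ε ^ 2 + ‖(‖y‖ ^ 2)⁻¹ • y + a‖ ^ 2) ^ 2)⁻¹)
        = (A ^ 2)⁻¹ * (((ε / A) ^ 2 + ‖y + A⁻¹ • a‖ ^ 2) ^ 2)⁻¹ := by
    filter_upwards [Measure.ae_ne volume (0 : E3)] with y hy
    have hy0 : 0 < ‖y‖ := norm_pos_iff.2 hy
    have h1 : (ε / A) ^ 2 + ‖y + A⁻¹ • a‖ ^ 2 = A⁻¹ * (A * ‖y‖ ^ 2 + 2 * inner ℝ y a + 1) := by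
      rw [norm_add_sq_real, inner_smul_right, norm_smul, norm_inv, Real.norm_of_nonneg hA0.le]
      field_simp
      rw [hA]; ring
    have h2 : ε ^ 2 + ‖(‖y‖ ^ 2)⁻¹ • y + a‖ ^ 2
        = (‖y‖ ^ 2)⁻¹ * (A * ‖y‖ ^ 2 + 2 * inner ℝ y a + 1) := by
      rw [norm_add_sq_real, real_inner_smul_left, norm_smul, norm_inv, norm_pow, norm_norm]
      field_simp
      rw [hA]; ring
    have h3 : A * ‖y‖ ^ 2 + 2 * inner ℝ y a + 1 ≠ 0 := by
      intro h0
      rw [h0, mul_zero] at h2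
      have : 0 < ε ^ 2 + ‖(‖y‖ ^ 2)⁻¹ • y + a‖ ^ 2 := by positivity
      exact this.ne' h2
    rw [h1, h2, norm_smul, norm_inv, norm_pow, norm_norm]
    field_simp
  obtain ⟨hi', hv'⟩ := integral_regularized_kernel (div_pos hε hA0)
  rw [integral_congr_ae he, integral_const_mul,
    integral_add_right_eq_self (fun y : E3 => (((ε / A) ^ 2 + ‖y‖ ^ 2) ^ 2)⁻¹), hv'] at hv
  refine ⟨hi.2 (Integrable.congr ?_ (he.mono fun _ h => h.symm)), hv.trans ?_⟩
  · exact (hi'.comp_add_right (A⁻¹ • a)).const_mul _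
  · field_simp

end Inversion

section RieszPotential

lemma integral_mul_integral_swap {F : E3 → E3 → ℝ} {f : E3 → ℝ} {M : ℝ}
    (hm : Measurable (Function.uncurry F)) (h0 : ∀ x y, 0 ≤ F x y) (hi : ∀ x, Integrable (F x))
    (hM : ∀ x, ∫ y, F x y ≤ M) (hf : Integrable f) :
    Integrable (fun p : E3 × E3 => f p.1 * F p.1 p.2) (volume.prod volume) ∧
      ∫ x, f x * ∫ y, F x y = ∫ y, ∫ x, f x * F x y := by
  have h_integrable : Integrable (fun p : E3 × E3 => f p.1 * F p.1 p.2) (volume.prod volume) := by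
    have hms : AEStronglyMeasurable (fun p : E3 × E3 => f p.1 * F p.1 p.2)
        (volume.prod volume) := hf.aestronglyMeasurable.comp_fst.mul hm.aestronglyMeasurable
    refine (integrable_prod_iff hms).2
      ⟨Eventually.of_forall fun x => (hi x).const_mul (f x), ?_⟩
    refine (hf.norm.mul_const M).mono' hms.norm.integral_prod_right'
      (Eventually.of_forall fun x => ?_)
    have he : ∀ y, ‖f x * F x y‖ = ‖f x‖ * F x y := fun y => by
      rw [norm_mul, Real.norm_of_nonneg (h0 x y)]
    simp_rw [he]
    rw [integral_const_mul, norm_mul, norm_norm,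
      Real.norm_of_nonneg (integral_nonneg fun y => h0 x y)]
    exact mul_le_mul_of_nonneg_left (hM x) (norm_nonneg _)
  refine ⟨h_integrable, ?_⟩
  simp_rw [← integral_const_mul]
  exact integral_integral_swap h_integrable

/-- The Riesz potential of order one, without its normalising constant. -/
noncomputable def rieszPot (ρ : E3 → ℝ) (x : E3) : ℝ := ∫ y, (‖x - y‖ ^ 2)⁻¹ * ρ y

/-- The regularised half-Laplacian at scale `ε`. -/
noncomputable def regHalfLap (ε : ℝ) (φ : E3 → ℝ) (x : E3) : ℝ :=
  φ x / ε - 1 / π ^ 2 * ∫ y, ((ε ^ 2 + ‖x - y‖ ^ 2) ^ 2)⁻¹ * φ y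

lemma DecayDens.exists_rieszPot_bound {ρ : E3 → ℝ} {D : ℝ} (h : DecayDens ρ D) :
    ∃ M, 0 ≤ M ∧ ∀ x, Integrable (fun y => (‖x - y‖ ^ 2)⁻¹ * ρ y) ∧ rieszPot ρ x ≤ M := by
  obtain ⟨M, hM0, hM⟩ := h.exists_riesz_bound two_pos (by norm_num)
  have h2 : ∀ z : E3, ‖z‖ ^ (-2 : ℝ) = (‖z‖ ^ 2)⁻¹ := fun z => by
    rw [show (-2 : ℝ) = -((2 : ℕ) : ℝ) by norm_num, Real.rpow_neg (norm_nonneg z),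
      Real.rpow_natCast]
  simp_rw [h2] at hM
  exact ⟨M, hM0, hM⟩

lemma rieszPot_nonneg {ρ : E3 → ℝ} (h : ∀ x, 0 ≤ ρ x) (x : E3) : 0 ≤ rieszPot ρ x :=
  integral_nonneg fun y => mul_nonneg (by positivity) (h y)

lemma measurable_rieszPot {ρ : E3 → ℝ} (h : Measurable ρ) : Measurable (rieszPot ρ) := by
  have : Measurable fun p : E3 × E3 => (‖p.1 - p.2‖ ^ 2)⁻¹ * ρ p.2 :=
    (by fun_prop : Measurable fun p : E3 × E3 => (‖p.1 - p.2‖ ^ 2)⁻¹).mul (h.comp measurable_snd)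
  exact (this.stronglyMeasurable.integral_prod_right (ν := volume)).measurable

lemma integrable_mul_regularized {ε : ℝ} (hε : 0 < ε) (x : E3) {φ : E3 → ℝ}
    (hφ : Integrable φ) :
    Integrable (fun y => ((ε ^ 2 + ‖x - y‖ ^ 2) ^ 2)⁻¹ * φ y) := by
  refine hφ.bdd_mul (c := ((ε ^ 2) ^ 2)⁻¹)
    (by fun_prop : Measurable fun y : E3 => ((ε ^ 2 + ‖x - y‖ ^ 2) ^ 2)⁻¹).aestronglyMeasurable
    (Eventually.of_forall fun y => ?_)
  rw [Real.norm_of_nonneg (by positivity)]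
  gcongr
  nlinarith [sq_nonneg ‖x - y‖]

lemma integral_rieszPot_mul_regularized {ρ : E3 → ℝ} {D : ℝ} (h : DecayDens ρ D) {ε : ℝ}
    (hε : 0 < ε) (y' : E3) :
    Integrable (fun x => ((ε ^ 2 + ‖x - y'‖ ^ 2) ^ 2)⁻¹ * rieszPot ρ x) ∧
    ∫ x, ((ε ^ 2 + ‖x - y'‖ ^ 2) ^ 2)⁻¹ * rieszPot ρ x
      = ∫ y, π ^ 2 / (ε * (ε ^ 2 + ‖y - y'‖ ^ 2)) * ρ y := by
  obtain ⟨M, hM0, hM⟩ := h.exists_rieszPot_bound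
  have hk : Integrable fun x : E3 => ((ε ^ 2 + ‖x - y'‖ ^ 2) ^ 2)⁻¹ :=
    (integral_regularized_kernel hε).1.comp_sub_right y'
  have hFm : Measurable (Function.uncurry fun x y : E3 => (‖x - y‖ ^ 2)⁻¹ * ρ y) :=
    (by fun_prop : Measurable fun p : E3 × E3 => (‖p.1 - p.2‖ ^ 2)⁻¹).mul
      (h.meas.comp measurable_snd)
  constructor
  · refine (hk.bdd_mul (c := M) (measurable_rieszPot h.meas).aestronglyMeasurable
      (Eventually.of_forall fun x => ?_)).congr (Eventually.of_forall fun x => mul_comm _ _)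
    rw [Real.norm_of_nonneg (rieszPot_nonneg h.nonneg x)]
    exact (hM x).2
  · refine (integral_mul_integral_swap hFm (fun x y => mul_nonneg (by positivity) (h.nonneg y))
      (fun x => (hM x).1) (fun x => (hM x).2) hk).2.trans ?_
    refine integral_congr_ae (Eventually.of_forall fun y => ?_)
    have e : ∀ x : E3, ((ε ^ 2 + ‖x - y'‖ ^ 2) ^ 2)⁻¹ * ((‖x - y‖ ^ 2)⁻¹ * ρ y)
        = (fun z : E3 => (‖z‖ ^ 2)⁻¹ * ((ε ^ 2 + ‖z + (y - y')‖ ^ 2) ^ 2)⁻¹) (x - y) * ρ y := by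
      intro x
      simp only [sub_add_sub_cancel]
      ring
    simp_rw [e]
    rw [integral_mul_const,
      integral_sub_right_eq_self (fun z : E3 => (‖z‖ ^ 2)⁻¹ * ((ε ^ 2 + ‖z + (y - y')‖ ^ 2) ^ 2)⁻¹),
      (integral_riesz_mul_regularized hε (y - y')).2]

lemma integrable_riesz_mul {φ : E3 → ℝ} (hφ : Integrable φ) {B : ℝ} (hB : ∀ x, |φ x| ≤ B)
    (y : E3) : Integrable fun x => φ x * (‖x - y‖ ^ 2)⁻¹ := by
  have h1 : Integrable fun x => φ x * (‖x - y‖ ^ 2 * (1 ^ 2 + ‖x - y‖ ^ 2))⁻¹ :=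
    ((integral_riesz_kernel one_pos).1.comp_sub_right y).bdd_mul (c := B)
      hφ.aestronglyMeasurable (Eventually.of_forall hB)
  have h2 : Integrable fun x => (1 ^ 2 + ‖x - y‖ ^ 2)⁻¹ * φ x := by
    refine hφ.bdd_mul (c := 1)
      (by fun_prop : Measurable fun x : E3 => (1 ^ 2 + ‖x - y‖ ^ 2)⁻¹).aestronglyMeasurable
      (Eventually.of_forall fun x => ?_)
    rw [Real.norm_of_nonneg (by positivity)]
    exact inv_le_one_of_one_le₀ (by nlinarith [sq_nonneg ‖x - y‖])
  refine (h1.add h2).congr ?_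
  filter_upwards [Measure.ae_ne volume y] with x hx
  have : ‖x - y‖ ≠ 0 := norm_ne_zero_iff.2 (sub_ne_zero.2 hx)
  simp only [Pi.add_apply]
  field_simp

theorem integral_rieszPot_mul_regHalfLap {ρ : E3 → ℝ} {D : ℝ} (h : DecayDens ρ D) {ε : ℝ}
    (hε : 0 < ε) {φ : E3 → ℝ} (hφ : Integrable φ) {B : ℝ}
    (hB : ∀ x, |φ x| ≤ B) :
    ∫ x, rieszPot ρ x * regHalfLap ε φ x =
      ∫ y, ρ y * ∫ x, ε * (‖x - y‖ ^ 2 * (ε ^ 2 + ‖x - y‖ ^ 2))⁻¹ * φ x := by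
  obtain ⟨M, hM0, hM⟩ := h.exists_rieszPot_bound
  have hIb : ∀ x, ‖rieszPot ρ x‖ ≤ M := fun x => by
    rw [Real.norm_of_nonneg (rieszPot_nonneg h.nonneg x)]; exact (hM x).2
  have hIm := measurable_rieszPot h.meas
  have hFm : Measurable (Function.uncurry fun x y : E3 => (‖x - y‖ ^ 2)⁻¹ * ρ y) :=
    (by fun_prop : Measurable fun p : E3 × E3 => (‖p.1 - p.2‖ ^ 2)⁻¹).mul
      (h.meas.comp measurable_snd)
  obtain ⟨hA, hA'⟩ := integral_mul_integral_swap hFm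
    (fun x y => mul_nonneg (by positivity) (h.nonneg y)) (fun x => (hM x).1)
    (fun x => (hM x).2) hφ
  have hGm : Measurable (Function.uncurry fun y' x : E3 =>
      ((ε ^ 2 + ‖x - y'‖ ^ 2) ^ 2)⁻¹ * rieszPot ρ x) :=
    (by fun_prop : Measurable fun p : E3 × E3 => ((ε ^ 2 + ‖p.2 - p.1‖ ^ 2) ^ 2)⁻¹).mul
      (hIm.comp measurable_snd)
  have hGM : ∀ y' : E3, ∫ x, ((ε ^ 2 + ‖x - y'‖ ^ 2) ^ 2)⁻¹ * rieszPot ρ x ≤ π ^ 2 / ε * M := by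
    intro y'
    have hk : Integrable fun x : E3 => ((ε ^ 2 + ‖x - y'‖ ^ 2) ^ 2)⁻¹ :=
      (integral_regularized_kernel hε).1.comp_sub_right y'
    calc _ ≤ ∫ x : E3, ((ε ^ 2 + ‖x - y'‖ ^ 2) ^ 2)⁻¹ * M :=
          integral_mono (integral_rieszPot_mul_regularized h hε y').1 (hk.mul_const M)
            fun x => mul_le_mul_of_nonneg_left (hM x).2 (by positivity)
      _ = _ := by
        rw [integral_mul_const,
          integral_sub_right_eq_self (fun z : E3 => ((ε ^ 2 + ‖z‖ ^ 2) ^ 2)⁻¹),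
          (integral_regularized_kernel hε).2]
  obtain ⟨hC, hC'⟩ := integral_mul_integral_swap hGm
    (fun y x => mul_nonneg (by positivity) (rieszPot_nonneg h.nonneg x))
    (fun y' => (integral_rieszPot_mul_regularized h hε y').1) hGM hφ
  have hHm : Measurable (Function.uncurry fun y' y : E3 =>
      π ^ 2 / (ε * (ε ^ 2 + ‖y - y'‖ ^ 2)) * ρ y) :=
    (by fun_prop : Measurable fun p : E3 × E3 => π ^ 2 / (ε * (ε ^ 2 + ‖p.2 - p.1‖ ^ 2))).mul
      (h.meas.comp measurable_snd)
  have hHi : ∀ y' : E3, Integrable fun y => π ^ 2 / (ε * (ε ^ 2 + ‖y - y'‖ ^ 2)) * ρ y := by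
    intro y'
    refine h.integrable.bdd_mul (c := π ^ 2 / (ε * ε ^ 2))
      (by fun_prop : Measurable fun y : E3 =>
        π ^ 2 / (ε * (ε ^ 2 + ‖y - y'‖ ^ 2))).aestronglyMeasurable
      (Eventually.of_forall fun y => ?_)
    rw [Real.norm_of_nonneg (by positivity)]
    gcongr
    nlinarith [sq_nonneg ‖y - y'‖]
  obtain ⟨hE, hE'⟩ := integral_mul_integral_swap hHm
    (fun y' y => mul_nonneg (by positivity) (h.nonneg y)) hHi
    (fun y' => ((integral_rieszPot_mul_regularized h hε y').2.symm.le.trans (hGM y'))) hφ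
  have hconv : ∫ x, rieszPot ρ x * ∫ y, ((ε ^ 2 + ‖x - y‖ ^ 2) ^ 2)⁻¹ * φ y
      = ∫ y, ∫ y', φ y' * (π ^ 2 / (ε * (ε ^ 2 + ‖y - y'‖ ^ 2)) * ρ y) := by
    rw [← hE']
    simp_rw [← (integral_rieszPot_mul_regularized h hε _).2]
    rw [hC']
    refine integral_congr_ae (Eventually.of_forall fun x => ?_)
    simp only [← integral_const_mul]
    refine integral_congr_ae (Eventually.of_forall fun y => ?_)
    simp only
    ring
  have hi1 : Integrable fun x => rieszPot ρ x * φ x :=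
    hφ.bdd_mul hIm.aestronglyMeasurable (Eventually.of_forall hIb)
  have hi2 : Integrable fun x => rieszPot ρ x * ∫ y, ((ε ^ 2 + ‖x - y‖ ^ 2) ^ 2)⁻¹ * φ y := by
    refine hC.integral_prod_right.congr (Eventually.of_forall fun x => ?_)
    simp only [← integral_const_mul]
    refine integral_congr_ae (Eventually.of_forall fun y => ?_)
    simp only
    ring
  have hi3 : Integrable fun y => ∫ x, φ x * ((‖x - y‖ ^ 2)⁻¹ * ρ y) := hA.integral_prod_right
  have hi4 : Integrable fun y => ∫ y', φ y' * (π ^ 2 / (ε * (ε ^ 2 + ‖y - y'‖ ^ 2)) * ρ y) :=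
    hE.integral_prod_right
  calc _ = ∫ x, (1 / ε * (rieszPot ρ x * φ x) - 1 / π ^ 2 *
        (rieszPot ρ x * ∫ y, ((ε ^ 2 + ‖x - y‖ ^ 2) ^ 2)⁻¹ * φ y)) := by
        refine integral_congr_ae (Eventually.of_forall fun x => ?_)
        simp only [regHalfLap]
        ring
    _ = ∫ y, (1 / ε * (∫ x, φ x * ((‖x - y‖ ^ 2)⁻¹ * ρ y)) - 1 / π ^ 2 *
        ∫ y', φ y' * (π ^ 2 / (ε * (ε ^ 2 + ‖y - y'‖ ^ 2)) * ρ y)) := by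
        rw [integral_sub (hi1.const_mul _) (hi2.const_mul _), integral_const_mul,
          integral_const_mul, integral_sub (hi3.const_mul _) (hi4.const_mul _),
          integral_const_mul, integral_const_mul, hconv, ← hA']
        simp only [mul_comm (φ _)]
        rfl
    _ = _ := by
        refine integral_congr_ae (Eventually.of_forall fun y => ?_)
        simp only [← integral_const_mul]
        have j1 : Integrable fun x => 1 / ε * (φ x * ((‖x - y‖ ^ 2)⁻¹ * ρ y)) :=
          (((integrable_riesz_mul hφ hB y).mul_const (ρ y)).const_mul (1 / ε)).congr
            (Eventually.of_forall fun x => by simp only; ring)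
        have j2 : Integrable fun x =>
            1 / π ^ 2 * (φ x * (π ^ 2 / (ε * (ε ^ 2 + ‖y - x‖ ^ 2)) * ρ y)) := by
          refine ((hφ.bdd_mul (c := (ε ^ 2)⁻¹)
            (by fun_prop : Measurable fun x : E3 =>
              (ε ^ 2 + ‖y - x‖ ^ 2)⁻¹).aestronglyMeasurable
            (Eventually.of_forall fun x => ?_)).const_mul (ρ y / ε)).congr
            (Eventually.of_forall fun x => ?_)
          · rw [Real.norm_of_nonneg (by positivity)]
            gcongr
            nlinarith [sq_nonneg ‖y - x‖]
          · simp only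
            field_simp
        rw [← integral_sub j1 j2]
        refine integral_congr_ae ?_
        filter_upwards [Measure.ae_ne volume y] with x hx
        have : ‖x - y‖ ≠ 0 := norm_ne_zero_iff.2 (sub_ne_zero.2 hx)
        rw [norm_sub_rev y x]
        field_simp
        ring

end RieszPotential

section RieszLimit

lemma integral_riesz_approx_eq {ε : ℝ} (hε : 0 < ε) (φ : E3 → ℝ) (y : E3) :
    ∫ x, ε * (‖x - y‖ ^ 2 * (ε ^ 2 + ‖x - y‖ ^ 2))⁻¹ * φ x
      = ∫ z : E3, (‖z‖ ^ 2 * (1 ^ 2 + ‖z‖ ^ 2))⁻¹ * φ (ε • z + y) := by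
  have h1 : ∫ x, ε * (‖x - y‖ ^ 2 * (ε ^ 2 + ‖x - y‖ ^ 2))⁻¹ * φ x
      = ∫ x : E3, ε * (‖x‖ ^ 2 * (ε ^ 2 + ‖x‖ ^ 2))⁻¹ * φ (x + y) := by
    rw [← integral_sub_right_eq_self
      (fun x : E3 => ε * (‖x‖ ^ 2 * (ε ^ 2 + ‖x‖ ^ 2))⁻¹ * φ (x + y)) y]
    simp
  have h2 := Measure.integral_comp_smul (volume : Measure E3)
    (fun x : E3 => ε * (‖x‖ ^ 2 * (ε ^ 2 + ‖x‖ ^ 2))⁻¹ * φ (x + y)) ε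
  rw [finrank_euclideanSpace, Fintype.card_fin, abs_of_pos (by positivity), smul_eq_mul,
    eq_comm, inv_mul_eq_iff_eq_mul₀ (by positivity)] at h2
  rw [h1, h2, ← integral_const_mul]
  refine integral_congr_ae ?_
  filter_upwards [Measure.ae_ne volume (0 : E3)] with z hz
  have : ‖z‖ ≠ 0 := norm_ne_zero_iff.2 hz
  rw [norm_smul, Real.norm_of_nonneg hε.le, mul_pow]
  field_simp

lemma tendsto_integral_riesz_approx {ρ : E3 → ℝ} {D : ℝ} (h : DecayDens ρ D) {φ : E3 → ℝ}
    (hφ : Continuous φ) {B : ℝ} (hB : ∀ x, |φ x| ≤ B) :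
    Tendsto (fun ε : ℝ => ∫ y, ρ y * ∫ x, ε * (‖x - y‖ ^ 2 * (ε ^ 2 + ‖x - y‖ ^ 2))⁻¹ * φ x)
      (nhdsWithin 0 (Set.Ioi 0)) (nhds (2 * π ^ 2 * ∫ y, ρ y * φ y)) := by
  obtain ⟨hQ, hQ'⟩ := integral_riesz_kernel one_pos
  have hQm : Measurable fun z : E3 => (‖z‖ ^ 2 * (1 ^ 2 + ‖z‖ ^ 2))⁻¹ := by fun_prop
  have hbd : ∀ (ε : ℝ) (y z : E3), ‖(‖z‖ ^ 2 * (1 ^ 2 + ‖z‖ ^ 2))⁻¹ * φ (ε • z + y)‖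
      ≤ (‖z‖ ^ 2 * (1 ^ 2 + ‖z‖ ^ 2))⁻¹ * B := by
    intro ε y z
    rw [norm_mul, Real.norm_of_nonneg (by positivity)]
    exact mul_le_mul_of_nonneg_left (hB _) (by positivity)
  have hin : ∀ y, Tendsto (fun ε : ℝ => ∫ z : E3, (‖z‖ ^ 2 * (1 ^ 2 + ‖z‖ ^ 2))⁻¹ * φ (ε • z + y))
      (nhdsWithin 0 (Set.Ioi 0)) (nhds (2 * π ^ 2 * φ y)) := by
    intro y
    have e : 2 * π ^ 2 * φ y = ∫ z : E3, (‖z‖ ^ 2 * (1 ^ 2 + ‖z‖ ^ 2))⁻¹ * φ y := by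
      rw [integral_mul_const, hQ', div_one]
    rw [e]
    refine tendsto_integral_filter_of_dominated_convergence _
      (Eventually.of_forall fun ε => ?_)
      (Eventually.of_forall fun ε => Eventually.of_forall (hbd ε y))
      (hQ.mul_const B) (Eventually.of_forall fun z => ?_)
    · exact (hQm.mul (hφ.comp (by fun_prop)).measurable).aestronglyMeasurable
    · have : Continuous fun ε : ℝ => (‖z‖ ^ 2 * (1 ^ 2 + ‖z‖ ^ 2))⁻¹ * φ (ε • z + y) :=
        continuous_const.mul (hφ.comp (by fun_prop))
      have h0 := this.tendsto 0
      simp only [zero_smul, zero_add] at h0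
      exact h0.mono_left nhdsWithin_le_nhds
  have hcongr : (fun ε : ℝ => ∫ y, ρ y * ∫ z : E3, (‖z‖ ^ 2 * (1 ^ 2 + ‖z‖ ^ 2))⁻¹ * φ (ε • z + y))
      =ᶠ[nhdsWithin 0 (Set.Ioi 0)]
      fun ε : ℝ => ∫ y, ρ y * ∫ x, ε * (‖x - y‖ ^ 2 * (ε ^ 2 + ‖x - y‖ ^ 2))⁻¹ * φ x := by
    filter_upwards [self_mem_nhdsWithin] with ε hε
    simp_rw [integral_riesz_approx_eq hε]
  refine Tendsto.congr' hcongr ?_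
  have e : 2 * π ^ 2 * ∫ y, ρ y * φ y = ∫ y, ρ y * (2 * π ^ 2 * φ y) := by
    rw [← integral_const_mul]
    exact integral_congr_ae (Eventually.of_forall fun y => by simp only; ring)
  rw [e]
  refine tendsto_integral_filter_of_dominated_convergence (fun y => ρ y * (2 * π ^ 2 * B))
    (Eventually.of_forall fun ε => ?_)
    (Eventually.of_forall fun ε => Eventually.of_forall fun y => ?_)
    (h.integrable.mul_const _) (Eventually.of_forall fun y => (hin y).const_mul _)
  · have hj : Measurable fun p : E3 × E3 =>
        (‖p.2‖ ^ 2 * (1 ^ 2 + ‖p.2‖ ^ 2))⁻¹ * φ (ε • p.2 + p.1) :=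
      (hQm.comp measurable_snd).mul (hφ.comp (by fun_prop)).measurable
    exact (h.meas.mul
      (hj.stronglyMeasurable.integral_prod_right (ν := volume)).measurable).aestronglyMeasurable
  · rw [norm_mul, Real.norm_of_nonneg (h.nonneg y)]
    refine mul_le_mul_of_nonneg_left ?_ (h.nonneg y)
    refine (norm_integral_le_of_norm_le (hQ.mul_const B)
      (Eventually.of_forall (hbd ε y))).trans ?_
    rw [integral_mul_const, hQ', div_one]

end RieszLimit

section SecondDifference

/-- The symmetric second difference of `φ` at `x` with increment `z`. -/
def secondDiff (φ : E3 → ℝ) (x z : E3) : ℝ := 2 * φ x - φ (x + z) - φ (x - z)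

lemma SchwartzMap.exists_norm_fderiv_fderiv_le (φ : SchwartzMap E3 ℝ) :
    ∃ C, 0 ≤ C ∧ ∀ x, ‖fderiv ℝ (fderiv ℝ φ) x‖ ≤ C * ((1 + ‖x‖) ^ 4)⁻¹ := by
  set ψ := SchwartzMap.fderivCLM ℝ E3 (E3 →L[ℝ] ℝ) (SchwartzMap.fderivCLM ℝ E3 ℝ φ) with hψ
  refine ⟨2 ^ 4 * (Finset.Iic ((4, 0) : ℕ × ℕ)).sup
    (fun m => SchwartzMap.seminorm ℝ m.1 m.2) ψ, by positivity, fun x => ?_⟩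
  have h1 := SchwartzMap.one_add_le_sup_seminorm_apply (𝕜 := ℝ) (m := (4, 0)) (k := 4) (n := 0)
    le_rfl le_rfl ψ x
  rw [norm_iteratedFDeriv_zero] at h1
  rw [← div_eq_mul_inv, le_div_iff₀ (by positivity), mul_comm]
  exact h1

lemma SchwartzMap.exists_secondDiff_le (φ : SchwartzMap E3 ℝ) :
    ∃ C, 0 ≤ C ∧ ∀ x z : E3, ‖z‖ ≤ 1 →
      |secondDiff φ x z| ≤ C * ‖z‖ ^ 2 * ((1 + ‖x‖ ^ 2) ^ 2)⁻¹ := by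
  obtain ⟨C, hC0, hC⟩ := SchwartzMap.exists_norm_fderiv_fderiv_le φ
  refine ⟨32 * C, by positivity, fun x z hz => ?_⟩
  set K := 16 * C * ((1 + ‖x‖ ^ 2) ^ 2)⁻¹ with hK
  have hd : Differentiable ℝ φ := φ.differentiable
  have hd2 : Differentiable ℝ (fderiv ℝ φ) :=
    (SchwartzMap.fderivCLM ℝ E3 ℝ φ).differentiable
  have hloc : ∀ u ∈ Metric.closedBall x 1, ‖fderiv ℝ (fderiv ℝ φ) u‖ ≤ K := by
    intro u hu
    refine (hC u).trans ?_
    have h1 : ‖x‖ ≤ ‖u‖ + 1 := by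
      have h2 := norm_le_norm_add_norm_sub u x
      rw [norm_sub_rev, ← dist_eq_norm, dist_comm] at h2
      rw [Metric.mem_closedBall] at hu
      linarith
    have h3 : (1 + ‖x‖ ^ 2) ^ 2 ≤ 16 * (1 + ‖u‖) ^ 4 := by
      have h4 : 1 + ‖x‖ ^ 2 ≤ 4 * (1 + ‖u‖) ^ 2 := by
        nlinarith [norm_nonneg u, norm_nonneg x]
      calc (1 + ‖x‖ ^ 2) ^ 2 ≤ (4 * (1 + ‖u‖) ^ 2) ^ 2 := by gcongr
        _ = _ := by ring
    rw [hK, mul_comm 16 C, mul_assoc]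
    gcongr
    rw [← div_eq_mul_inv, le_div_iff₀ (by positivity), inv_mul_le_iff₀ (by positivity), mul_comm]
    exact h3
  have hlip : ∀ u v, u ∈ Metric.closedBall x 1 → v ∈ Metric.closedBall x 1 →
      ‖fderiv ℝ φ v - fderiv ℝ φ u‖ ≤ K * ‖v - u‖ := fun u v hu hv =>
    (convex_closedBall x 1).norm_image_sub_le_of_norm_fderiv_le (fun w _ => hd2 w) hloc hu hv
  have hg : ∀ t : E3, HasFDerivAt (fun t => φ (x + t) + φ (x - t))
      (fderiv ℝ φ (x + t) - fderiv ℝ φ (x - t)) t := by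
    intro t
    have h1 : HasFDerivAt (fun t => φ (x + t)) (fderiv ℝ φ (x + t)) t :=
      ((hd (x + t)).hasFDerivAt.comp t ((hasFDerivAt_id t).const_add x)).congr_fderiv (by ext; simp)
    have h2 : HasFDerivAt (fun t => φ (x - t)) (-fderiv ℝ φ (x - t)) t :=
      ((hd (x - t)).hasFDerivAt.comp t ((hasFDerivAt_id t).const_sub x)).congr_fderiv (by ext; simp)
    exact (h1.add h2).congr_fderiv (sub_eq_add_neg _ _).symm
  have hgb : ∀ t ∈ Metric.closedBall (0 : E3) ‖z‖,
      ‖fderiv ℝ φ (x + t) - fderiv ℝ φ (x - t)‖ ≤ K * (2 * ‖z‖) := by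
    intro t ht
    rw [mem_closedBall_zero_iff] at ht
    refine (hlip (x - t) (x + t) ?_ ?_).trans ?_
    · rw [Metric.mem_closedBall, dist_eq_norm]; simpa using ht.trans hz
    · rw [Metric.mem_closedBall, dist_eq_norm]; simpa using ht.trans hz
    · have : x + t - (x - t) = (2 : ℝ) • t := by rw [two_smul]; abel
      rw [this, norm_smul, Real.norm_of_nonneg two_pos.le]
      gcongr
  have h := (convex_closedBall (0 : E3) ‖z‖).norm_image_sub_le_of_norm_hasFDerivWithin_le
    (fun t _ => (hg t).hasFDerivWithinAt) hgb (Metric.mem_closedBall_self (norm_nonneg z))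
    (by simp : z ∈ Metric.closedBall (0 : E3) ‖z‖)
  have e : |secondDiff φ x z| = ‖φ (x + z) + φ (x - z) - (φ (x + 0) + φ (x - 0))‖ := by
    rw [Real.norm_eq_abs, ← abs_neg, secondDiff]
    congr 1
    simp only [add_zero, sub_zero]
    ring
  rw [e]
  refine h.trans (le_of_eq ?_)
  rw [sub_zero, hK]
  ring

lemma SchwartzMap.exists_abs_le (φ : SchwartzMap E3 ℝ) : ∃ B, 0 ≤ B ∧ ∀ x, |φ x| ≤ B :=
  ⟨SchwartzMap.seminorm ℝ 0 0 φ, by positivity, fun x => SchwartzMap.norm_le_seminorm ℝ φ x⟩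

lemma mul_inv_pow_four_le {m c C r : ℝ} (hr : r ≠ 0) (h1 : m ≤ C * r ^ 2) (h2 : m ≤ c) :
    m * (r ^ 4)⁻¹ ≤ (C + c) * (r ^ 2 * (1 ^ 2 + r ^ 2))⁻¹ := by
  have hr2 : 0 < r ^ 2 := by positivity
  rw [show r ^ 4 = r ^ 2 * r ^ 2 by ring, ← div_eq_mul_inv, ← div_eq_mul_inv,
    div_le_div_iff₀ (by positivity) (by positivity)]
  nlinarith [mul_le_mul_of_nonneg_left h1 hr2.le,
    mul_le_mul_of_nonneg_left h2 (mul_nonneg hr2.le hr2.le)]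

lemma continuous_secondDiff {φ : E3 → ℝ} (hφ : Continuous φ) :
    Continuous fun p : E3 × E3 => secondDiff φ p.1 p.2 := by
  unfold secondDiff
  fun_prop

lemma SchwartzMap.integrable_secondDiff (φ : SchwartzMap E3 ℝ) (x : E3) :
    Integrable fun z => secondDiff φ x z * (‖z‖ ^ 4)⁻¹ := by
  obtain ⟨C, hC0, hC⟩ := φ.exists_secondDiff_le
  obtain ⟨B, hB0, hB⟩ := φ.exists_abs_le
  have h4 : ∀ z, |secondDiff φ x z| ≤ 4 * B := by
    intro z
    have h1 := abs_le.1 (hB x); have h2 := abs_le.1 (hB (x + z)); have h3 := abs_le.1 (hB (x - z))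
    unfold secondDiff
    exact abs_le.2 ⟨by linarith, by linarith⟩
  have h2 : ∀ z, |secondDiff φ x z| ≤ (C + 4 * B) * ‖z‖ ^ 2 := by
    intro z
    rcases le_total ‖z‖ 1 with hz | hz
    · refine (hC x z hz).trans ?_
      have : ((1 + ‖x‖ ^ 2) ^ 2)⁻¹ ≤ 1 :=
        inv_le_one_of_one_le₀ (one_le_pow₀ (by nlinarith [sq_nonneg ‖x‖]))
      calc C * ‖z‖ ^ 2 * ((1 + ‖x‖ ^ 2) ^ 2)⁻¹ ≤ C * ‖z‖ ^ 2 * 1 := by gcongr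
        _ ≤ _ := by nlinarith [mul_nonneg hB0 (sq_nonneg ‖z‖)]
    · refine (h4 z).trans ?_
      nlinarith [mul_nonneg hC0 (sq_nonneg ‖z‖), mul_le_mul_of_nonneg_left
        (one_le_pow₀ hz : 1 ≤ ‖z‖ ^ 2) hB0]
  refine ((integral_riesz_kernel one_pos).1.const_mul (C + 4 * B + 4 * B)).mono'
    (Measurable.aestronglyMeasurable ?_) ?_
  · have : Measurable fun z => secondDiff φ x z := ((continuous_secondDiff φ.continuous).comp
      (Continuous.prodMk_right x)).measurable
    exact this.mul (by fun_prop)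
  · filter_upwards [Measure.ae_ne volume (0 : E3)] with z hz
    rw [norm_mul, Real.norm_of_nonneg (by positivity : 0 ≤ (‖z‖ ^ 4)⁻¹), Real.norm_eq_abs]
    exact mul_inv_pow_four_le (norm_ne_zero_iff.2 hz) (h2 z) (h4 z)

lemma SchwartzMap.integrable_secondDiff_prod (φ : SchwartzMap E3 ℝ) :
    Integrable (fun p : E3 × E3 => secondDiff φ p.1 p.2 * (‖p.2‖ ^ 4)⁻¹)
      (volume.prod volume) := by
  obtain ⟨C, hC0, hC⟩ := φ.exists_secondDiff_le
  have hφ : Integrable φ := φ.integrable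
  set N := ∫ x, |φ x| with hN
  have hN0 : 0 ≤ N := integral_nonneg fun x => abs_nonneg _
  set A := ∫ x : E3, ((1 + ‖x‖ ^ 2) ^ 2)⁻¹ with hA
  have hA0 : 0 ≤ A := integral_nonneg fun x => by positivity
  have hsi : ∀ z, Integrable fun x => secondDiff φ x z := fun z =>
    ((hφ.const_mul 2).sub (hφ.comp_add_right z)).sub (hφ.comp_sub_right z)
  have h4 : ∀ z, ∫ x, |secondDiff φ x z| ≤ 4 * N := by
    intro z
    have hm : ∀ x, |secondDiff φ x z| ≤ 2 * |φ x| + |φ (x + z)| + |φ (x - z)| := by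
      intro x
      unfold secondDiff
      calc _ ≤ |2 * φ x| + |φ (x + z)| + |φ (x - z)| :=
            (abs_sub _ _).trans (add_le_add_left (abs_sub _ _) _)
        _ = _ := by rw [abs_mul, abs_two]
    have i1 : Integrable fun x => 2 * |φ x| := hφ.abs.const_mul 2
    have i2 : Integrable fun x => |φ (x + z)| := hφ.abs.comp_add_right z
    have i3 : Integrable fun x => |φ (x - z)| := hφ.abs.comp_sub_right z
    have i12 : Integrable fun x => 2 * |φ x| + |φ (x + z)| := i1.add i2
    refine (integral_mono (hsi z).abs (i12.add i3) hm).trans (le_of_eq ?_)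
    simp only [Pi.add_apply]
    rw [integral_add i12 i3, integral_add i1 i2, integral_const_mul,
      integral_add_right_eq_self (fun x => |φ x|), integral_sub_right_eq_self (fun x => |φ x|)]
    ring
  have h2 : ∀ z, ∫ x, |secondDiff φ x z| ≤ (C * A + 4 * N) * ‖z‖ ^ 2 := by
    intro z
    rcases le_total ‖z‖ 1 with hz | hz
    · have : ∫ x, |secondDiff φ x z| ≤ ∫ x : E3, C * ‖z‖ ^ 2 * ((1 + ‖x‖ ^ 2) ^ 2)⁻¹ :=
        integral_mono (hsi z).abs (integrable_inv_one_add_sq_sq.const_mul _) fun x => hC x z hz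
      rw [integral_const_mul, ← hA] at this
      nlinarith [mul_nonneg hN0 (sq_nonneg ‖z‖)]
    · refine (h4 z).trans ?_
      nlinarith [mul_nonneg (mul_nonneg hC0 hA0) (sq_nonneg ‖z‖), mul_le_mul_of_nonneg_left
        (one_le_pow₀ hz : 1 ≤ ‖z‖ ^ 2) hN0]
  have hms : AEStronglyMeasurable (fun p : E3 × E3 => secondDiff φ p.1 p.2 * (‖p.2‖ ^ 4)⁻¹)
      (volume.prod volume) :=
    ((continuous_secondDiff φ.continuous).measurable.mul (by fun_prop)).aestronglyMeasurable
  refine (integrable_prod_iff' hms).2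
    ⟨Eventually.of_forall fun z => (hsi z).mul_const (‖z‖ ^ 4)⁻¹, ?_⟩
  refine ((integral_riesz_kernel one_pos).1.const_mul (C * A + 4 * N + 4 * N)).mono'
    hms.norm.prod_swap.integral_prod_right' ?_
  filter_upwards [Measure.ae_ne volume (0 : E3)] with z hz
  rw [Real.norm_of_nonneg (integral_nonneg fun x => norm_nonneg _)]
  have he : ∀ x, ‖secondDiff φ x z * (‖z‖ ^ 4)⁻¹‖ = |secondDiff φ x z| * (‖z‖ ^ 4)⁻¹ := fun x => by
    rw [norm_mul, Real.norm_of_nonneg (by positivity : 0 ≤ (‖z‖ ^ 4)⁻¹), Real.norm_eq_abs]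
  simp_rw [he]
  rw [integral_mul_const]
  exact mul_inv_pow_four_le (norm_ne_zero_iff.2 hz) (h2 z) (h4 z)

end SecondDifference

section WeakEquation

lemma integral_diff_mul_even_kernel {k : E3 → ℝ} (hk : Integrable k) (hev : ∀ z, k (-z) = k z)
    {φ : E3 → ℝ} (hφ : Continuous φ) {B : ℝ} (hB : ∀ x, |φ x| ≤ B) (x : E3) :
    Integrable (fun y => k (x - y) * φ y) ∧
    ∫ y, (φ x - φ y) * k (x - y) = 1 / 2 * ∫ z, secondDiff φ x z * k z := by
  have hi : ∀ f : E3 → E3, Continuous f → Integrable fun z => (φ x - φ (f z)) * k z := by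
    intro f hf
    have hc : Continuous fun z => φ x - φ (f z) := continuous_const.sub (hφ.comp hf)
    refine hk.bdd_mul (c := B + B) hc.measurable.aestronglyMeasurable
      (Eventually.of_forall fun z => ?_)
    exact (norm_sub_le _ _).trans (add_le_add (hB _) (hB _))
  constructor
  · refine ((hk.comp_sub_left x).bdd_mul (c := B) hφ.measurable.aestronglyMeasurable
      (Eventually.of_forall hB)).congr (Eventually.of_forall fun y => mul_comm _ _)
  have e1 : ∫ y, (φ x - φ y) * k (x - y) = ∫ z, (φ x - φ (x - z)) * k z := by
    rw [← integral_sub_left_eq_self (fun z => (φ x - φ (x - z)) * k z) volume x]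
    simp
  have e2 : ∫ y, (φ x - φ y) * k (x - y) = ∫ z, (φ x - φ (x + z)) * k z := by
    rw [e1, ← integral_neg_eq_self]
    simp [hev]
  have e3 : ∫ z, secondDiff φ x z * k z
      = (∫ z, (φ x - φ (x - z)) * k z) + ∫ z, (φ x - φ (x + z)) * k z := by
    rw [← integral_add (hi (fun z => x - z) (by fun_prop)) (hi (fun z => x + z) (by fun_prop))]
    refine integral_congr_ae (Eventually.of_forall fun z => ?_)
    simp only [secondDiff]
    ring
  rw [e3, ← e1, ← e2]
  ring

lemma regHalfLap_eq {ε : ℝ} (hε : 0 < ε) {φ : E3 → ℝ} (hφ : Continuous φ) {B : ℝ}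
    (hB : ∀ x, |φ x| ≤ B) (x : E3) :
    regHalfLap ε φ x = 1 / (2 * π ^ 2) * ∫ z, secondDiff φ x z * ((ε ^ 2 + ‖z‖ ^ 2) ^ 2)⁻¹ := by
  obtain ⟨hk, hk'⟩ := integral_regularized_kernel hε
  obtain ⟨hi, he⟩ := integral_diff_mul_even_kernel hk (fun z => by rw [norm_neg]) hφ hB x
  have h1 : ∫ y, (φ x - φ y) * ((ε ^ 2 + ‖x - y‖ ^ 2) ^ 2)⁻¹
      = φ x * (π ^ 2 / ε) - ∫ y, ((ε ^ 2 + ‖x - y‖ ^ 2) ^ 2)⁻¹ * φ y := by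
    rw [← hk', ← integral_sub_left_eq_self (fun z : E3 => ((ε ^ 2 + ‖z‖ ^ 2) ^ 2)⁻¹) volume x,
      ← integral_const_mul, ← integral_sub ((hk.comp_sub_left x).const_mul _) hi]
    refine integral_congr_ae (Eventually.of_forall fun y => ?_)
    simp only
    ring
  have h2 : regHalfLap ε φ x
      = 1 / π ^ 2 * ∫ y, (φ x - φ y) * ((ε ^ 2 + ‖x - y‖ ^ 2) ^ 2)⁻¹ := by
    rw [h1, regHalfLap]
    field_simp
  rw [h2, he]
  ring

lemma integrable_truncated_kernel {ε : ℝ} (hε : 0 < ε) :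
    Integrable (Set.indicator {z : E3 | ε < ‖z‖} fun z => (‖z‖ ^ 4)⁻¹) := by
  have hs : MeasurableSet {z : E3 | ε < ‖z‖} := measurableSet_lt measurable_const measurable_norm
  refine ((integral_regularized_kernel hε).1.const_mul 4).mono'
    (((by fun_prop : Measurable fun z : E3 => (‖z‖ ^ 4)⁻¹).indicator hs).aestronglyMeasurable)
    (Eventually.of_forall fun z => ?_)
  by_cases hz : ε < ‖z‖
  · rw [Set.indicator_of_mem (by exact hz), Real.norm_of_nonneg (by positivity), ← div_eq_mul_inv,
      le_div_iff₀ (by positivity), inv_mul_le_iff₀ (by have := hε.trans hz; positivity)]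
    have : ε ^ 2 ≤ ‖z‖ ^ 2 := by gcongr
    calc (ε ^ 2 + ‖z‖ ^ 2) ^ 2 ≤ (‖z‖ ^ 2 + ‖z‖ ^ 2) ^ 2 := by gcongr
      _ = _ := by ring
  · rw [Set.indicator_of_notMem (by exact hz), norm_zero]
    positivity

lemma halfLap_eq (φ : SchwartzMap E3 ℝ) (x : E3) :
    halfLap φ x = 1 / (2 * π ^ 2) * ∫ z, secondDiff φ x z * (‖z‖ ^ 4)⁻¹ := by
  obtain ⟨B, hB0, hB⟩ := φ.exists_abs_le
  refine Tendsto.limUnder_eq ?_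
  have hlim : Tendsto (fun ε : ℝ => ∫ z, secondDiff φ x z *
      Set.indicator {z : E3 | ε < ‖z‖} (fun z => (‖z‖ ^ 4)⁻¹) z) (nhdsWithin 0 (Set.Ioi 0))
      (nhds (∫ z, secondDiff φ x z * (‖z‖ ^ 4)⁻¹)) := by
    have hm : Measurable fun z => secondDiff φ x z := ((continuous_secondDiff φ.continuous).comp
      (Continuous.prodMk_right x)).measurable
    refine tendsto_integral_filter_of_dominated_convergence
      (fun z => ‖secondDiff φ x z * (‖z‖ ^ 4)⁻¹‖)
      (Eventually.of_forall fun ε => ?_)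
      (Eventually.of_forall fun ε => Eventually.of_forall fun z => ?_)
      (φ.integrable_secondDiff x).norm ?_
    · have hs : MeasurableSet {z : E3 | ε < ‖z‖} :=
        measurableSet_lt measurable_const measurable_norm
      exact (hm.mul ((by fun_prop : Measurable fun z : E3 =>
        (‖z‖ ^ 4)⁻¹).indicator hs)).aestronglyMeasurable
    · rw [norm_mul, norm_mul]
      gcongr
      exact norm_indicator_le_norm_self _ _
    · filter_upwards [Measure.ae_ne volume (0 : E3)] with z hz
      refine tendsto_const_nhds.congr' ?_
      filter_upwards [nhdsWithin_le_nhds (gt_mem_nhds (norm_pos_iff.2 hz))] with ε hε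
      rw [Set.indicator_of_mem (by exact hε)]
  have h := hlim.const_mul (1 / (2 * π ^ 2))
  refine h.congr' ?_
  filter_upwards [self_mem_nhdsWithin] with ε hε
  have hs : MeasurableSet {y : E3 | ε < ‖x - y‖} :=
    measurableSet_lt measurable_const (by fun_prop)
  have he := (integral_diff_mul_even_kernel (integrable_truncated_kernel hε)
    (fun z => by simp only [Set.indicator, Set.mem_ofPred_eq, norm_neg]) φ.continuous hB x).2
  rw [← integral_indicator hs]
  have e2 : ∫ y, Set.indicator {y : E3 | ε < ‖x - y‖} (fun y => (φ x - φ y) / ‖x - y‖ ^ 4) y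
      = ∫ y, (φ x - φ y) * Set.indicator {z : E3 | ε < ‖z‖} (fun z => (‖z‖ ^ 4)⁻¹) (x - y) := by
    refine integral_congr_ae (Eventually.of_forall fun y => ?_)
    simp only [Set.indicator, Set.mem_ofPred_eq]
    split_ifs <;> simp [div_eq_mul_inv]
  rw [e2, he]
  ring

lemma tendsto_integral_mul_regHalfLap {V : E3 → ℝ} (hV : Measurable V) {M : ℝ}
    (hM : ∀ x, |V x| ≤ M) (φ : SchwartzMap E3 ℝ) :
    Tendsto (fun ε : ℝ => ∫ x, V x * regHalfLap ε φ x) (nhdsWithin 0 (Set.Ioi 0))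
      (nhds (∫ x, V x * halfLap φ x)) := by
  obtain ⟨B, hB0, hB⟩ := φ.exists_abs_le
  have hM0 : 0 ≤ M := (abs_nonneg _).trans (hM 0)
  have hF : ∀ k : E3 → ℝ, Measurable k → (∀ z, z ≠ 0 → |k z| ≤ (‖z‖ ^ 4)⁻¹) →
      Integrable (fun p : E3 × E3 => V p.1 * (secondDiff φ p.1 p.2 * k p.2))
        (volume.prod volume) ∧
      ∀ᵐ p : E3 × E3 ∂(volume.prod volume), ‖V p.1 * (secondDiff φ p.1 p.2 * k p.2)‖
        ≤ M * ‖secondDiff φ p.1 p.2 * (‖p.2‖ ^ 4)⁻¹‖ := by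
    intro k hkm hk
    have hms : Measurable fun p : E3 × E3 => V p.1 * (secondDiff φ p.1 p.2 * k p.2) :=
      (hV.comp measurable_fst).mul ((continuous_secondDiff φ.continuous).measurable.mul
        (hkm.comp measurable_snd))
    have hle : ∀ᵐ p : E3 × E3 ∂(volume.prod volume), ‖V p.1 * (secondDiff φ p.1 p.2 * k p.2)‖
        ≤ M * ‖secondDiff φ p.1 p.2 * (‖p.2‖ ^ 4)⁻¹‖ := by
      have h0 : ∀ᵐ p : E3 × E3 ∂(volume.prod volume), p.2 ≠ 0 :=
        Measure.quasiMeasurePreserving_snd.ae (Measure.ae_ne volume (0 : E3))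
      filter_upwards [h0] with p hp
      rw [norm_mul, norm_mul, norm_mul, Real.norm_of_nonneg (by positivity : 0 ≤ (‖p.2‖ ^ 4)⁻¹)]
      gcongr
      · exact hM _
      · exact hk _ hp
    exact ⟨(φ.integrable_secondDiff_prod.norm.const_mul M).mono' hms.aestronglyMeasurable hle, hle⟩
  have hke : ∀ ε : ℝ, ∀ z : E3, z ≠ 0 → |((ε ^ 2 + ‖z‖ ^ 2) ^ 2)⁻¹| ≤ (‖z‖ ^ 4)⁻¹ := by
    intro ε z hz
    have := norm_pos_iff.2 hz
    rw [abs_of_nonneg (by positivity), show ‖z‖ ^ 4 = (‖z‖ ^ 2) ^ 2 by ring]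
    gcongr
    nlinarith [sq_nonneg ε]
  have hprod : ∀ k : E3 → ℝ, Measurable k → (∀ z, z ≠ 0 → |k z| ≤ (‖z‖ ^ 4)⁻¹) →
      ∫ p : E3 × E3, V p.1 * (secondDiff φ p.1 p.2 * k p.2) ∂(volume.prod volume)
        = ∫ x, V x * ∫ z, secondDiff φ x z * k z := by
    intro k hkm hk
    rw [integral_prod _ (hF k hkm hk).1]
    simp_rw [integral_const_mul]
  have hlim : Tendsto (fun ε : ℝ => ∫ p : E3 × E3,
      V p.1 * (secondDiff φ p.1 p.2 * ((ε ^ 2 + ‖p.2‖ ^ 2) ^ 2)⁻¹) ∂(volume.prod volume))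
      (nhdsWithin 0 (Set.Ioi 0)) (nhds (∫ p : E3 × E3,
        V p.1 * (secondDiff φ p.1 p.2 * (‖p.2‖ ^ 4)⁻¹) ∂(volume.prod volume))) := by
    refine tendsto_integral_filter_of_dominated_convergence
      (fun p => M * ‖secondDiff φ p.1 p.2 * (‖p.2‖ ^ 4)⁻¹‖)
      (Eventually.of_forall fun ε => (hF _ (by fun_prop) (hke ε)).1.aestronglyMeasurable)
      (Eventually.of_forall fun ε => (hF _ (by fun_prop) (hke ε)).2)
      (φ.integrable_secondDiff_prod.norm.const_mul M) ?_
    have h0 : ∀ᵐ p : E3 × E3 ∂(volume.prod volume), p.2 ≠ 0 :=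
      Measure.quasiMeasurePreserving_snd.ae (Measure.ae_ne volume (0 : E3))
    filter_upwards [h0] with p hp
    have hp0 := norm_pos_iff.2 hp
    have hc : ContinuousAt (fun ε : ℝ =>
        V p.1 * (secondDiff φ p.1 p.2 * ((ε ^ 2 + ‖p.2‖ ^ 2) ^ 2)⁻¹)) 0 := by
      refine continuousAt_const.mul (continuousAt_const.mul (ContinuousAt.inv₀ (by fun_prop) ?_))
      positivity
    have h1 := hc.tendsto.mono_left (nhdsWithin_le_nhds (s := Set.Ioi (0 : ℝ)))
    have e : ((0 : ℝ) ^ 2 + ‖p.2‖ ^ 2) ^ 2 = ‖p.2‖ ^ 4 := by ring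
    rwa [e] at h1
  rw [hprod (fun z => (‖z‖ ^ 4)⁻¹) (by fun_prop) (fun z _ => by
    rw [abs_of_nonneg (by positivity)])] at hlim
  have h2 := hlim.const_mul (1 / (2 * π ^ 2))
  have e1 : 1 / (2 * π ^ 2) * ∫ x, V x * ∫ z, secondDiff φ x z * (‖z‖ ^ 4)⁻¹
      = ∫ x, V x * halfLap φ x := by
    rw [← integral_const_mul]
    refine integral_congr_ae (Eventually.of_forall fun x => ?_)
    simp only [halfLap_eq]
    ring
  rw [e1] at h2
  refine h2.congr' ?_
  filter_upwards [self_mem_nhdsWithin] with ε hε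
  rw [hprod (fun z => ((ε ^ 2 + ‖z‖ ^ 2) ^ 2)⁻¹) (by fun_prop) (hke ε), ← integral_const_mul]
  refine integral_congr_ae (Eventually.of_forall fun x => ?_)
  simp only [regHalfLap_eq hε φ.continuous hB]
  ring

theorem DecayDens.integral_neg_lap_mul_halfLap {ρ : E3 → ℝ} {D : ℝ} (h : DecayDens ρ D) (c : ℝ)
    (φ : SchwartzMap E3 ℝ) :
    ∫ x, (-(lap (logPot c ρ) x)) * halfLap φ x = ∫ x, ρ x * φ x := by
  obtain ⟨B, hB0, hB⟩ := φ.exists_abs_le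
  obtain ⟨M, hM0, hM⟩ := h.exists_rieszPot_bound
  have h1 := tendsto_integral_mul_regHalfLap (measurable_rieszPot h.meas) (M := M)
    (fun x => by rw [abs_of_nonneg (rieszPot_nonneg h.nonneg x)]; exact (hM x).2) φ
  have h2 := tendsto_integral_riesz_approx h φ.continuous hB
  have h3 : ∫ x, rieszPot ρ x * halfLap φ x = 2 * π ^ 2 * ∫ y, ρ y * φ y := by
    refine tendsto_nhds_unique h1 (h2.congr' ?_)
    filter_upwards [self_mem_nhdsWithin] with ε hε
    exact (integral_rieszPot_mul_regHalfLap h hε φ.integrable hB).symm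
  have h4 : ∀ x, (-(lap (logPot c ρ) x)) * halfLap φ x
      = 1 / (2 * π ^ 2) * (rieszPot ρ x * halfLap φ x) := by
    intro x
    rw [h.lap_logPot c, rieszPot]
    ring
  simp_rw [h4]
  rw [integral_const_mul, h3]
  field_simp

end WeakEquation

section CosineTransform

/-- Cosine transform. -/
noncomputable def cosTr (f : E3 → ℝ) (ξ : E3) : ℝ := ∫ x, f x * cos (inner ℝ x ξ)

/-- Sine transform. -/
noncomputable def sinTr (f : E3 → ℝ) (ξ : E3) : ℝ := ∫ x, f x * sin (inner ℝ x ξ)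

lemma integral_gauss_mul_cos {b : ℝ} (hb : 0 < b) (z : E3) :
    ∫ ξ : E3, exp (-b * ‖ξ‖ ^ 2) * cos (inner ℝ z ξ)
      = (π / b) ^ (3 / 2 : ℝ) * exp (-‖z‖ ^ 2 / (4 * b)) := by
  have h := GaussianFourier.integral_cexp_neg_mul_sq_norm_add (V := E3) (b := (b : ℂ))
    (by simpa using hb) Complex.I z
  have hi : Integrable fun ξ : E3 =>
      Complex.exp (-(b : ℂ) * ‖ξ‖ ^ 2 + Complex.I * (inner ℝ z ξ : ℝ)) :=
    GaussianFourier.integrable_cexp_neg_mul_sq_norm_add (V := E3) (b := (b : ℂ))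
      (by simpa using hb) Complex.I z
  have hre := congrArg Complex.re h
  have hl : (∫ ξ : E3, Complex.exp (-(b : ℂ) * ‖ξ‖ ^ 2 + Complex.I * (inner ℝ z ξ : ℝ))).re
      = ∫ ξ : E3, (Complex.exp (-(b : ℂ) * ‖ξ‖ ^ 2 + Complex.I * (inner ℝ z ξ : ℝ))).re :=
    (integral_re hi).symm
  rw [hl] at hre
  have e1 : ∀ ξ : E3, (Complex.exp (-(b : ℂ) * ‖ξ‖ ^ 2 + Complex.I * (inner ℝ z ξ : ℝ))).re
      = exp (-b * ‖ξ‖ ^ 2) * cos (inner ℝ z ξ) := by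
    intro ξ
    rw [Complex.exp_re]
    have h1 : (-(b : ℂ) * ‖ξ‖ ^ 2 + Complex.I * (inner ℝ z ξ : ℝ)).re = -b * ‖ξ‖ ^ 2 := by
      simp [← Complex.ofReal_pow]
    have h2 : (-(b : ℂ) * ‖ξ‖ ^ 2 + Complex.I * (inner ℝ z ξ : ℝ)).im = inner ℝ z ξ := by
      simp [← Complex.ofReal_pow]
    rw [h1, h2]
  simp_rw [e1] at hre
  rw [hre, finrank_euclideanSpace, Fintype.card_fin, Complex.I_sq]
  have e2 : ((π : ℂ) / b) ^ (((3 : ℕ) : ℂ) / 2) * Complex.exp (-1 * ‖z‖ ^ 2 / (4 * b))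
      = (((π / b) ^ (3 / 2 : ℝ) * exp (-‖z‖ ^ 2 / (4 * b)) : ℝ) : ℂ) := by
    rw [Complex.ofReal_mul, Complex.ofReal_cpow (by positivity), Complex.ofReal_exp]
    push_cast
    simp
  rw [e2, Complex.ofReal_re]

lemma integrable_mul_cos {f : E3 → ℝ} (hf : Integrable f) (ξ : E3) :
    Integrable fun x => f x * cos (inner ℝ x ξ) :=
  hf.mul_bdd (c := 1) (by fun_prop : Continuous fun x : E3 =>
    cos (inner ℝ x ξ)).aestronglyMeasurable (Eventually.of_forall fun x => abs_cos_le_one _)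

lemma integrable_mul_sin {f : E3 → ℝ} (hf : Integrable f) (ξ : E3) :
    Integrable fun x => f x * sin (inner ℝ x ξ) :=
  hf.mul_bdd (c := 1) (by fun_prop : Continuous fun x : E3 =>
    sin (inner ℝ x ξ)).aestronglyMeasurable (Eventually.of_forall fun x => abs_sin_le_one _)

lemma cosTr_mul_add_sinTr_mul {f g : E3 → ℝ} (hf : Integrable f) (hg : Integrable g) (ξ : E3) :
    cosTr f ξ * cosTr g ξ + sinTr f ξ * sinTr g ξ
      = ∫ p : E3 × E3, f p.1 * g p.2 * cos (inner ℝ (p.1 - p.2) ξ) ∂(volume.prod volume) := by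
  have h1 : Integrable (fun p : E3 × E3 => f p.1 * cos (inner ℝ p.1 ξ) *
      (g p.2 * cos (inner ℝ p.2 ξ))) (volume.prod volume) :=
    (integrable_mul_cos hf ξ).mul_prod (integrable_mul_cos hg ξ)
  have h2 : Integrable (fun p : E3 × E3 => f p.1 * sin (inner ℝ p.1 ξ) *
      (g p.2 * sin (inner ℝ p.2 ξ))) (volume.prod volume) :=
    (integrable_mul_sin hf ξ).mul_prod (integrable_mul_sin hg ξ)
  unfold cosTr sinTr
  rw [← integral_prod_mul, ← integral_prod_mul, ← integral_add h1 h2]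
  refine integral_congr_ae (Eventually.of_forall fun p => ?_)
  simp only [inner_sub_left, cos_sub]
  ring

lemma integral_gauss_bilinear {f g : E3 → ℝ} (hf : Integrable f) (hg : Integrable g) {τ : ℝ}
    (hτ : 0 < τ) :
    (4 * π / τ) ^ (3 / 2 : ℝ) *
      ∫ p : E3 × E3, f p.1 * g p.2 * exp (-‖p.1 - p.2‖ ^ 2 / τ) ∂(volume.prod volume)
      = ∫ ξ, exp (-(τ / 4) * ‖ξ‖ ^ 2) *
        (cosTr f ξ * cosTr g ξ + sinTr f ξ * sinTr g ξ) := by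
  have hτ4 : 0 < τ / 4 := by positivity
  have h_integrable : Integrable (Function.uncurry fun (ξ : E3) (p : E3 × E3) =>
      exp (-(τ / 4) * ‖ξ‖ ^ 2) * (f p.1 * g p.2 * cos (inner ℝ (p.1 - p.2) ξ)))
      (volume.prod (volume.prod volume)) := by
    have h1 : Integrable (fun q : E3 × (E3 × E3) =>
        exp (-(τ / 4) * ‖q.1‖ ^ 2) * (f q.2.1 * g q.2.2)) (volume.prod (volume.prod volume)) :=
      (integrable_gauss hτ4).mul_prod (hf.mul_prod hg)
    refine (h1.mul_bdd (c := 1) (by fun_prop : Continuous fun q : E3 × (E3 × E3) =>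
      cos (inner ℝ (q.2.1 - q.2.2) q.1)).aestronglyMeasurable
      (Eventually.of_forall fun x => abs_cos_le_one _)).congr (Eventually.of_forall fun q => ?_)
    simp only [Function.uncurry]
    ring
  simp_rw [cosTr_mul_add_sinTr_mul hf hg, ← integral_const_mul]
  rw [integral_integral_swap h_integrable]
  refine integral_congr_ae (Eventually.of_forall fun p => ?_)
  have e : ∀ ξ : E3, exp (-(τ / 4) * ‖ξ‖ ^ 2) * (f p.1 * g p.2 * cos (inner ℝ (p.1 - p.2) ξ))
      = f p.1 * g p.2 * (exp (-(τ / 4) * ‖ξ‖ ^ 2) * cos (inner ℝ (p.1 - p.2) ξ)) := fun ξ => by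
    ring
  simp only [e]
  rw [integral_const_mul, integral_gauss_mul_cos hτ4]
  have h4 : π / (τ / 4) = 4 * π / τ := by field_simp
  have h5 : 4 * (τ / 4) = τ := by ring
  rw [h4, h5]
  ring

end CosineTransform

section Plancherel

lemma continuous_cosTr {f : E3 → ℝ} (hf : Integrable f) : Continuous (cosTr f) := by
  refine continuous_of_dominated (bound := fun x => |f x|)
    (fun ξ => (integrable_mul_cos hf ξ).aestronglyMeasurable)
    (fun ξ => Eventually.of_forall fun x => ?_) hf.abs
    (Eventually.of_forall fun x => by fun_prop)
  rw [norm_mul]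
  exact mul_le_of_le_one_right (abs_nonneg _) (abs_cos_le_one _)

lemma continuous_sinTr {f : E3 → ℝ} (hf : Integrable f) : Continuous (sinTr f) := by
  refine continuous_of_dominated (bound := fun x => |f x|)
    (fun ξ => (integrable_mul_sin hf ξ).aestronglyMeasurable)
    (fun ξ => Eventually.of_forall fun x => ?_) hf.abs
    (Eventually.of_forall fun x => by fun_prop)
  rw [norm_mul]
  exact mul_le_of_le_one_right (abs_nonneg _) (abs_sin_le_one _)

/-- The squared modulus of the Fourier transform. -/
noncomputable def powerSpec (f : E3 → ℝ) (ξ : E3) : ℝ := cosTr f ξ ^ 2 + sinTr f ξ ^ 2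

lemma powerSpec_nonneg (f : E3 → ℝ) (ξ : E3) : 0 ≤ powerSpec f ξ := by
  unfold powerSpec; positivity

lemma integral_gauss_diagonal_le {f : E3 → ℝ} (hf : Integrable f)
    (hf2 : Integrable fun x => f x ^ 2) {τ : ℝ} (hτ : 0 < τ) :
    ∫ p : E3 × E3, f p.1 * f p.2 * exp (-‖p.1 - p.2‖ ^ 2 / τ) ∂(volume.prod volume)
      ≤ (π * τ) ^ (3 / 2 : ℝ) * ∫ x, f x ^ 2 := by
  have hg : Integrable fun z : E3 => exp (-‖z‖ ^ 2 / τ) :=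
    (integrable_gauss (inv_pos.2 hτ)).congr (Eventually.of_forall fun z => by
      simp only; congr 1; ring)
  have hgv : ∫ z : E3, exp (-‖z‖ ^ 2 / τ) = (π * τ) ^ (3 / 2 : ℝ) := by
    have h := GaussianFourier.integral_rexp_neg_mul_sq_norm (V := E3) (inv_pos.2 hτ)
    rw [finrank_euclideanSpace, Fintype.card_fin, div_inv_eq_mul] at h
    push_cast at h
    rw [← h]
    exact integral_congr_ae (Eventually.of_forall fun z => by simp only; congr 1; ring)
  have hsec : ∀ x : E3, ∫ y, exp (-‖x - y‖ ^ 2 / τ) = (π * τ) ^ (3 / 2 : ℝ) := fun x => by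
    rw [integral_sub_left_eq_self (fun z : E3 => exp (-‖z‖ ^ 2 / τ)), hgv]
  obtain ⟨hi, -⟩ := integral_mul_integral_swap (F := fun x y => exp (-‖x - y‖ ^ 2 / τ))
    (M := (π * τ) ^ (3 / 2 : ℝ)) (by
      exact (by fun_prop : Measurable fun p : E3 × E3 => exp (-‖p.1 - p.2‖ ^ 2 / τ)))
    (fun x y => (exp_pos _).le) (fun x => hg.comp_sub_left x) (fun x => (hsec x).le) hf2
  have hi' : Integrable (fun p : E3 × E3 => f p.2 ^ 2 * exp (-‖p.1 - p.2‖ ^ 2 / τ))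
      (volume.prod volume) := by
    refine hi.swap.congr (Eventually.of_forall fun p => ?_)
    simp only [Function.comp, Prod.fst_swap, Prod.snd_swap, norm_sub_rev p.2 p.1]
  have hv : ∫ p : E3 × E3, f p.1 ^ 2 * exp (-‖p.1 - p.2‖ ^ 2 / τ) ∂(volume.prod volume)
      = (π * τ) ^ (3 / 2 : ℝ) * ∫ x, f x ^ 2 := by
    rw [integral_prod _ hi]
    simp_rw [integral_const_mul, hsec]
    rw [integral_mul_const, mul_comm]
  have hv' : ∫ p : E3 × E3, f p.2 ^ 2 * exp (-‖p.1 - p.2‖ ^ 2 / τ) ∂(volume.prod volume)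
      = (π * τ) ^ (3 / 2 : ℝ) * ∫ x, f x ^ 2 := by
    rw [← hv, ← integral_prod_swap]
    simp only [Prod.fst_swap, Prod.snd_swap]
    refine integral_congr_ae (Eventually.of_forall fun p => ?_)
    simp only [norm_sub_rev p.2 p.1]
  have hff : Integrable (fun p : E3 × E3 => f p.1 * f p.2 * exp (-‖p.1 - p.2‖ ^ 2 / τ))
      (volume.prod volume) := by
    refine (hf.mul_prod hf).mul_bdd (c := 1) (by fun_prop : Continuous fun p : E3 × E3 =>
      exp (-‖p.1 - p.2‖ ^ 2 / τ)).aestronglyMeasurable (Eventually.of_forall fun p => ?_)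
    rw [Real.norm_of_nonneg (exp_pos _).le]
    exact exp_le_one_iff.2 (div_nonpos_of_nonpos_of_nonneg (by simp) hτ.le)
  calc _ ≤ ∫ p : E3 × E3, (1 / 2 * (f p.1 ^ 2 * exp (-‖p.1 - p.2‖ ^ 2 / τ)) +
        1 / 2 * (f p.2 ^ 2 * exp (-‖p.1 - p.2‖ ^ 2 / τ))) ∂(volume.prod volume) := by
        refine integral_mono hff ((hi.const_mul _).add (hi'.const_mul _)) fun p => ?_
        simp only
        nlinarith [mul_nonneg (sq_nonneg (f p.1 - f p.2)) (exp_pos (-‖p.1 - p.2‖ ^ 2 / τ)).le]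
    _ = _ := by
        rw [integral_add (hi.const_mul _) (hi'.const_mul _), integral_const_mul,
          integral_const_mul, hv, hv']
        ring

lemma integrable_powerSpec {f : E3 → ℝ} (hf : Integrable f)
    (hf2 : Integrable fun x => f x ^ 2) :
    Integrable (powerSpec f) ∧ ∫ ξ, powerSpec f ξ ≤ (2 * π) ^ 3 * ∫ x, f x ^ 2 := by
  have hc : Continuous (powerSpec f) :=
    ((continuous_cosTr hf).pow 2).add ((continuous_sinTr hf).pow 2)
  set N := (2 * π) ^ 3 * ∫ x, f x ^ 2 with hN
  have hN0 : 0 ≤ N := mul_nonneg (by positivity) (integral_nonneg fun x => sq_nonneg _)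
  have hb : ∀ τ : ℝ, 0 < τ → ∫⁻ ξ, ENNReal.ofReal (exp (-(τ / 4) * ‖ξ‖ ^ 2) * powerSpec f ξ)
      ≤ ENNReal.ofReal N := by
    intro τ hτ
    have hB : ∀ ξ, |powerSpec f ξ| ≤ (∫ x, |f x|) ^ 2 + (∫ x, |f x|) ^ 2 := by
      intro ξ
      rw [abs_of_nonneg (powerSpec_nonneg f ξ), powerSpec]
      have h1 : |cosTr f ξ| ≤ ∫ x, |f x| := by
        rw [cosTr, ← Real.norm_eq_abs]
        refine norm_integral_le_of_norm_le hf.abs (Eventually.of_forall fun x => ?_)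
        rw [norm_mul]
        exact mul_le_of_le_one_right (abs_nonneg _) (abs_cos_le_one _)
      have h2 : |sinTr f ξ| ≤ ∫ x, |f x| := by
        rw [sinTr, ← Real.norm_eq_abs]
        refine norm_integral_le_of_norm_le hf.abs (Eventually.of_forall fun x => ?_)
        rw [norm_mul]
        exact mul_le_of_le_one_right (abs_nonneg _) (abs_sin_le_one _)
      rw [← sq_abs (cosTr f ξ), ← sq_abs (sinTr f ξ)]
      gcongr
    have hi : Integrable fun ξ => exp (-(τ / 4) * ‖ξ‖ ^ 2) * powerSpec f ξ :=
      (integrable_gauss (by positivity : 0 < τ / 4)).mul_bdd hc.aestronglyMeasurable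
        (Eventually.of_forall hB)
    rw [← ofReal_integral_eq_lintegral_ofReal hi
      (Eventually.of_forall fun ξ => mul_nonneg (exp_pos _).le (powerSpec_nonneg f ξ))]
    refine ENNReal.ofReal_le_ofReal ?_
    have h1 := integral_gauss_bilinear hf hf hτ
    have e : ∀ ξ, cosTr f ξ * cosTr f ξ + sinTr f ξ * sinTr f ξ = powerSpec f ξ := fun ξ => by
      rw [powerSpec]; ring
    simp_rw [e] at h1
    rw [← h1]
    refine (mul_le_mul_of_nonneg_left (integral_gauss_diagonal_le hf hf2 hτ)
      (by positivity)).trans (le_of_eq ?_)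
    rw [← mul_assoc, ← Real.mul_rpow (by positivity) (by positivity), hN]
    congr 1
    have h4 : 4 * π / τ * (π * τ) = (2 * π) ^ (2 : ℝ) := by
      rw [Real.rpow_two]
      field_simp
      norm_num
    rw [h4, ← Real.rpow_mul (by positivity)]
    norm_num
  have hl : ∫⁻ ξ, ENNReal.ofReal (powerSpec f ξ) ≤ ENNReal.ofReal N := by
    have hlim : ∀ ξ, Tendsto (fun n : ℕ => ENNReal.ofReal
        (exp (-((1 / ((n : ℝ) + 1)) / 4) * ‖ξ‖ ^ 2) * powerSpec f ξ)) atTop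
        (nhds (ENNReal.ofReal (powerSpec f ξ))) := by
      intro ξ
      refine (ENNReal.continuous_ofReal.tendsto _).comp ?_
      have hcc : Continuous fun s : ℝ => exp (-(s / 4) * ‖ξ‖ ^ 2) * powerSpec f ξ := by fun_prop
      have := (hcc.tendsto 0).comp tendsto_one_div_add_atTop_nhds_zero_nat
      simpa [Function.comp_def] using this
    calc ∫⁻ ξ, ENNReal.ofReal (powerSpec f ξ)
        = ∫⁻ ξ, liminf (fun n : ℕ => ENNReal.ofReal
          (exp (-((1 / ((n : ℝ) + 1)) / 4) * ‖ξ‖ ^ 2) * powerSpec f ξ)) atTop :=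
          lintegral_congr fun ξ => (hlim ξ).liminf_eq.symm
      _ ≤ liminf (fun n : ℕ => ∫⁻ ξ, ENNReal.ofReal
          (exp (-((1 / ((n : ℝ) + 1)) / 4) * ‖ξ‖ ^ 2) * powerSpec f ξ)) atTop :=
          lintegral_liminf_le fun n => by
            have := hc.measurable
            fun_prop
      _ ≤ ENNReal.ofReal N :=
          liminf_le_of_le (by isBoundedDefault) fun b hb' => by
            obtain ⟨n, hn⟩ := hb'.exists
            exact hn.trans (hb _ (by positivity))
  have h_integrable : Integrable (powerSpec f) := by
    refine ⟨hc.aestronglyMeasurable, ?_⟩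
    rw [hasFiniteIntegral_iff_ofReal (Eventually.of_forall (powerSpec_nonneg f))]
    exact hl.trans_lt ENNReal.ofReal_lt_top
  refine ⟨h_integrable, ?_⟩
  rw [← ENNReal.ofReal_le_ofReal_iff hN0, ofReal_integral_eq_lintegral_ofReal h_integrable
    (Eventually.of_forall (powerSpec_nonneg f))]
  exact hl

end Plancherel

section SpectralDerivative

lemma hasFDerivAt_inner_left (ξ x : E3) :
    HasFDerivAt (fun x : E3 => (inner ℝ x ξ : ℝ)) (innerSL ℝ ξ) x := by
  refine ((innerSL ℝ ξ).hasFDerivAt (x := x)).congr_of_eventuallyEq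
    (Eventually.of_forall fun y => ?_)
  exact real_inner_comm _ _

lemma pd_cos_inner (i : Fin 3) (ξ x : E3) :
    pd i (fun x : E3 => cos (inner ℝ x ξ)) x = -(ξ i * sin (inner ℝ x ξ)) := by
  rw [pd, (hasFDerivAt_inner_left ξ x).cos.fderiv]
  simp [EuclideanSpace.inner_single_right, mul_comm]

lemma pd_sin_inner (i : Fin 3) (ξ x : E3) :
    pd i (fun x : E3 => sin (inner ℝ x ξ)) x = ξ i * cos (inner ℝ x ξ) := by
  rw [pd, (hasFDerivAt_inner_left ξ x).sin.fderiv]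
  simp [EuclideanSpace.inner_single_right, mul_comm]

lemma differentiable_inner_left (ξ : E3) : Differentiable ℝ fun x : E3 => (inner ℝ x ξ : ℝ) :=
  fun x => (hasFDerivAt_inner_left ξ x).differentiableAt

lemma cosTr_pd {φ : E3 → ℝ} (i : Fin 3) (hφ : ContDiff ℝ (⊤ : ℕ∞) φ) (hs : HasCompactSupport φ)
    (ξ : E3) : cosTr (pd i φ) ξ = ξ i * sinTr φ ξ := by
  have h := integral_mul_pd i (differentiable_inner_left ξ).cos
    ⟨|ξ i|, fun x => by
      rw [pd_cos_inner, abs_neg, abs_mul]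
      exact mul_le_of_le_one_right (abs_nonneg _) (abs_sin_le_one _)⟩ hφ hs
  simp_rw [pd_cos_inner, neg_mul, integral_neg, neg_neg, mul_assoc, integral_const_mul] at h
  unfold cosTr sinTr
  simp_rw [mul_comm (pd i φ _), mul_comm (φ _)]
  exact h

lemma sinTr_pd {φ : E3 → ℝ} (i : Fin 3) (hφ : ContDiff ℝ (⊤ : ℕ∞) φ) (hs : HasCompactSupport φ)
    (ξ : E3) : sinTr (pd i φ) ξ = -(ξ i * cosTr φ ξ) := by
  have h := integral_mul_pd i (differentiable_inner_left ξ).sin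
    ⟨|ξ i|, fun x => by
      rw [pd_sin_inner, abs_mul]
      exact mul_le_of_le_one_right (abs_nonneg _) (abs_cos_le_one _)⟩ hφ hs
  simp_rw [pd_sin_inner, mul_assoc, integral_const_mul] at h
  unfold cosTr sinTr
  simp_rw [mul_comm (pd i φ _), mul_comm (φ _)]
  exact h

lemma powerSpec_pd_le {φ : E3 → ℝ} (i : Fin 3) (hφ : ContDiff ℝ (⊤ : ℕ∞) φ)
    (hs : HasCompactSupport φ) (ξ : E3) :
    powerSpec (pd i φ) ξ ≤ ‖ξ‖ ^ 2 * powerSpec φ ξ := by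
  have h1 : (ξ i) ^ 2 ≤ ‖ξ‖ ^ 2 := by
    rw [← sq_abs (ξ i)]
    have := PiLp.norm_apply_le ξ i
    rw [Real.norm_eq_abs] at this
    gcongr
  have h2 : powerSpec (pd i φ) ξ = (ξ i) ^ 2 * powerSpec φ ξ := by
    rw [powerSpec, powerSpec, cosTr_pd i hφ hs, sinTr_pd i hφ hs]; ring
  rw [h2]
  exact mul_le_mul_of_nonneg_right h1 (powerSpec_nonneg _ _)

lemma hasCompactSupport_pd {φ : E3 → ℝ} (i : Fin 3) (hs : HasCompactSupport φ) :
    HasCompactSupport (pd i φ) := hs.fderiv_apply ℝ _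

lemma powerSpec_pd_pd_pd_le {φ : E3 → ℝ} (i j k : Fin 3) (hφ : ContDiff ℝ (⊤ : ℕ∞) φ)
    (hs : HasCompactSupport φ) (ξ : E3) :
    powerSpec (pd i (pd j (pd k φ))) ξ ≤ ‖ξ‖ ^ 6 * powerSpec φ ξ := by
  have h1 := powerSpec_pd_le k hφ hs ξ
  have h2 := powerSpec_pd_le j (contDiff_pd k hφ) (hasCompactSupport_pd k hs) ξ
  have h3 := powerSpec_pd_le i (contDiff_pd j (contDiff_pd k hφ))
    (hasCompactSupport_pd j (hasCompactSupport_pd k hs)) ξ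
  calc _ ≤ ‖ξ‖ ^ 2 * (‖ξ‖ ^ 2 * (‖ξ‖ ^ 2 * powerSpec φ ξ)) := by
        refine h3.trans (mul_le_mul_of_nonneg_left (h2.trans ?_) (by positivity))
        exact mul_le_mul_of_nonneg_left h1 (by positivity)
    _ = _ := by ring

lemma integral_pd_eq_zero {φ : E3 → ℝ} (i : Fin 3) (hφ : ContDiff ℝ (⊤ : ℕ∞) φ)
    (hs : HasCompactSupport φ) : ∫ x, pd i φ x = 0 := by
  have h0 : ∀ x, pd i (fun _ : E3 => (1 : ℝ)) x = 0 := fun x => by simp [pd]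
  have h := integral_mul_pd i (differentiable_const (1 : ℝ)) ⟨0, fun x => by simp [h0]⟩ hφ hs
  simpa [h0] using h

lemma lintegral_sqrt_mul_exp {r : ℝ} (hr : 0 < r) :
    ∫⁻ τ in Set.Ioi (0 : ℝ), ENNReal.ofReal (τ ^ (1 / 2 : ℝ) * exp (-(τ / 4) * r ^ 2))
      = ENNReal.ofReal (8 * Gamma (3 / 2) / r ^ 3) := by
  have h := Real.integral_rpow_mul_exp_neg_mul_Ioi (a := 3 / 2) (r := r ^ 2 / 4) (by norm_num)
    (by positivity)
  have e : ∀ τ : ℝ, τ ^ (3 / 2 - 1 : ℝ) * exp (-(r ^ 2 / 4 * τ))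
      = τ ^ (1 / 2 : ℝ) * exp (-(τ / 4) * r ^ 2) := fun τ => by
    congr 2
    · norm_num
    · ring
  simp_rw [e] at h
  have hv : (1 / (r ^ 2 / 4)) ^ (3 / 2 : ℝ) * Gamma (3 / 2) = 8 * Gamma (3 / 2) / r ^ 3 := by
    have : (1 / (r ^ 2 / 4)) = (2 / r) ^ (2 : ℝ) := by
      rw [Real.rpow_two]; field_simp; norm_num
    rw [this, ← Real.rpow_mul (by positivity)]
    norm_num
    field_simp
    norm_num
  rw [hv] at h
  have hpos : 0 < 8 * Gamma (3 / 2) / r ^ 3 := by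
    have := Gamma_pos_of_pos (s := 3 / 2) (by norm_num)
    positivity
  rw [← h, ofReal_integral_eq_lintegral_ofReal]
  · by_contra hn
    rw [integral_undef hn] at h
    exact hpos.ne h
  · filter_upwards [ae_restrict_mem measurableSet_Ioi] with τ hτ
    have : (0 : ℝ) < τ := hτ
    positivity

/-- The bilinear form of the Gaussian kernel of width `τ`. -/
noncomputable def gaussForm (f g : E3 → ℝ) (τ : ℝ) : ℝ :=
  ∫ p : E3 × E3, f p.1 * g p.2 * exp (-‖p.1 - p.2‖ ^ 2 / τ) ∂(volume.prod volume)

lemma abs_cosTr_mul_add_le (f g : E3 → ℝ) (ξ : E3) :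
    |cosTr f ξ * cosTr g ξ + sinTr f ξ * sinTr g ξ| ≤ √(powerSpec f ξ) * √(powerSpec g ξ) := by
  rw [← Real.sqrt_mul (powerSpec_nonneg _ _)]
  refine Real.abs_le_sqrt ?_
  unfold powerSpec
  nlinarith [sq_nonneg (cosTr f ξ * sinTr g ξ - sinTr f ξ * cosTr g ξ)]

lemma lintegral_gaussForm_le {f g φ : E3 → ℝ} (hf : Integrable f) (hg : Integrable g)
    (hφ : Integrable φ) (hgφ : ∀ ξ, powerSpec g ξ ≤ ‖ξ‖ ^ 6 * powerSpec φ ξ) :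
    ∫⁻ τ in Set.Ioi (0 : ℝ), ENNReal.ofReal (|gaussForm f g τ| / τ) ≤
      ∫⁻ ξ, ENNReal.ofReal ((4 * π) ^ (-(3 / 2) : ℝ) * (8 * Gamma (3 / 2)) *
        (√(powerSpec f ξ) * √(powerSpec φ ξ))) := by
  have hPc : ∀ {f : E3 → ℝ}, Integrable f → Measurable (powerSpec f) := fun hf =>
    (((continuous_cosTr hf).pow 2).add ((continuous_sinTr hf).pow 2)).measurable
  have hfm := hPc hf
  have hφm := hPc hφ
  set c : ℝ := (4 * π) ^ (-(3 / 2) : ℝ) with hc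
  have hc0 : 0 ≤ c := by positivity
  set S : E3 → ℝ := fun ξ => √(powerSpec f ξ) * √(powerSpec φ ξ) with hS
  have hSm : Measurable S := by fun_prop
  have hS0 : ∀ ξ, 0 ≤ S ξ := fun ξ => by positivity
  have hΓ := Gamma_pos_of_pos (s := 3 / 2) (by norm_num)
  have h1 : ∀ τ ∈ Set.Ioi (0 : ℝ), ENNReal.ofReal (|gaussForm f g τ| / τ) ≤
      ∫⁻ ξ, ENNReal.ofReal (τ ^ (1 / 2 : ℝ) * exp (-(τ / 4) * ‖ξ‖ ^ 2)) *
        ENNReal.ofReal (c * ‖ξ‖ ^ 3 * S ξ) := by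
    intro τ hτ
    have hτ : 0 < τ := hτ
    have hb := integral_gauss_bilinear hf hg hτ
    have hA : |gaussForm f g τ| / τ = c * τ ^ (1 / 2 : ℝ) * |∫ ξ, exp (-(τ / 4) * ‖ξ‖ ^ 2) *
        (cosTr f ξ * cosTr g ξ + sinTr f ξ * sinTr g ξ)| := by
      rw [← hb, abs_mul, abs_of_pos (show 0 < (4 * π / τ) ^ (3 / 2 : ℝ) by positivity), gaussForm, Real.div_rpow (by positivity) hτ.le,
        hc, Real.rpow_neg (by positivity)]
      have e : τ ^ (3 / 2 : ℝ) = τ * τ ^ (1 / 2 : ℝ) := by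
        rw [← Real.rpow_one_add' hτ.le (by norm_num)]; norm_num
      rw [e]
      have := (Real.rpow_pos_of_pos (show 0 < 4 * π by positivity) (3 / 2 : ℝ)).ne'
      have := (Real.rpow_pos_of_pos hτ (1 / 2 : ℝ)).ne'
      field_simp
    rw [hA, ENNReal.ofReal_mul (by positivity)]
    have h0 : ENNReal.ofReal |∫ ξ, exp (-(τ / 4) * ‖ξ‖ ^ 2) *
        (cosTr f ξ * cosTr g ξ + sinTr f ξ * sinTr g ξ)| ≤
        ∫⁻ ξ, ENNReal.ofReal ‖exp (-(τ / 4) * ‖ξ‖ ^ 2) *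
        (cosTr f ξ * cosTr g ξ + sinTr f ξ * sinTr g ξ)‖ :=
      ENNReal.ofReal_le_of_le_toReal (norm_integral_le_lintegral_norm fun ξ : E3 =>
        exp (-(τ / 4) * ‖ξ‖ ^ 2) * (cosTr f ξ * cosTr g ξ + sinTr f ξ * sinTr g ξ))
    refine (mul_le_mul_right h0 _).trans ?_
    rw [← lintegral_const_mul' _ _ ENNReal.ofReal_ne_top]
    refine lintegral_mono fun ξ => ?_
    rw [← ENNReal.ofReal_mul (by positivity), ← ENNReal.ofReal_mul (by positivity)]
    refine ENNReal.ofReal_le_ofReal ?_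
    rw [norm_mul, Real.norm_of_nonneg (exp_pos _).le, Real.norm_eq_abs]
    have h2 : |cosTr f ξ * cosTr g ξ + sinTr f ξ * sinTr g ξ| ≤ ‖ξ‖ ^ 3 * S ξ := by
      refine (abs_cosTr_mul_add_le f g ξ).trans ?_
      have h3 : √(powerSpec g ξ) ≤ ‖ξ‖ ^ 3 * √(powerSpec φ ξ) := by
        refine (Real.sqrt_le_sqrt (hgφ ξ)).trans (le_of_eq ?_)
        rw [Real.sqrt_mul (by positivity), show ‖ξ‖ ^ 6 = (‖ξ‖ ^ 3) ^ 2 by ring,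
          Real.sqrt_sq (by positivity)]
      calc _ ≤ √(powerSpec f ξ) * (‖ξ‖ ^ 3 * √(powerSpec φ ξ)) := by gcongr
        _ = _ := by simp only [hS]; ring
    calc _ ≤ c * τ ^ (1 / 2 : ℝ) * (exp (-(τ / 4) * ‖ξ‖ ^ 2) * (‖ξ‖ ^ 3 * S ξ)) := by gcongr
      _ = _ := by ring
  refine (setLIntegral_mono' measurableSet_Ioi h1).trans ?_
  rw [lintegral_lintegral_swap (by
    refine Measurable.aemeasurable ?_
    simp only [Function.uncurry_def]
    fun_prop)]
  refine lintegral_mono_ae ?_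
  filter_upwards [Measure.ae_ne volume (0 : E3)] with ξ hξ
  have hr : 0 < ‖ξ‖ := norm_pos_iff.2 hξ
  rw [lintegral_mul_const' _ _ ENNReal.ofReal_ne_top, lintegral_sqrt_mul_exp hr,
    ← ENNReal.ofReal_mul (by positivity)]
  refine ENNReal.ofReal_le_ofReal (le_of_eq ?_)
  field_simp
  simp only [hS]
  ring

end SpectralDerivative

section LogKernel

lemma intervalIntegrable_exp_div {a b v : ℝ} (ha : 0 < a) (hb : 0 < b) :
    IntervalIntegrable (fun τ => exp (-v / τ) / τ) volume a b := by
  have hne : ∀ τ ∈ Set.uIcc a b, τ ≠ 0 := fun τ hτ =>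
    ((lt_min ha hb).trans_le hτ.1).ne'
  refine ContinuousOn.intervalIntegrable ?_
  exact (Real.continuous_exp.comp_continuousOn
    (continuousOn_const.div continuousOn_id hne)).div continuousOn_id hne

lemma integral_exp_div_scale {c a b v : ℝ} (hc : c ≠ 0) :
    ∫ τ in a..b, exp (-v / (c * τ)) / τ = ∫ τ in c * a..c * b, exp (-v / τ) / τ := by
  rw [← intervalIntegral.smul_integral_comp_mul_left, smul_eq_mul,
    ← intervalIntegral.integral_const_mul]
  refine intervalIntegral.integral_congr fun τ _ => ?_
  rw [mul_div_assoc', mul_div_mul_left _ _ hc]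

lemma integral_exp_div_sub {a b u : ℝ} (ha : 0 < a) (hb : 0 < b) (hu : 0 < u) :
    (∫ τ in a..b, exp (-u / τ) / τ) - ∫ τ in a..b, exp (-1 / τ) / τ
      = ∫ τ in u⁻¹..1, (exp (-1 / (a * τ)) / τ - exp (-1 / (b * τ)) / τ) := by
  have hu' : 0 < u⁻¹ := inv_pos.2 hu
  have hI : ∀ {c d : ℝ}, 0 < c → 0 < d →
      IntervalIntegrable (fun τ => exp (-1 / τ) / τ) volume c d := fun hc hd =>
    intervalIntegrable_exp_div hc hd
  have hs : ∀ {c : ℝ}, 0 < c → IntervalIntegrable (fun τ => exp (-1 / (c * τ)) / τ) volume u⁻¹ 1 :=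
    fun {c} hc => by
      have := intervalIntegrable_exp_div (v := 1 / c) hu' one_pos
      refine this.congr fun τ _ => ?_
      rw [← neg_div, div_div]
  rw [intervalIntegral.integral_sub (hs ha) (hs hb), integral_exp_div_scale ha.ne',
    integral_exp_div_scale hb.ne']
  have h1 : ∫ τ in a..b, exp (-u / τ) / τ = ∫ τ in u⁻¹ * a..u⁻¹ * b, exp (-1 / τ) / τ := by
    rw [← integral_exp_div_scale hu'.ne']
    refine intervalIntegral.integral_congr fun τ _ => ?_
    congr 2
    rw [← div_div, div_inv_eq_mul]
    ring
  rw [h1, mul_one, mul_one, mul_comm u⁻¹, mul_comm u⁻¹]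
  have p1 := mul_pos ha hu'
  have p2 := mul_pos hb hu'
  have e1 := intervalIntegral.integral_add_adjacent_intervals (hI p1 ha) (hI ha hb)
  have e2 := intervalIntegral.integral_add_adjacent_intervals (hI p1 p2) (hI p2 hb)
  linarith

lemma abs_integral_exp_div_sub_le {a b u : ℝ} (ha : 0 < a) (hb : 0 < b) (hu : 0 < u) :
    |(∫ τ in a..b, exp (-u / τ) / τ) - ∫ τ in a..b, exp (-1 / τ) / τ| ≤ |log u| := by
  have hu' : 0 < u⁻¹ := inv_pos.2 hu
  rw [integral_exp_div_sub ha hb hu, ← Real.norm_eq_abs]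
  have hl : ∫ τ in u⁻¹..1, τ⁻¹ = log u := by
    rw [integral_inv_of_pos hu' one_pos, one_div, inv_inv]
  rw [← hl]
  refine intervalIntegral.norm_integral_le_abs_of_norm_le ?_
    (intervalIntegral.intervalIntegrable_inv (fun τ hτ => ((lt_min hu' one_pos).trans_le hτ.1).ne')
      continuousOn_id)
  filter_upwards [ae_restrict_mem measurableSet_uIoc] with τ hτ
  have hτ0 : 0 < τ := (lt_min hu' one_pos).trans hτ.1
  have h1 : ∀ {c : ℝ}, 0 < c → exp (-1 / (c * τ)) ≤ 1 := fun hc =>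
    exp_le_one_iff.2 (div_nonpos_of_nonpos_of_nonneg (by norm_num) (by positivity))
  rw [← sub_div, div_eq_mul_inv, norm_mul, Real.norm_of_nonneg (inv_pos.2 hτ0).le]
  refine mul_le_of_le_one_left (inv_pos.2 hτ0).le (abs_sub_le_iff.2 ⟨?_, ?_⟩)
  · have := exp_pos (-1 / (b * τ)); linarith [h1 ha]
  · have := exp_pos (-1 / (a * τ)); linarith [h1 hb]

lemma tendsto_integral_exp_div_sub {u : ℝ} (hu : 0 < u) :
    Tendsto (fun n : ℕ => (∫ τ in ((n : ℝ) + 1)⁻¹..(n : ℝ) + 1, exp (-u / τ) / τ) -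
      ∫ τ in ((n : ℝ) + 1)⁻¹..(n : ℝ) + 1, exp (-1 / τ) / τ) atTop (nhds (-log u)) := by
  have hu' : 0 < u⁻¹ := inv_pos.2 hu
  have hl : ∫ τ in u⁻¹..1, -τ⁻¹ = -log u := by
    rw [intervalIntegral.integral_neg, integral_inv_of_pos hu' one_pos, one_div, inv_inv]
  rw [← hl]
  have hn : ∀ n : ℕ, (0 : ℝ) < (n : ℝ) + 1 := fun n => by positivity
  simp_rw [fun n : ℕ => integral_exp_div_sub (inv_pos.2 (hn n)) (hn n) hu]
  have hpos : ∀ τ ∈ Set.uIoc u⁻¹ 1, 0 < τ := fun τ hτ => (lt_min hu' one_pos).trans hτ.1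
  refine intervalIntegral.tendsto_integral_filter_of_dominated_convergence (fun τ => τ⁻¹)
    (Eventually.of_forall fun n => (by fun_prop : Measurable fun τ : ℝ =>
      exp (-1 / (((n : ℝ) + 1)⁻¹ * τ)) / τ - exp (-1 / (((n : ℝ) + 1) * τ)) / τ
      ).aestronglyMeasurable)
    (Eventually.of_forall fun n => Eventually.of_forall fun τ hτ => ?_)
    (intervalIntegral.intervalIntegrable_inv (fun τ hτ => ((lt_min hu' one_pos).trans_le hτ.1).ne')
      continuousOn_id)
    (Eventually.of_forall fun τ hτ => ?_)
  · have hτ0 := hpos τ hτ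
    have h1 : ∀ {c : ℝ}, 0 < c → exp (-1 / (c * τ)) ≤ 1 := fun hc =>
      exp_le_one_iff.2 (div_nonpos_of_nonpos_of_nonneg (by norm_num) (by positivity))
    rw [← sub_div, div_eq_mul_inv, norm_mul, Real.norm_of_nonneg (inv_pos.2 hτ0).le]
    refine mul_le_of_le_one_left (inv_pos.2 hτ0).le (abs_sub_le_iff.2 ⟨?_, ?_⟩)
    · have := exp_pos (-1 / (((n : ℝ) + 1) * τ)); linarith [h1 (inv_pos.2 (hn n))]
    · have := exp_pos (-1 / (((n : ℝ) + 1)⁻¹ * τ)); linarith [h1 (hn n)]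
  · have hτ0 := hpos τ hτ
    have t1 : Tendsto (fun n : ℕ => exp (-1 / (((n : ℝ) + 1)⁻¹ * τ))) atTop (nhds 0) := by
      have hlin : Tendsto (fun n : ℕ => ((n : ℝ) + 1) * τ⁻¹) atTop atTop :=
        (tendsto_atTop_add_const_right _ _ tendsto_natCast_atTop_atTop).atTop_mul_const
          (inv_pos.2 hτ0)
      refine (tendsto_exp_neg_atTop_nhds_zero.comp hlin).congr fun n => ?_
      simp only [Function.comp]
      congr 1
      have := hn n
      field_simp
    have t2 : Tendsto (fun n : ℕ => exp (-1 / (((n : ℝ) + 1) * τ))) atTop (nhds 1) := by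
      have hc : Continuous fun s : ℝ => exp (-(s * τ⁻¹)) := by fun_prop
      have := (hc.tendsto 0).comp tendsto_one_div_add_atTop_nhds_zero_nat
      rw [zero_mul, neg_zero, exp_zero] at this
      refine this.congr fun n => ?_
      simp only [Function.comp]
      congr 1
      have := hn n
      field_simp
    have := (t1.div_const τ).sub (t2.div_const τ)
    rwa [zero_div, zero_sub, one_div] at this

end LogKernel

section LogForm

lemma gaussForm_comm (f g : E3 → ℝ) (τ : ℝ) : gaussForm f g τ = gaussForm g f τ := by
  unfold gaussForm
  rw [← integral_prod_swap]
  refine integral_congr_ae (Eventually.of_forall fun p => ?_)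
  simp only [Prod.fst_swap, Prod.snd_swap, norm_sub_rev p.2 p.1]
  ring

lemma integral_gaussForm_div {f g : E3 → ℝ} (hf : Integrable f) (hg : Integrable g) {a b : ℝ}
    (ha : 0 < a) (hab : a ≤ b) :
    Integrable (fun p : E3 × E3 => f p.1 * g p.2 * ∫ τ in a..b, exp (-‖p.1 - p.2‖ ^ 2 / τ) / τ)
      (volume.prod volume) ∧
    ∫ p : E3 × E3, f p.1 * g p.2 * (∫ τ in a..b, exp (-‖p.1 - p.2‖ ^ 2 / τ) / τ)
      ∂(volume.prod volume) = ∫ τ in a..b, gaussForm f g τ / τ := by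
  have hinv : Integrable (fun τ : ℝ => τ⁻¹) (volume.restrict (Set.Ioc a b)) := by
    have := intervalIntegral.intervalIntegrable_inv (μ := volume) (f := fun τ : ℝ => τ) (a := a)
      (b := b) (fun τ hτ => ((lt_min ha (ha.trans_le hab)).trans_le hτ.1).ne') continuousOn_id
    exact (intervalIntegrable_iff_integrableOn_Ioc_of_le hab).1 this
  have hfg : Integrable (fun p : E3 × E3 => f p.1 * g p.2) (volume.prod volume) := hf.mul_prod hg
  have hI : Integrable (fun q : (E3 × E3) × ℝ =>
      f q.1.1 * g q.1.2 * q.2⁻¹ * exp (-‖q.1.1 - q.1.2‖ ^ 2 / |q.2|))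
      ((volume.prod volume).prod (volume.restrict (Set.Ioc a b))) := by
    refine (hfg.mul_prod hinv).mul_bdd (c := 1) (by fun_prop : Measurable
      fun q : (E3 × E3) × ℝ => exp (-‖q.1.1 - q.1.2‖ ^ 2 / |q.2|)).aestronglyMeasurable
      (Eventually.of_forall fun q => ?_)
    rw [Real.norm_of_nonneg (exp_pos _).le]
    exact exp_le_one_iff.2 (div_nonpos_of_nonpos_of_nonneg (by simp) (abs_nonneg _))
  have e1 : ∀ p : E3 × E3, f p.1 * g p.2 * (∫ τ in a..b, exp (-‖p.1 - p.2‖ ^ 2 / τ) / τ)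
      = ∫ τ in Set.Ioc a b, f p.1 * g p.2 * τ⁻¹ * exp (-‖p.1 - p.2‖ ^ 2 / |τ|) := by
    intro p
    rw [intervalIntegral.integral_of_le hab, ← integral_const_mul]
    refine setIntegral_congr_fun measurableSet_Ioc fun τ hτ => ?_
    simp only [abs_of_pos (ha.trans hτ.1)]
    ring
  have e2 : ∫ τ in a..b, gaussForm f g τ / τ = ∫ τ in Set.Ioc a b, ∫ p : E3 × E3,
      f p.1 * g p.2 * τ⁻¹ * exp (-‖p.1 - p.2‖ ^ 2 / |τ|) ∂(volume.prod volume) := by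
    rw [intervalIntegral.integral_of_le hab]
    refine setIntegral_congr_fun measurableSet_Ioc fun τ hτ => ?_
    simp only [abs_of_pos (ha.trans hτ.1), gaussForm]
    rw [div_eq_mul_inv, ← integral_mul_const]
    refine integral_congr_ae (Eventually.of_forall fun p => ?_)
    simp only
    ring
  refine ⟨hI.integral_prod_left.congr (Eventually.of_forall fun p => (e1 p).symm), ?_⟩
  simp_rw [e1]
  rw [e2, integral_integral_swap hI]

lemma abs_integral_gaussForm_div_le {f g : E3 → ℝ} {a b B : ℝ} (ha : 0 < a) (hab : a ≤ b)
    (hB0 : 0 ≤ B) (hB : ∫⁻ τ in Set.Ioi (0 : ℝ), ENNReal.ofReal (|gaussForm f g τ| / τ)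
      ≤ ENNReal.ofReal B) :
    |∫ τ in a..b, gaussForm f g τ / τ| ≤ B := by
  rw [intervalIntegral.integral_of_le hab, ← Real.norm_eq_abs]
  refine (norm_integral_le_lintegral_norm fun τ => gaussForm f g τ / τ).trans ?_
  refine ENNReal.toReal_le_of_le_ofReal hB0 (le_trans ?_ hB)
  calc ∫⁻ τ in Set.Ioc a b, ENNReal.ofReal ‖gaussForm f g τ / τ‖
      = ∫⁻ τ in Set.Ioc a b, ENNReal.ofReal (|gaussForm f g τ| / τ) := by
        refine setLIntegral_congr_fun measurableSet_Ioc fun τ hτ => ?_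
        simp only [norm_div, Real.norm_eq_abs, abs_of_pos (ha.trans hτ.1)]
    _ ≤ _ := lintegral_mono_set fun τ hτ => ha.trans hτ.1

lemma abs_log_le_inv_add {r : ℝ} (hr : 0 ≤ r) : |log r| ≤ r ^ (-1 : ℝ) + r := by
  rcases hr.eq_or_lt with rfl | hr
  · simp
  rw [Real.rpow_neg_one]
  have h1 := Real.log_le_sub_one_of_pos hr
  have h2 := Real.log_le_sub_one_of_pos (inv_pos.2 hr)
  rw [Real.log_inv] at h2
  have := inv_pos.2 hr
  exact abs_le.2 ⟨by linarith, by linarith⟩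

namespace DecayDens

variable {ρ : E3 → ℝ} {D : ℝ} (h : DecayDens ρ D) {g : E3 → ℝ}
include h

lemma exists_integral_abs_log_le : ∃ M, ∀ x, ∫ y, |log ‖x - y‖| * ρ y ≤ M * (1 + ‖x‖) := by
  obtain ⟨M, hM0, hM⟩ := h.exists_riesz_bound one_pos (by norm_num)
  set N := ∫ y, (1 + ‖y‖ ^ 2) * ρ y
  refine ⟨M + 2 * N, fun x => ?_⟩
  have hl := h.integrable_linear 0 1 x
  have h1 : ∫ y, |log ‖x - y‖| * ρ y
      ≤ ∫ y, (‖x - y‖ ^ (-1 : ℝ) * ρ y + (0 + 1 * ‖x - y‖) * ρ y) := by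
    have hi := ((h.hasFDerivAt_log_potential x).1).abs
    refine integral_mono (hi.congr (Eventually.of_forall fun y => ?_)) ((hM x).1.add hl)
      fun y => ?_
    · simp only [abs_mul, abs_of_nonneg (h.nonneg y)]
    · simp only [zero_add, one_mul]
      rw [← add_mul]
      exact mul_le_mul_of_nonneg_right (abs_log_le_inv_add (norm_nonneg _)) (h.nonneg y)
  have h2 : ∫ y, (0 + 1 * ‖x - y‖) * ρ y ≤ ∫ y, 2 * (1 + ‖x‖) * ((1 + ‖y‖ ^ 2) * ρ y) := by
    refine integral_mono hl (h.integrable_moment.const_mul _) fun y => ?_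
    simp only [zero_add, one_mul]
    rw [← mul_assoc]
    refine mul_le_mul_of_nonneg_right ?_ (h.nonneg y)
    have := norm_sub_le x y
    nlinarith [norm_nonneg x, norm_nonneg y, sq_nonneg (‖y‖ - 1),
      mul_nonneg (norm_nonneg x) (sq_nonneg ‖y‖)]
  rw [integral_add (hM x).1 hl] at h1
  rw [integral_const_mul] at h2
  have h3 := (hM x).2
  nlinarith [mul_nonneg hM0 (norm_nonneg x)]

lemma integrable_log_prod (hg : Integrable fun x => g x * (1 + ‖x‖)) :
    Integrable (fun p : E3 × E3 => g p.1 * (|log ‖p.1 - p.2‖| * ρ p.2))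
      (volume.prod volume) := by
  obtain ⟨M, hM⟩ := h.exists_integral_abs_log_le
  have hp : ∀ x : E3, 0 < 1 + ‖x‖ := fun x => by positivity
  have hi : ∀ x : E3, Integrable fun y => |log ‖x - y‖| * ρ y := fun x =>
    ((h.hasFDerivAt_log_potential x).1).abs.congr (Eventually.of_forall fun y => by
      simp only [abs_mul, abs_of_nonneg (h.nonneg y)])
  have hm : Measurable (Function.uncurry fun x y : E3 =>
      (1 + ‖x‖)⁻¹ * (|log ‖x - y‖| * ρ y)) := by
    have h1 : Measurable fun p : E3 × E3 => log ‖p.1 - p.2‖ :=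
      Real.measurable_log.comp (by fun_prop)
    have h2 : Measurable fun p : E3 × E3 => |log ‖p.1 - p.2‖| := by
      simpa only [Real.norm_eq_abs] using h1.norm
    exact (by fun_prop : Measurable fun p : E3 × E3 => (1 + ‖p.1‖)⁻¹).mul
      (h2.mul (h.meas.comp measurable_snd))
  refine (integral_mul_integral_swap hm (M := M) (fun x y => ?_) (fun x => (hi x).const_mul _)
    (fun x => ?_) hg).1.congr (Eventually.of_forall fun p => ?_)
  · have := h.nonneg y
    positivity
  · rw [integral_const_mul, inv_mul_le_iff₀ (hp x), mul_comm]
    exact hM x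
  · have := (hp p.1).ne'
    simp only
    field_simp

lemma abs_integral_logPot_mul_le (c : ℝ) {B : ℝ} (hgi : Integrable g)
    (hg : Integrable fun x => g x * (1 + ‖x‖)) (hg0 : ∫ x, g x = 0) (hB0 : 0 ≤ B)
    (hB : ∫⁻ τ in Set.Ioi (0 : ℝ), ENNReal.ofReal (|gaussForm ρ g τ| / τ) ≤ ENNReal.ofReal B) :
    |∫ x, logPot c ρ x * g x| ≤ B / (4 * π ^ 2) := by
  have hlp := h.integrable_log_prod hg
  have hms : AEStronglyMeasurable (fun p : E3 × E3 => g p.1 * ρ p.2 * -log (‖p.1 - p.2‖ ^ 2))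
      (volume.prod volume) :=
    (hgi.mul_prod h.integrable).aestronglyMeasurable.mul
      (Real.measurable_log.comp (by fun_prop : Measurable fun p : E3 × E3 =>
        ‖p.1 - p.2‖ ^ 2)).neg.aestronglyMeasurable
  have hbd : Integrable (fun p : E3 × E3 => 2 * |g p.1 * (|log ‖p.1 - p.2‖| * ρ p.2)|)
      (volume.prod volume) := hlp.abs.const_mul 2
  have hbe : ∀ p : E3 × E3, |g p.1 * ρ p.2| * |log (‖p.1 - p.2‖ ^ 2)|
      = 2 * |g p.1 * (|log ‖p.1 - p.2‖| * ρ p.2)| := fun p => by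
    rw [Real.log_pow, abs_mul, abs_mul, abs_mul, abs_mul, abs_abs]
    push_cast
    rw [abs_two]
    ring
  have hlog : Integrable (fun p : E3 × E3 => g p.1 * ρ p.2 * -log (‖p.1 - p.2‖ ^ 2))
      (volume.prod volume) := by
    refine hbd.mono' hms (Eventually.of_forall fun p => ?_)
    rw [norm_mul, norm_neg, Real.norm_eq_abs, Real.norm_eq_abs, hbe]
  have hdiag : ∀ᵐ p : E3 × E3 ∂(volume.prod volume), p.1 ≠ p.2 := by
    refine (Measure.ae_prod_iff_ae_ae ?_).2 (Eventually.of_forall fun x => ?_)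
    · exact (isClosed_eq continuous_fst continuous_snd).measurableSet.compl
    · filter_upwards [Measure.ae_ne volume x] with y hy using hy.symm
  have hn : ∀ n : ℕ, (0 : ℝ) < (n : ℝ) + 1 := fun n => by positivity
  have hn' : ∀ n : ℕ, ((n : ℝ) + 1)⁻¹ ≤ (n : ℝ) + 1 := fun n =>
    (inv_le_one_of_one_le₀ (by simp)).trans (by simp)
  set κ : ℕ → ℝ → ℝ := fun n u => ∫ τ in ((n : ℝ) + 1)⁻¹..(n : ℝ) + 1, exp (-u / τ) / τ with hκ
  have hF := fun n => integral_gaussForm_div hgi h.integrable (inv_pos.2 (hn n)) (hn' n)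
  have hgρ : Integrable (fun p : E3 × E3 => g p.1 * ρ p.2) (volume.prod volume) :=
    hgi.mul_prod h.integrable
  have hgρ0 : ∫ p : E3 × E3, g p.1 * ρ p.2 ∂(volume.prod volume) = 0 := by
    rw [integral_prod_mul, hg0, zero_mul]
  have hFi : ∀ n, Integrable (fun p : E3 × E3 =>
      g p.1 * ρ p.2 * (κ n (‖p.1 - p.2‖ ^ 2) - κ n 1)) (volume.prod volume) := fun n =>
    ((hF n).1.sub (hgρ.mul_const (κ n 1))).congr (Eventually.of_forall fun p => by
      simp only [hκ, Pi.sub_apply]; ring)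
  have hFv : ∀ n, |∫ p : E3 × E3, g p.1 * ρ p.2 * (κ n (‖p.1 - p.2‖ ^ 2) - κ n 1)
      ∂(volume.prod volume)| ≤ B := by
    intro n
    simp_rw [mul_sub]
    rw [integral_sub (hF n).1 (hgρ.mul_const (κ n 1)), integral_mul_const, hgρ0, zero_mul,
      sub_zero, (hF n).2]
    simp_rw [gaussForm_comm g ρ]
    exact abs_integral_gaussForm_div_le (inv_pos.2 (hn n)) (hn' n) hB0 hB
  have hlim : Tendsto (fun n => ∫ p : E3 × E3, g p.1 * ρ p.2 * (κ n (‖p.1 - p.2‖ ^ 2) - κ n 1)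
      ∂(volume.prod volume)) atTop
      (nhds (∫ p : E3 × E3, g p.1 * ρ p.2 * -log (‖p.1 - p.2‖ ^ 2) ∂(volume.prod volume))) := by
    refine tendsto_integral_of_dominated_convergence _ (fun n => (hFi n).aestronglyMeasurable) hbd
      (fun n => ?_) ?_
    · filter_upwards [hdiag] with p hp
      have hu : 0 < ‖p.1 - p.2‖ ^ 2 := by
        have := norm_pos_iff.2 (sub_ne_zero.2 hp)
        positivity
      rw [norm_mul, Real.norm_eq_abs, Real.norm_eq_abs, ← hbe]
      exact mul_le_mul_of_nonneg_left
        (abs_integral_exp_div_sub_le (inv_pos.2 (hn n)) (hn n) hu) (abs_nonneg _)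
    · filter_upwards [hdiag] with p hp
      have hu : 0 < ‖p.1 - p.2‖ ^ 2 := by
        have := norm_pos_iff.2 (sub_ne_zero.2 hp)
        positivity
      exact (tendsto_integral_exp_div_sub hu).const_mul _
  have hle : |∫ p : E3 × E3, g p.1 * ρ p.2 * -log (‖p.1 - p.2‖ ^ 2) ∂(volume.prod volume)| ≤ B :=
    le_of_tendsto hlim.abs (Eventually.of_forall hFv)
  have hin : ∀ x, ∫ y, g x * ρ y * -log (‖x - y‖ ^ 2)
      = 2 * (g x * ∫ y, -log ‖x - y‖ * ρ y) := fun x => by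
    rw [← integral_const_mul, ← integral_const_mul]
    refine integral_congr_ae (Eventually.of_forall fun y => ?_)
    simp only [Real.log_pow]
    push_cast
    ring
  have hpi := hlog.integral_prod_left
  simp only [hin] at hpi
  rw [integral_prod _ hlog] at hle
  simp only [hin] at hle
  have hw : ∫ x, logPot c ρ x * g x
      = 1 / (4 * π ^ 2) * ∫ x, 2 * (g x * ∫ y, -log ‖x - y‖ * ρ y) := by
    have e : ∀ x, logPot c ρ x * g x = c * g x +
        1 / (4 * π ^ 2) * (2 * (g x * ∫ y, -log ‖x - y‖ * ρ y)) := fun x => by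
      unfold logPot
      field_simp
      ring
    simp_rw [e]
    rw [integral_add (hgi.const_mul c) (hpi.const_mul _), integral_const_mul, hg0, mul_zero,
      zero_add, integral_const_mul]
  rw [hw, abs_mul, abs_of_pos (by positivity), one_div, inv_mul_eq_div]
  gcongr

end DecayDens

end LogForm

section ThirdDerivatives

lemma integrable_sq_of_hasCompactSupport {φ : E3 → ℝ} (hφ : Continuous φ)
    (hs : HasCompactSupport φ) : Integrable fun x => φ x ^ 2 := by
  have : Integrable fun x => φ x * φ x :=
    (hφ.mul hφ).integrable_of_hasCompactSupport hs.mul_left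
  simpa only [sq] using this

lemma integral_sqrt_mul_sqrt_le {P Q : E3 → ℝ} (hP : Integrable P) (hQ : Integrable Q)
    (hP0 : ∀ ξ, 0 ≤ P ξ) (hQ0 : ∀ ξ, 0 ≤ Q ξ) :
    Integrable (fun ξ => √(P ξ) * √(Q ξ)) ∧
      ∫ ξ, √(P ξ) * √(Q ξ) ≤ √(∫ ξ, P ξ) * √(∫ ξ, Q ξ) := by
  have hm : ∀ {P : E3 → ℝ}, Integrable P → AEStronglyMeasurable (fun ξ => √(P ξ)) volume :=
    fun hP => Real.continuous_sqrt.comp_aestronglyMeasurable hP.aestronglyMeasurable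
  have hL : ∀ {P : E3 → ℝ}, Integrable P → (∀ ξ, 0 ≤ P ξ) →
      MemLp (fun ξ => √(P ξ)) (ENNReal.ofReal 2) volume := fun {P} hP hP0 => by
    rw [show ENNReal.ofReal 2 = 2 by simp]
    refine (memLp_two_iff_integrable_sq (hm hP)).2 (hP.congr (Eventually.of_forall fun ξ => ?_))
    simp only [Real.sq_sqrt (hP0 ξ)]
  refine ⟨?_, ?_⟩
  · refine (hP.add hQ).mono' ((hm hP).mul (hm hQ)) (Eventually.of_forall fun ξ => ?_)
    rw [Real.norm_of_nonneg (by positivity), Pi.add_apply]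
    nlinarith [Real.sq_sqrt (hP0 ξ), Real.sq_sqrt (hQ0 ξ), sq_nonneg (√(P ξ) - √(Q ξ)),
      hP0 ξ, hQ0 ξ]
  · have h := integral_mul_le_Lp_mul_Lq_of_nonneg Real.HolderConjugate.two_two
      (Eventually.of_forall fun ξ => Real.sqrt_nonneg (P ξ))
      (Eventually.of_forall fun ξ => Real.sqrt_nonneg (Q ξ)) (hL hP hP0) (hL hQ hQ0)
    simp_rw [Real.rpow_two, fun ξ => Real.sq_sqrt (hP0 ξ), fun ξ => Real.sq_sqrt (hQ0 ξ),
      ← Real.sqrt_eq_rpow] at h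
    exact h

lemma DecayDens.exists_abs_integral_logPot_mul_le {ρ : E3 → ℝ} {D : ℝ} (h : DecayDens ρ D)
    (c : ℝ) : ∃ C, ∀ (i j k : Fin 3) (φ : E3 → ℝ), ContDiff ℝ (⊤ : ℕ∞) φ → HasCompactSupport φ →
      |∫ x, logPot c ρ x * pd i (pd j (pd k φ)) x| ≤ C * √(∫ x, φ x ^ 2) := by
  have hρ2 : Integrable fun x => ρ x ^ 2 := by
    refine (h.integrable.const_mul D).mono' (h.meas.pow_const 2).aestronglyMeasurable
      (Eventually.of_forall fun x => ?_)
    rw [Real.norm_of_nonneg (sq_nonneg _), sq]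
    exact mul_le_mul_of_nonneg_right (h.le_const x) (h.nonneg x)
  set c₀ := (4 * π) ^ (-(3 / 2) : ℝ) * (8 * Gamma (3 / 2)) with hc₀
  have hc₀' : 0 ≤ c₀ := by
    have := Gamma_pos_of_pos (s := 3 / 2) (by norm_num)
    positivity
  set P := ∫ ξ, powerSpec ρ ξ
  refine ⟨c₀ * (√P * √((2 * π) ^ 3)) / (4 * π ^ 2), fun i j k φ hφ hs => ?_⟩
  have hg := contDiff_pd i (contDiff_pd j (contDiff_pd k hφ))
  have hgs := hasCompactSupport_pd i (hasCompactSupport_pd j (hasCompactSupport_pd k hs))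
  have hφi := hφ.continuous.integrable_of_hasCompactSupport (μ := volume) hs
  have hgi := hg.continuous.integrable_of_hasCompactSupport (μ := volume) hgs
  have hgi' : Integrable fun x => pd i (pd j (pd k φ)) x * (1 + ‖x‖) :=
    (hg.continuous.mul (by fun_prop)).integrable_of_hasCompactSupport hgs.mul_right
  have hg0 := integral_pd_eq_zero i (contDiff_pd j (contDiff_pd k hφ))
    (hasCompactSupport_pd j (hasCompactSupport_pd k hs))
  obtain ⟨hPρ, -⟩ := integrable_powerSpec h.integrable hρ2
  obtain ⟨hPφ, hPφ'⟩ := integrable_powerSpec hφi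
    (integrable_sq_of_hasCompactSupport hφ.continuous hs)
  obtain ⟨hi, hle⟩ := integral_sqrt_mul_sqrt_le hPρ hPφ (powerSpec_nonneg ρ) (powerSpec_nonneg φ)
  have hB := lintegral_gaussForm_le h.integrable hgi hφi (powerSpec_pd_pd_pd_le i j k hφ hs)
  rw [← ofReal_integral_eq_lintegral_ofReal (hi.const_mul _)
    (Eventually.of_forall fun ξ => mul_nonneg hc₀' (by positivity)), integral_const_mul] at hB
  have hB0 : 0 ≤ c₀ * ∫ ξ, √(powerSpec ρ ξ) * √(powerSpec φ ξ) :=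
    mul_nonneg hc₀' (integral_nonneg fun ξ => by positivity)
  refine (h.abs_integral_logPot_mul_le c hgi hgi' hg0 hB0 hB).trans ?_
  rw [div_mul_eq_mul_div]
  refine div_le_div_of_nonneg_right ?_ (by positivity)
  rw [mul_assoc c₀]
  refine mul_le_mul_of_nonneg_left (hle.trans ?_) hc₀'
  rw [mul_assoc, ← Real.sqrt_mul (by positivity : (0 : ℝ) ≤ (2 * π) ^ 3)]
  exact mul_le_mul_of_nonneg_left (Real.sqrt_le_sqrt hPφ') (Real.sqrt_nonneg _)

lemma exists_inner_eq_of_abs_le {X H : Type*} [AddCommGroup X] [Module ℝ X]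
    [NormedAddCommGroup H] [InnerProductSpace ℝ H] [CompleteSpace H] (T : X →ₗ[ℝ] H)
    (ℓ : X →ₗ[ℝ] ℝ) {C : ℝ} (hℓ : ∀ x, |ℓ x| ≤ C * ‖T x‖) :
    ∃ g : H, ∀ x, ℓ x = inner ℝ g (T x) := by
  obtain ⟨S, hS⟩ := T.rangeRestrict.exists_rightInverse_of_surjective T.range_rangeRestrict
  have hS' : ∀ y, T (S y) = y := fun y => by
    have := congrArg Subtype.val (LinearMap.congr_fun hS y)
    simpa using this
  set L : LinearMap.range T →L[ℝ] ℝ := (ℓ.comp S).mkContinuous C fun y => by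
    have := hℓ (S y)
    rw [hS'] at this
    simpa using this
  obtain ⟨G, hG, -⟩ := exists_extension_norm_eq (LinearMap.range T) L
  refine ⟨(InnerProductSpace.toDual ℝ H).symm G, fun x => ?_⟩
  rw [InnerProductSpace.toDual_symm_apply]
  have h1 := hG ⟨T x, LinearMap.mem_range_self T x⟩
  simp only at h1
  rw [h1]
  change ℓ x = ℓ (S _)
  have h2 := hℓ (x - S ⟨T x, LinearMap.mem_range_self T x⟩)
  rw [map_sub T, hS', sub_self, norm_zero, mul_zero, map_sub] at h2
  exact sub_eq_zero.1 (abs_nonpos_iff.1 h2)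

lemma pd_add (i : Fin 3) {f g : E3 → ℝ} (hf : ContDiff ℝ (⊤ : ℕ∞) f)
    (hg : ContDiff ℝ (⊤ : ℕ∞) g) : pd i (f + g) = pd i f + pd i g := by
  ext x
  simp only [pd, Pi.add_apply]
  rw [fderiv_add (hf.differentiable (by simp) x) (hg.differentiable (by simp) x)]
  rfl

lemma pd_smul (i : Fin 3) (a : ℝ) {f : E3 → ℝ} (hf : ContDiff ℝ (⊤ : ℕ∞) f) :
    pd i (a • f) = a • pd i f := by
  ext x
  simp only [pd, Pi.smul_apply]
  rw [fderiv_const_smul (hf.differentiable (by simp) x)]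
  rfl

/-- The space of smooth compactly supported functions. -/
def testSpace : Submodule ℝ (E3 → ℝ) where
  carrier := {φ | ContDiff ℝ (⊤ : ℕ∞) φ ∧ HasCompactSupport φ}
  add_mem' hf hg := ⟨hf.1.add hg.1, hf.2.add hg.2⟩
  zero_mem' := ⟨contDiff_const, HasCompactSupport.zero⟩
  smul_mem' _ _ hf := ⟨contDiff_const.smul hf.1, hf.2.smul_left⟩

lemma exists_weak_third_derivative {w : E3 → ℝ} (hw : Continuous w) {C : ℝ} {i j k : Fin 3}
    (hC : ∀ φ : E3 → ℝ, ContDiff ℝ (⊤ : ℕ∞) φ → HasCompactSupport φ →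
      |∫ x, w x * pd i (pd j (pd k φ)) x| ≤ C * √(∫ x, φ x ^ 2)) :
    ∃ g : E3 → ℝ, Integrable (fun x => g x ^ 2) ∧
      ∀ φ : E3 → ℝ, ContDiff ℝ (⊤ : ℕ∞) φ → HasCompactSupport φ →
        ∫ x, w x * pd i (pd j (pd k φ)) x = ∫ x, g x * φ x := by
  have hL : ∀ φ : testSpace, MemLp (φ : E3 → ℝ) 2 volume := fun φ =>
    (memLp_two_iff_integrable_sq φ.2.1.continuous.aestronglyMeasurable).2
      (integrable_sq_of_hasCompactSupport φ.2.1.continuous φ.2.2)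
  have hi : ∀ φ : testSpace, Integrable fun x => w x * pd i (pd j (pd k φ)) x := fun φ =>
    (hw.mul (contDiff_pd i (contDiff_pd j (contDiff_pd k φ.2.1))).continuous
      ).integrable_of_hasCompactSupport
      (hasCompactSupport_pd i (hasCompactSupport_pd j (hasCompactSupport_pd k φ.2.2))).mul_left
  let T : testSpace →ₗ[ℝ] Lp ℝ 2 (volume : Measure E3) :=
    { toFun := fun φ => MemLp.toLp (φ : E3 → ℝ) (hL φ)
      map_add' := fun φ ψ => MemLp.toLp_add (hL φ) (hL ψ)
      map_smul' := fun a φ => MemLp.toLp_const_smul a (hL φ) }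
  let ℓ : testSpace →ₗ[ℝ] ℝ :=
    { toFun := fun φ => ∫ x, w x * pd i (pd j (pd k φ)) x
      map_add' := fun φ ψ => by
        rw [← integral_add (hi φ) (hi ψ)]
        refine integral_congr_ae (Eventually.of_forall fun x => ?_)
        simp only [Submodule.coe_add]
        rw [pd_add k φ.2.1 ψ.2.1, pd_add j (contDiff_pd k φ.2.1) (contDiff_pd k ψ.2.1),
          pd_add i (contDiff_pd j (contDiff_pd k φ.2.1)) (contDiff_pd j (contDiff_pd k ψ.2.1)),
          Pi.add_apply, mul_add]
      map_smul' := fun a φ => by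
        rw [RingHom.id_apply, smul_eq_mul, ← integral_const_mul]
        refine integral_congr_ae (Eventually.of_forall fun x => ?_)
        simp only [Submodule.coe_smul]
        rw [pd_smul k a φ.2.1, pd_smul j a (contDiff_pd k φ.2.1),
          pd_smul i a (contDiff_pd j (contDiff_pd k φ.2.1)), Pi.smul_apply, smul_eq_mul]
        ring }
  have hT : ∀ φ : testSpace, ‖T φ‖ = √(∫ x, (φ : E3 → ℝ) x ^ 2) := fun φ => by
    rw [← Real.sqrt_sq (norm_nonneg (T φ)), ← real_inner_self_eq_norm_sq, L2.inner_def]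
    congr 1
    refine integral_congr_ae ?_
    filter_upwards [(hL φ).coeFn_toLp] with x hx
    change inner ℝ ((hL φ).toLp (φ : E3 → ℝ) x) ((hL φ).toLp (φ : E3 → ℝ) x) = _
    rw [hx, real_inner_self_eq_norm_sq, Real.norm_eq_abs, sq_abs]
  obtain ⟨g, hg⟩ := exists_inner_eq_of_abs_le T ℓ (C := C) fun φ => by
    rw [hT]
    exact hC φ φ.2.1 φ.2.2
  refine ⟨g, (Lp.memLp g).integrable_sq, fun φ hφ hs => ?_⟩
  refine (hg ⟨φ, hφ, hs⟩).trans ?_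
  rw [L2.inner_def]
  refine integral_congr_ae ?_
  filter_upwards [(hL ⟨φ, hφ, hs⟩).coeFn_toLp] with x hx
  change inner ℝ (g x) ((hL ⟨φ, hφ, hs⟩).toLp φ x) = _
  rw [hx, real_inner_comm]
  rfl

end ThirdDerivatives

lemma DecayDens.exists_weak_derivative {ρ : E3 → ℝ} {D : ℝ} (h : DecayDens ρ D) (c : ℝ)
    (β : Fin 3 → ℕ) (hβ : ∑ i, β i ≤ 3) :
    ∃ g : E3 → ℝ, LocallyIntegrable (fun x => (g x) ^ 2) volume ∧
      ∀ φ : E3 → ℝ, ContDiff ℝ (⊤ : ℕ∞) φ → HasCompactSupport φ →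
        ∫ x, logPot c ρ x * pdM β φ x = (-1 : ℝ) ^ (∑ i, β i) * ∫ x, g x * φ x := by
  obtain ⟨l, hl, hpd⟩ := exists_list_pdM β
  simp_rw [hpd]
  rw [← hl] at hβ ⊢
  have hw := h.differentiable_logPot c
  have hb1 : ∀ i, ∃ B, ∀ x, |pd i (logPot c ρ) x| ≤ B := fun i => h.exists_fderiv_logPot_le c _
  have hw1 : ∀ i, Differentiable ℝ (pd i (logPot c ρ)) := fun i x =>
    (h.hasFDerivAt_fderiv_logPot c _ x).differentiableAt
  have hb2 : ∀ i j, ∃ B, ∀ x, |pd j (pd i (logPot c ρ)) x| ≤ B := fun i j =>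
    h.exists_fderiv_fderiv_logPot_le c _ _
  match l, hβ with
  | [], _ =>
    refine ⟨logPot c ρ, (hw.continuous.pow 2).locallyIntegrable, fun φ _ _ => ?_⟩
    simp
  | [i], _ =>
    refine ⟨pd i (logPot c ρ), ((hw1 i).continuous.pow 2).locallyIntegrable, fun φ hφ hs => ?_⟩
    simpa using integral_mul_pd i hw (hb1 i) hφ hs
  | [i, j], _ =>
    obtain ⟨B, hB⟩ := hb2 i j
    refine ⟨pd j (pd i (logPot c ρ)), ?_, fun φ hφ hs => ?_⟩
    · refine locallyIntegrable_of_bounded (B := B ^ 2)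
        ((measurable_fderiv_apply_const ℝ _ _).pow_const 2) fun x => ?_
      rw [abs_pow]
      exact pow_le_pow_left₀ (abs_nonneg _) (hB x) 2
    · have h1 := integral_mul_pd i hw (hb1 i) (contDiff_pd j hφ) (hasCompactSupport_pd j hs)
      have h2 := integral_mul_pd j (hw1 i) ⟨B, hB⟩ hφ hs
      simpa [h2] using h1
  | [i, j, k], _ =>
    obtain ⟨C, hC⟩ := h.exists_abs_integral_logPot_mul_le c
    obtain ⟨g, hg, hgφ⟩ := exists_weak_third_derivative hw.continuous (hC i j k)
    refine ⟨fun x => -g x, ?_, fun φ hφ hs => ?_⟩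
    · simpa using hg.locallyIntegrable
    · have h1 := hgφ φ hφ hs
      simp only [neg_mul, integral_neg, ← h1]
      norm_num
  | _ :: _ :: _ :: _ :: _, hβ => simp at hβ; omega

/-- Theorem 1 (prescribed `Q`-curvature): if `K ∈ L^∞(ℝ³)` is positive with
`K(x) ≤ C₀|x|^{−s}` for `|x| ≥ 1`, then for every `μ ∈ (0, min{s/6, 1})` there is a
solution `w ∈ H³_{loc}` (all weak derivatives up to order 3 in `L²_{loc}`) of
`(−Δ)^{3/2}w = K e^{3w}` in ℝ³ with `∫ K e^{3w} = 2(1−μ)|S³| = 4π²(1−μ)`. -/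
theorem prescribed_Q_curvature_existence (K : E3 → ℝ) (hKmeas : Measurable K)
    (hKpos : ∀ x, 0 < K x) (hKbdd : ∃ C : ℝ, ∀ x, K x ≤ C)
    (s C₀ : ℝ) (hs : 0 < s) (hC₀ : 0 < C₀)
    (hKdecay : ∀ x : E3, 1 ≤ ‖x‖ → K x ≤ C₀ * ‖x‖ ^ (-s))
    (μ : ℝ) (hμ : μ ∈ Set.Ioo 0 (min (s / 6) 1)) :
    ∃ w : E3 → ℝ,
      (∀ β : Fin 3 → ℕ, (∑ i, β i) ≤ 3 →
        ∃ g : E3 → ℝ, LocallyIntegrable (fun x => (g x) ^ 2) volume ∧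
          ∀ φ : E3 → ℝ, ContDiff ℝ (⊤ : ℕ∞) φ → HasCompactSupport φ →
            ∫ x, w x * pdM β φ x = (-1 : ℝ) ^ (∑ i, β i) * ∫ x, g x * φ x) ∧
      MemL12 (lap w) ∧
      Integrable (fun x => K x * Real.exp (3 * w x)) volume ∧
      (∫ x, K x * Real.exp (3 * w x)) = 4 * Real.pi ^ 2 * (1 - μ) ∧
      ∀ φ : SchwartzMap E3 ℝ,
        ∫ x, (-(lap w x)) * halfLap φ x = ∫ x, K x * Real.exp (3 * w x) * φ x := by
  obtain ⟨ρ, c, D, hm, h0, hle, h_integrable, heq⟩ :=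
    exists_density K hKmeas hKpos hKbdd s C₀ hC₀ hKdecay μ hμ
  have h : DecayDens ρ D := ⟨hm, h0, hle⟩
  have hK : ∀ x, K x * Real.exp (3 * logPot c ρ x) = ρ x := heq
  refine ⟨logPot c ρ, h.exists_weak_derivative c, h.memL12_lap_logPot c, ?_, ?_, fun φ => ?_⟩
  · simpa only [hK] using h.integrable
  · simpa only [hK] using h_integrable
  · simpa only [hK] using h.integral_neg_lap_mul_halfLap c φ
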